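/- There exist constants α > 0 and C < ∞ such that the following holds for all n = 2^{j₀}, m = 2^{−i₀}n as above. Let k₁ < k₂ with the x-coordinates of H_{k₁} contained in I_{j₁} and those of H_{k₂} contained in I_{j₂}, where j₂ − j₁ ≥ 5. Then P(Q_n ∩ H_{k₁} ≠ ∅ and Q_n ∩ H_{k₂} ≠ ∅) ≤ C·(m/n)⁴·2^{2j₁+(1−α)j₂}. -/

import Mathlib

/-!
Critical site percolation on the triangular lattice realized on `ℤ²`.
A configuration assigns to each site `true` (open) or `false` (closed),
and `P` is the product Bernoulli(1/2) measure, axiomatized by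
`IsBernoulliHalf` below (finite cylinder events have product probability).
-/

open MeasureTheory
open scoped ENNReal

/-- Sites of the lattice: vertices of `ℤ²`. -/
abbrev Site : Type := ℤ × ℤ

/-- A percolation configuration: `true` = open, `false` = closed. -/
abbrev Config : Type := Site → Bool

/-- Adjacency for the triangular lattice realized on `ℤ²`:
the neighbors of `(x,y)` are `(x±1,y)`, `(x,y±1)`, `(x+1,y-1)`, `(x-1,y+1)`. -/
def Adj (a b : Site) : Prop :=
  (b.1 - a.1, b.2 - a.2) ∈
    ({(1, 0), (-1, 0), (0, 1), (0, -1), (1, -1), (-1, 1)} : Set (ℤ × ℤ))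

/-- A (nonempty, self-avoiding) lattice path: a list of distinct sites in which
consecutive sites are neighbors. -/
def IsPath (p : List Site) : Prop := p ≠ [] ∧ p.Nodup ∧ p.Chain' Adj

/-- A path all of whose vertices lie in the set `S`. -/
def PathIn (S : Set Site) (p : List Site) : Prop := IsPath p ∧ ∀ v ∈ p, v ∈ S

/-- All sites of `p` are open in `ω`. -/
def IsOpenOn (ω : Config) (p : List Site) : Prop := ∀ v ∈ p, ω v = true

/-- All sites of `p` are closed in `ω`. -/
def IsClosedOn (ω : Config) (p : List Site) : Prop := ∀ v ∈ p, ω v = false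

/-- The first vertex of `p` lies in `A`. -/
def FirstIn (A : Set Site) (p : List Site) : Prop := ∃ a ∈ A, p.head? = some a

/-- The last vertex of `p` lies in `A`. -/
def LastIn (A : Set Site) (p : List Site) : Prop := ∃ a ∈ A, p.getLast? = some a

/-- `μ` is the product Bernoulli(1/2) measure on configurations: a probability
measure for which every finite cylinder event has the product probability. -/
def IsBernoulliHalf (μ : Measure Config) : Prop :=
  IsProbabilityMeasure μ ∧
    ∀ (S : Finset Site) (f : Site → Bool),
      μ {ω | ∀ v ∈ S, ω v = f v} = (1 / 2 : ℝ≥0∞) ^ S.card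

/-- The lattice rectangle `[x₀,x₁] × [y₀,y₁]`. -/
def rect (x₀ x₁ y₀ y₁ : ℤ) : Set Site :=
  {v | x₀ ≤ v.1 ∧ v.1 ≤ x₁ ∧ y₀ ≤ v.2 ∧ v.2 ≤ y₁}

/-- The left side of a rectangle. -/
def rectLeft (x₀ x₁ y₀ y₁ : ℤ) : Set Site := {v ∈ rect x₀ x₁ y₀ y₁ | v.1 = x₀}

/-- The right side of a rectangle. -/
def rectRight (x₀ x₁ y₀ y₁ : ℤ) : Set Site := {v ∈ rect x₀ x₁ y₀ y₁ | v.1 = x₁}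

/-- The top side of a rectangle. -/
def rectTop (x₀ x₁ y₀ y₁ : ℤ) : Set Site := {v ∈ rect x₀ x₁ y₀ y₁ | v.2 = y₁}

/-- The bottom side of a rectangle. -/
def rectBot (x₀ x₁ y₀ y₁ : ℤ) : Set Site := {v ∈ rect x₀ x₁ y₀ y₁ | v.2 = y₀}

/-- A horizontal open crossing of the rectangle `[x₀,x₁] × [y₀,y₁]`:
an open path in the rectangle from its left side to its right side. -/
def HorizCrossing (x₀ x₁ y₀ y₁ : ℤ) (ω : Config) (p : List Site) : Prop :=
  PathIn (rect x₀ x₁ y₀ y₁) p ∧ IsOpenOn ω p ∧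
    FirstIn (rectLeft x₀ x₁ y₀ y₁) p ∧ LastIn (rectRight x₀ x₁ y₀ y₁) p

/-- `v` is a pivotal site for the box `B(n) = [-n,n]²`: some horizontal open
crossing of `B(n)` contains `v`, and there are two disjoint closed paths in
`B(n)` started from `v` (i.e. starting at a neighbor of `v`), one to the top
side and one to the bottom side of `B(n)`. -/
def Pivotal (n : ℤ) (ω : Config) (v : Site) : Prop :=
  (∃ p, HorizCrossing (-n) n (-n) n ω p ∧ v ∈ p) ∧
    ∃ q₁ q₂ : List Site,
      PathIn (rect (-n) n (-n) n) q₁ ∧ IsClosedOn ω q₁ ∧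
        FirstIn {w | Adj v w} q₁ ∧ LastIn (rectTop (-n) n (-n) n) q₁ ∧
      PathIn (rect (-n) n (-n) n) q₂ ∧ IsClosedOn ω q₂ ∧
        FirstIn {w | Adj v w} q₂ ∧ LastIn (rectBot (-n) n (-n) n) q₂ ∧
      List.Disjoint q₁ q₂

/-- `Q_n`: the set of pivotal sites for `B(n)`. -/
def Qset (n : ℤ) (ω : Config) : Set Site := {v | Pivotal n ω v}

/-- The block `H_k`: `{(x,y) ∈ B(n) : -n+(k-1)m < x ≤ -n+km, -n ≤ y ≤ -n+m}`. -/
def Hblock (n m : ℤ) (k : ℕ) : Set Site :=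
  {v | -n + ((k : ℤ) - 1) * m < v.1 ∧ v.1 ≤ -n + (k : ℤ) * m ∧
        -n ≤ v.2 ∧ v.2 ≤ -n + m}

/-- The dyadic interval `I_j` (for `n = 2^j₀`, `m = 2^{j₀-i₀}`):
`I_j = (n - 2^{-j}n, n - 2^{-j-1}n]` for `j < i₀` and `I_{i₀} = (n-m, n]`. -/
def Iset (j₀ i₀ j : ℕ) : Set ℤ :=
  if j = i₀ then Set.Ioc ((2 : ℤ) ^ j₀ - 2 ^ (j₀ - i₀)) ((2 : ℤ) ^ j₀)
  else Set.Ioc ((2 : ℤ) ^ j₀ - 2 ^ (j₀ - j)) ((2 : ℤ) ^ j₀ - 2 ^ (j₀ - j - 1))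

namespace TriPerc

open Set

/-- The fair coin measure. -/
noncomputable def fair : Measure Bool :=
  (2 : ℝ≥0∞)⁻¹ • (Measure.dirac true + Measure.dirac false)

instance : IsProbabilityMeasure fair :=
  ⟨by simp [fair, ENNReal.inv_two_add_inv_two]⟩

lemma fair_map_not : fair.map (fun b => !b) = fair := by
  ext s _
  rw [Measure.map_apply (measurable_of_finite _) (by trivial)]
  have e1 : (true ∈ (fun b => !b) ⁻¹' s) ↔ false ∈ s := Iff.rfl
  have e2 : (false ∈ (fun b => !b) ⁻¹' s) ↔ true ∈ s := Iff.rfl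
  by_cases h1 : true ∈ s <;> by_cases h2 : false ∈ s <;>
    simp only [fair, Measure.smul_apply, Measure.add_apply, Measure.dirac_apply, Set.indicator,
      e1, e2, h1, h2, if_true, if_false, Pi.one_apply, add_zero, zero_add]

/-- The product of fair coins. -/
noncomputable def mu0 : Measure Config := Measure.infinitePi (fun _ => fair)

instance : IsProbabilityMeasure mu0 := by unfold mu0; infer_instance

/-- Probability of an event under the product of fair coins. -/
noncomputable def Pr (A : Set Config) : ℝ := mu0.real A

lemma eq_mu0 {μ : Measure Config} (h : IsBernoulliHalf μ) : μ = mu0 := by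
  classical
  obtain ⟨hp, hμ⟩ := h
  refine Measure.eq_infinitePi _ fun s t _ => ?_
  have e1 : (Set.pi (s : Set Site) t : Set Config) =
      ⋃ f ∈ (Finset.pi s (fun i => ({true, false} : Finset Bool).filter (fun b => b ∈ t i))),
        {ω : Config | ∀ v ∈ s, ω v = (fun v => if h : v ∈ s then f v h else true) v} := by
    ext ω
    simp only [Set.mem_pi, Finset.mem_coe, Set.mem_iUnion, Finset.mem_pi, Finset.mem_filter,
      Set.mem_ofPred_eq, exists_prop]
    constructor
    · intro h
      refine ⟨fun i _ => ω i, fun i hi => ⟨by cases ω i <;> simp, h i hi⟩, fun v hv => by simp [hv]⟩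
    · rintro ⟨f, hf, h⟩ i hi
      rw [h i hi]
      simpa [hi] using (hf i hi).2
  rw [e1, measure_biUnion_finset]
  · simp only [hμ]
    rw [Finset.sum_const, Finset.card_pi, nsmul_eq_mul, Nat.cast_prod, ← Finset.prod_const,
      ← Finset.prod_mul_distrib]
    refine Finset.prod_congr rfl fun i _ => ?_
    by_cases h1 : true ∈ t i <;> by_cases h2 : false ∈ t i <;>
      simp [fair, Set.indicator, h1, h2, Finset.filter_insert, Finset.filter_singleton,
        ENNReal.inv_two_add_inv_two, one_add_one_eq_two, ENNReal.mul_inv_cancel]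
  · intro f _ g _ hfg
    refine Set.disjoint_left.2 fun ω h1 h2 => hfg ?_
    funext i hi
    have := (h1 i hi).symm.trans (h2 i hi)
    simpa [hi] using this
  · intro f _
    have : {ω : Config | ∀ v ∈ s, ω v = (fun v => if h : v ∈ s then f v h else true) v} =
      ⋂ v ∈ s, (fun ω : Config => ω v) ⁻¹' {if h : v ∈ s then f v h else true} := by
      ext; simp
    rw [this]
    exact Finset.measurableSet_biInter _ fun v _ => (measurable_pi_apply v) trivial

/-- `A` depends only on the coordinates in `S`. -/
def Dep (S : Set Site) (A : Set Config) : Prop :=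
  ∀ ω ω' : Config, (∀ v ∈ S, ω v = ω' v) → (ω ∈ A ↔ ω' ∈ A)

section Dep
variable {S T : Set Site} {A B : Set Config}

lemma Dep.mono (h : Dep S A) (hST : S ⊆ T) : Dep T A :=
  fun ω ω' hh => h ω ω' fun v hv => hh v (hST hv)

lemma Dep.inter (hA : Dep S A) (hB : Dep S B) : Dep S (A ∩ B) :=
  fun ω ω' hh => and_congr (hA ω ω' hh) (hB ω ω' hh)

lemma Dep.compl (hA : Dep S A) : Dep S Aᶜ :=
  fun ω ω' hh => not_congr (hA ω ω' hh)

lemma dep_const (S : Set Site) (p : Prop) : Dep S {_ω | p} := fun _ _ _ => Iff.rfl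

lemma dep_of_imp (h : ∀ ω ω' : Config, (∀ v ∈ S, ω v = ω' v) → ω ∈ A → ω' ∈ A) : Dep S A :=
  fun ω ω' hh => ⟨h ω ω' hh, h ω' ω fun v hv => (hh v hv).symm⟩

/-- The section of `A` where the state of `v` is set to `b`. -/
def sec (v : Site) (b : Bool) (A : Set Config) : Set Config := {ω | Function.update ω v b ∈ A}

lemma sec_dep {v : Site} (b : Bool) (h : Dep (insert v S) A) : Dep S (sec v b A) := by
  intro ω ω' hh
  refine h _ _ fun w hw => ?_
  by_cases hwv : w = v
  · subst hwv; simp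
  · simp only [Function.update_of_ne hwv]
    exact hh w (hw.resolve_left hwv)

lemma sec_self {v : Site} {ω : Config} {b : Bool} (h : ω v = b) : ω ∈ sec v b A ↔ ω ∈ A := by
  simp only [sec, Set.mem_ofPred_eq]
  rw [← h, Function.update_eq_self]

lemma Dep.empty_or_univ (h : Dep ∅ A) : A = ∅ ∨ A = univ := by
  rcases A.eq_empty_or_nonempty with h0 | ⟨ω, hω⟩
  · exact Or.inl h0
  · exact Or.inr (Set.eq_univ_of_forall fun ω' => (h ω ω' (by simp)).1 hω)

lemma Dep.measurableSet (hS : S.Finite) (h : Dep S A) : MeasurableSet A := by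
  induction S, hS using Set.Finite.induction_on generalizing A with
  | empty => rcases h.empty_or_univ with rfl | rfl <;> simp
  | @insert v S hv hS ih =>
    have : A = (sec v true A ∩ (fun ω => ω v) ⁻¹' {true}) ∪
        (sec v false A ∩ (fun ω => ω v) ⁻¹' {false}) := by
      ext ω
      cases hb : ω v <;> simp [hb, sec_self hb]
    rw [this]
    have m : ∀ b : Bool, MeasurableSet ((fun ω : Config => ω v) ⁻¹' {b}) :=
      fun b => measurable_pi_apply v trivial
    exact ((ih (sec_dep _ h)).inter (m _)).union ((ih (sec_dep _ h)).inter (m _))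

end Dep

lemma Pr_nonneg (A : Set Config) : 0 ≤ Pr A := measureReal_nonneg

lemma Pr_le_one (A : Set Config) : Pr A ≤ 1 := measureReal_le_one

lemma Pr_mono {A B : Set Config} (h : A ⊆ B) : Pr A ≤ Pr B := measureReal_mono h

lemma Pr_union_le (A B : Set Config) : Pr (A ∪ B) ≤ Pr A + Pr B := measureReal_union_le _ _

lemma Pr_univ : Pr univ = 1 := by simp [Pr]

lemma Pr_empty : Pr ∅ = 0 := by simp [Pr]

lemma Pr_biUnion_le {ι : Type*} (s : Finset ι) (A : ι → Set Config) :
    Pr (⋃ i ∈ s, A i) ≤ ∑ i ∈ s, Pr (A i) :=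
  measureReal_biUnion_finset_le s A

lemma Pr_compl {S : Set Site} {A : Set Config} (hS : S.Finite) (h : Dep S A) :
    Pr Aᶜ = 1 - Pr A := by
  simp only [Pr]
  rw [measureReal_compl (h.measurableSet hS)]
  simp

lemma Pr_union_add_inter {S : Set Site} {A B : Set Config} (hS : S.Finite) (h : Dep S B) :
    Pr (A ∪ B) + Pr (A ∩ B) = Pr A + Pr B :=
  measureReal_union_add_inter (h.measurableSet hS)

/-- Global colour flip. -/
def flip (ω : Config) : Config := fun v => !(ω v)

lemma flip_flip (ω : Config) : flip (flip ω) = ω := by funext v; simp [flip]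

lemma Pr_preimage_of_map {f : Config → Config} (hf : Measurable f) (h : mu0.map f = mu0)
    (g : Config → Config) (hg : Measurable g) (hfg : ∀ ω, g (f ω) = ω) (h' : mu0.map g = mu0)
    (hgf : ∀ ω, f (g ω) = ω) (A : Set Config) : Pr (f ⁻¹' A) = Pr A := by
  have e : Config ≃ᵐ Config := ⟨⟨f, g, hfg, hgf⟩, hf, hg⟩
  have := (MeasurableEquiv.map_apply (⟨⟨f, g, hfg, hgf⟩, hf, hg⟩ : Config ≃ᵐ Config)
    (μ := mu0) A)
  simp only [MeasurableEquiv.coe_mk, Equiv.coe_fn_mk, h] at this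
  simp [Pr, Measure.real, this]

lemma measurable_flip : Measurable flip :=
  measurable_pi_lambda _ fun v => (measurable_of_finite (fun b : Bool => !b)).comp
    (measurable_pi_apply v)

lemma mu0_flip : mu0.map flip = mu0 := by
  have := Measure.infinitePi_map_pi (ι := Site) (X := fun _ => Bool) (Y := fun _ => Bool)
    (fun _ => fair) (f := fun _ b => !b) (fun _ => measurable_of_finite _)
  simp only [fair_map_not] at this
  exact this

lemma Pr_flip (A : Set Config) : Pr (flip ⁻¹' A) = Pr A :=
  Pr_preimage_of_map measurable_flip mu0_flip flip measurable_flip flip_flip mu0_flip flip_flip A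

lemma measurable_reindex (e : Site ≃ Site) : Measurable (fun (ω : Config) v => ω (e v)) :=
  measurable_pi_lambda _ fun v => measurable_pi_apply (e v)

lemma mu0_reindex (e : Site ≃ Site) : mu0.map (fun (ω : Config) v => ω (e v)) = mu0 := by
  have := Measure.infinitePi_map_piCongrLeft (X := fun _ => Bool) (fun _ : Site => fair) e.symm
  have h2 : (MeasurableEquiv.piCongrLeft (fun _ : Site => Bool) e.symm : Config → Config) =
      (fun (ω : Config) v => ω (e v)) := by
    funext ω v
    simp [MeasurableEquiv.coe_piCongrLeft, Equiv.piCongrLeft, Equiv.piCongrLeft']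
  rw [h2] at this
  exact this

lemma Pr_reindex (e : Site ≃ Site) (A : Set Config) :
    Pr ((fun (ω : Config) v => ω (e v)) ⁻¹' A) = Pr A :=
  Pr_preimage_of_map (measurable_reindex e) (mu0_reindex e) (fun ω v => ω (e.symm v))
    (measurable_reindex e.symm) (fun ω => by funext v; simp) (mu0_reindex e.symm)
    (fun ω => by funext v; simp) A

/-- Flip of a single coordinate. -/
def flipAt (v : Site) (ω : Config) : Config := fun w => if w = v then !(ω w) else ω w

lemma flipAt_flipAt (v : Site) (ω : Config) : flipAt v (flipAt v ω) = ω := by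
  funext w; by_cases h : w = v <;> simp [flipAt, h]

lemma measurable_flipAt (v : Site) : Measurable (flipAt v) := by
  refine measurable_pi_lambda _ fun w => ?_
  by_cases h : w = v
  · simp only [flipAt, h, if_true]
    exact (measurable_of_finite (fun b : Bool => !b)).comp (measurable_pi_apply v)
  · simp only [flipAt, h, if_false]
    exact measurable_pi_apply w

lemma mu0_flipAt (v : Site) : mu0.map (flipAt v) = mu0 := by
  have := Measure.infinitePi_map_pi (ι := Site) (X := fun _ => Bool) (Y := fun _ => Bool)
    (fun _ => fair) (f := fun w b => if w = v then !b else b) (fun _ => measurable_of_finite _)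
  have h2 : ∀ w : Site, fair.map (fun b => if w = v then !b else b) = fair := by
    intro w
    by_cases h : w = v
    · simp only [h, if_true]; exact fair_map_not
    · simp [h]
  simp only [h2] at this
  exact this

lemma Pr_flipAt (v : Site) (A : Set Config) : Pr (flipAt v ⁻¹' A) = Pr A :=
  Pr_preimage_of_map (measurable_flipAt v) (mu0_flipAt v) (flipAt v) (measurable_flipAt v)
    (flipAt_flipAt v) (mu0_flipAt v) (flipAt_flipAt v) A

lemma Pr_split {S : Set Site} (hS : S.Finite) {A : Set Config} (h : Dep S A) (v : Site) :
    Pr A = (Pr (sec v true A) + Pr (sec v false A)) / 2 := by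
  have m : ∀ b : Bool, MeasurableSet ((fun ω : Config => ω v) ⁻¹' {b}) :=
    fun b => measurable_pi_apply v trivial
  have key : ∀ b : Bool, Pr (sec v b A) = 2 * Pr (A ∩ (fun ω => ω v) ⁻¹' {b}) := by
    intro b
    have e1 : Pr (sec v b A) = Pr (sec v b A ∩ (fun ω => ω v) ⁻¹' {b}) +
        Pr (sec v b A \ (fun ω => ω v) ⁻¹' {b}) :=
      (measureReal_inter_add_diff (m b)).symm
    have e2 : sec v b A ∩ (fun ω => ω v) ⁻¹' {b} = A ∩ (fun ω => ω v) ⁻¹' {b} := by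
      ext ω
      simp only [Set.mem_inter_iff, Set.mem_preimage, Set.mem_singleton_iff]
      exact and_congr_left fun hb => sec_self hb
    have e3 : sec v b A \ (fun ω => ω v) ⁻¹' {b} =
        flipAt v ⁻¹' (sec v b A ∩ (fun ω => ω v) ⁻¹' {b}) := by
      ext ω
      have : Function.update (flipAt v ω) v b = Function.update ω v b := by
        funext w; by_cases h : w = v
        · subst h; simp
        · simp [flipAt, h]
      simp only [sec, Set.mem_sdiff, Set.mem_ofPred_eq, Set.mem_preimage, Set.mem_singleton_iff,
        Set.mem_inter_iff, this]
      refine and_congr_right fun _ => ?_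
      cases hb : ω v <;> cases b <;> simp [flipAt, hb]
    rw [e3, Pr_flipAt, e2] at e1
    linarith
  have e : Pr A = Pr (A ∩ (fun ω => ω v) ⁻¹' {true}) + Pr (A \ (fun ω => ω v) ⁻¹' {true}) :=
    (measureReal_inter_add_diff (m true)).symm
  have e2 : A \ (fun ω => ω v) ⁻¹' {true} = A ∩ (fun ω => ω v) ⁻¹' {false} := by
    ext ω; simp
  rw [key, key, e, e2]
  ring

lemma sec_inter (v : Site) (b : Bool) (A B : Set Config) :
    sec v b (A ∩ B) = sec v b A ∩ sec v b B := rfl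

lemma sec_dep' {S : Set Site} {A : Set Config} (v : Site) (b : Bool) (h : Dep S A) :
    Dep (S \ {v}) (sec v b A) := by
  intro ω ω' hh
  refine h _ _ fun w hw => ?_
  by_cases hwv : w = v
  · subst hwv; simp
  · simp only [Function.update_of_ne hwv]
    exact hh w ⟨hw, hwv⟩

lemma sec_eq_of_notMem {S : Set Site} {A : Set Config} {v : Site} (b : Bool) (h : Dep S A)
    (hv : v ∉ S) : sec v b A = A := by
  ext ω
  refine h _ _ fun w hw => ?_
  exact Function.update_of_ne (by rintro rfl; exact hv hw) _ _

/-- Monotonicity of an event in the coordinates of `X` alone (more open sites is better). -/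
def IncOn (X : Set Site) (A : Set Config) : Prop :=
  ∀ ω ω' : Config, (∀ v ∈ X, ω v = true → ω' v = true) → (∀ v ∉ X, ω v = ω' v) → ω ∈ A → ω' ∈ A

/-- Monotonicity of an event in the coordinates of `X` alone (more closed sites is better). -/
def DecOn (X : Set Site) (A : Set Config) : Prop :=
  ∀ ω ω' : Config, (∀ v ∈ X, ω v = false → ω' v = false) → (∀ v ∉ X, ω v = ω' v) →
    ω ∈ A → ω' ∈ A

lemma IncOn.inter {X : Set Site} {A B : Set Config} (hA : IncOn X A) (hB : IncOn X B) :
    IncOn X (A ∩ B) := fun ω ω' h1 h2 h => ⟨hA ω ω' h1 h2 h.1, hB ω ω' h1 h2 h.2⟩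

lemma DecOn.inter {X : Set Site} {A B : Set Config} (hA : DecOn X A) (hB : DecOn X B) :
    DecOn X (A ∩ B) := fun ω ω' h1 h2 h => ⟨hA ω ω' h1 h2 h.1, hB ω ω' h1 h2 h.2⟩

lemma IncOn.sec {X : Set Site} {A : Set Config} (h : IncOn X A) (v : Site) (b : Bool) :
    IncOn X (sec v b A) := by
  intro ω ω' h1 h2 hA
  refine h _ _ (fun w hw => ?_) (fun w hw => ?_) hA <;> by_cases hwv : w = v
  · subst hwv; simp
  · simp only [Function.update_of_ne hwv]; exact h1 w hw
  · subst hwv; simp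
  · simp only [Function.update_of_ne hwv]; exact h2 w hw

lemma IncOn.sec_subset {X : Set Site} {A : Set Config} (h : IncOn X A) {v : Site} (hv : v ∈ X) :
    TriPerc.sec v false A ⊆ TriPerc.sec v true A := by
  intro ω hA
  refine h _ _ (fun w hw => ?_) (fun w hw => ?_) hA <;> by_cases hwv : w = v
  · subst hwv; simp
  · simp only [Function.update_of_ne hwv]; exact id
  · subst hwv; exact absurd hv hw
  · simp only [Function.update_of_ne hwv]

/-- The Harris inequality, in a version where monotonicity is required only on the
coordinates `X` on which `B` depends. -/
lemma harris {X S : Set Site} (hS : S.Finite) {A B : Set Config} (hA : IncOn X A)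
    (hB : IncOn X B) (dA : Dep S A) (dB : Dep (S ∩ X) B) :
    Pr A * Pr B ≤ Pr (A ∩ B) := by
  induction S, hS using Set.Finite.induction_on generalizing A B with
  | empty =>
    rcases dA.empty_or_univ with rfl | rfl
    · simp [Pr_empty]
    · simp [Pr_univ]
  | @insert v S hv hS ih =>
    have fin : (insert v S).Finite := hS.insert v
    have dB' : Dep (insert v S) B := dB.mono Set.inter_subset_left
    have dsB : ∀ b, Dep (S ∩ X) (TriPerc.sec v b B) := fun b =>
      (sec_dep' v b dB).mono fun w hw =>
        ⟨hw.1.1.resolve_left hw.2, hw.1.2⟩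
    rw [Pr_split fin dA v, Pr_split fin dB' v, Pr_split fin (dA.inter dB') v, sec_inter, sec_inter]
    have h1 := ih (hA.sec v true) (hB.sec v true) (sec_dep _ dA) (dsB _)
    have h2 := ih (hA.sec v false) (hB.sec v false) (sec_dep _ dA) (dsB _)
    by_cases hvX : v ∈ X
    · have a := Pr_mono (hA.sec_subset hvX)
      have b := Pr_mono (hB.sec_subset hvX)
      nlinarith [mul_nonneg (sub_nonneg.2 a) (sub_nonneg.2 b)]
    · have e : ∀ b, TriPerc.sec v b B = B := fun b =>
        sec_eq_of_notMem b dB fun h => hvX h.2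
      simp only [e] at *
      nlinarith

lemma Dep.flip {S : Set Site} {A : Set Config} (h : Dep S A) : Dep S (TriPerc.flip ⁻¹' A) :=
  fun ω ω' hh => h _ _ fun v hv => by simp [TriPerc.flip, hh v hv]

lemma DecOn.flip {X : Set Site} {A : Set Config} (h : DecOn X A) :
    IncOn X (TriPerc.flip ⁻¹' A) := by
  intro ω ω' h1 h2 hA
  refine h _ _ (fun v hv hh => ?_) (fun v hv => by simp [TriPerc.flip, h2 v hv]) hA
  simp only [TriPerc.flip, Bool.not_eq_false'] at hh ⊢
  exact h1 v hv hh

lemma harris_dec {X S : Set Site} (hS : S.Finite) {A B : Set Config} (hA : DecOn X A)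
    (hB : DecOn X B) (dA : Dep S A) (dB : Dep (S ∩ X) B) :
    Pr A * Pr B ≤ Pr (A ∩ B) := by
  have := harris hS hA.flip hB.flip dA.flip dB.flip
  rwa [← Set.preimage_inter, Pr_flip, Pr_flip, Pr_flip] at this

/-- Independence of events depending on disjoint sets of coordinates. -/
lemma Pr_indep {S T : Set Site} (hS : S.Finite) (hST : Disjoint S T) {A B : Set Config}
    (dA : Dep S A) (dB : Dep T B) : Pr (A ∩ B) = Pr A * Pr B := by
  induction S, hS using Set.Finite.induction_on generalizing A with
  | empty =>
    rcases dA.empty_or_univ with rfl | rfl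
    · simp [Pr_empty]
    · simp [Pr_univ]
  | @insert v S hv hS ih =>
    have hvT : v ∉ T := fun h => Set.disjoint_left.1 hST (Set.mem_insert v S) h
    have e : ∀ b, TriPerc.sec v b B = B := fun b => sec_eq_of_notMem b dB hvT
    have hST' : Disjoint S T := hST.mono_left (Set.subset_insert v S)
    have key : ∀ b, Pr (A ∩ B ∩ (fun ω => ω v) ⁻¹' {b}) = Pr (TriPerc.sec v b A) * Pr B / 2 := by
      intro b
      have i1 := ih hST' (sec_dep b dA)
      rw [← i1]
      have e3 : TriPerc.sec v b A ∩ B = TriPerc.sec v b (A ∩ B) := by rw [sec_inter, e]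
      have m : MeasurableSet ((fun ω : Config => ω v) ⁻¹' {b}) := measurable_pi_apply v trivial
      have f1 : Pr (TriPerc.sec v b (A ∩ B)) =
          Pr (TriPerc.sec v b (A ∩ B) ∩ (fun ω => ω v) ⁻¹' {b}) +
          Pr (TriPerc.sec v b (A ∩ B) \ (fun ω => ω v) ⁻¹' {b}) :=
        (measureReal_inter_add_diff m).symm
      have f2 : TriPerc.sec v b (A ∩ B) ∩ (fun ω => ω v) ⁻¹' {b} =
          A ∩ B ∩ (fun ω => ω v) ⁻¹' {b} := by
        ext ω
        simp only [Set.mem_inter_iff, Set.mem_preimage, Set.mem_singleton_iff]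
        refine and_congr_left fun hb => ?_
        exact sec_self (A := A ∩ B) hb
      have f3 : TriPerc.sec v b (A ∩ B) \ (fun ω => ω v) ⁻¹' {b} =
          flipAt v ⁻¹' (TriPerc.sec v b (A ∩ B) ∩ (fun ω => ω v) ⁻¹' {b}) := by
        ext ω
        have : Function.update (flipAt v ω) v b = Function.update ω v b := by
          funext w; by_cases h : w = v
          · subst h; simp
          · simp [flipAt, h]
        simp only [TriPerc.sec, Set.mem_sdiff, Set.mem_ofPred_eq, Set.mem_preimage,
          Set.mem_singleton_iff, Set.mem_inter_iff, this]
        refine and_congr_right fun _ => ?_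
        cases hb : ω v <;> cases b <;> simp [flipAt, hb]
      rw [f3, Pr_flipAt, f2] at f1
      rw [e3]
      linarith
    have m : MeasurableSet ((fun ω : Config => ω v) ⁻¹' {true}) := measurable_pi_apply v trivial
    have e1 : Pr (A ∩ B) = Pr (A ∩ B ∩ (fun ω => ω v) ⁻¹' {true}) +
        Pr ((A ∩ B) \ (fun ω => ω v) ⁻¹' {true}) := (measureReal_inter_add_diff m).symm
    have e2 : (A ∩ B) \ (fun ω => ω v) ⁻¹' {true} = A ∩ B ∩ (fun ω => ω v) ⁻¹' {false} := by
      ext ω; simp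
    rw [e1, e2, key, key, Pr_split (hS.insert v) dA v]
    ring

/-- Disjoint occurrence of two events in terms of their closed sites. -/
def occ (A B : Set Config) : Set Config :=
  {ω | ∃ ω₁ ∈ A, ∃ ω₂ ∈ B, ∀ v, (ω₁ v = false → ω v = false ∧ ω₂ v = true) ∧
    (ω₂ v = false → ω v = false)}

/-- Decreasing events. -/
def Dec (A : Set Config) : Prop := ∀ ω ω' : Config, (∀ v, ω v = false → ω' v = false) →
  ω ∈ A → ω' ∈ A

/-- Increasing events. -/
def Inc (A : Set Config) : Prop := ∀ ω ω' : Config, (∀ v, ω v = true → ω' v = true) →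
  ω ∈ A → ω' ∈ A

lemma Dec.decOn {A : Set Config} (h : Dec A) (X : Set Site) : DecOn X A := by
  intro ω ω' h1 h2
  refine h _ _ fun v hv => ?_
  by_cases hX : v ∈ X
  · exact h1 v hX hv
  · rw [← h2 v hX]; exact hv

lemma Inc.incOn {A : Set Config} (h : Inc A) (X : Set Site) : IncOn X A := by
  intro ω ω' h1 h2
  refine h _ _ fun v hv => ?_
  by_cases hX : v ∈ X
  · exact h1 v hX hv
  · rw [← h2 v hX]; exact hv

lemma Dec.sec {A : Set Config} (h : Dec A) (v : Site) (b : Bool) : Dec (sec v b A) := by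
  intro ω ω' hh
  refine h _ _ fun w => ?_
  by_cases hwv : w = v
  · subst hwv; simp
  · simp only [Function.update_of_ne hwv]; exact hh w

lemma Dec.sec_subset {A : Set Config} (h : Dec A) (v : Site) :
    TriPerc.sec v true A ⊆ TriPerc.sec v false A := by
  intro ω
  refine h _ _ fun w => ?_
  by_cases hwv : w = v
  · subst hwv; simp
  · simp only [Function.update_of_ne hwv]; exact id

lemma occ_dep {S : Set Site} {A B : Set Config} (dA : Dep S A) (dB : Dep S B) :
    Dep S (occ A B) := by
  classical
  refine dep_of_imp ?_
  rintro ω ω' hh ⟨ω₁, h1, ω₂, h2, h⟩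
  refine ⟨fun v => if v ∈ S then ω₁ v else true, (dA _ _ fun v hv => by simp [hv]).1 h1,
    fun v => if v ∈ S then ω₂ v else true, (dB _ _ fun v hv => by simp [hv]).1 h2, fun v => ?_⟩
  by_cases hv : v ∈ S
  · simp only [hv, if_true]
    rw [← hh v hv]; exact h v
  · simp [hv]

lemma occ_mono {A A' B B' : Set Config} (hA : A ⊆ A') (hB : B ⊆ B') : occ A B ⊆ occ A' B' :=
  fun _ ⟨ω₁, h1, ω₂, h2, h⟩ => ⟨ω₁, hA h1, ω₂, hB h2, h⟩

/-- The van den Berg–Kesten inequality for decreasing events. -/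
lemma bk {S : Set Site} (hS : S.Finite) {A B : Set Config} (hA : Dec A) (hB : Dec B)
    (dA : Dep S A) (dB : Dep S B) : Pr (occ A B) ≤ Pr A * Pr B := by
  induction S, hS using Set.Finite.induction_on generalizing A B with
  | empty =>
    rcases dA.empty_or_univ with rfl | rfl
    · simp [Pr_empty, occ]
    · rcases dB.empty_or_univ with rfl | rfl
      · simp [Pr_empty, occ]
      · simp [Pr_univ, Pr_le_one]
  | @insert v S hv hS ih =>
    have fin := hS.insert v
    rw [Pr_split fin (occ_dep dA dB) v, Pr_split fin dA v, Pr_split fin dB v]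
    set At := TriPerc.sec v true A
    set Af := TriPerc.sec v false A
    set Bt := TriPerc.sec v true B
    set Bf := TriPerc.sec v false B
    have dt : TriPerc.sec v true (occ A B) ⊆ occ At Bt := by
      rintro ω ⟨ω₁, h1, ω₂, h2, h⟩
      have hv := h v
      simp only [Function.update_self] at hv
      have w1 : ω₁ v = true := by
        cases e : ω₁ v
        · exact absurd (hv.1 e).1 (by simp)
        · rfl
      have w2 : ω₂ v = true := by
        cases e : ω₂ v
        · exact absurd (hv.2 e) (by simp)
        · rfl
      refine ⟨ω₁, (sec_self w1).2 h1, ω₂, (sec_self w2).2 h2, fun w => ?_⟩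
      by_cases hwv : w = v
      · subst hwv; simp [w1, w2]
      · have := h w
        simpa only [Function.update_of_ne hwv] using this
    have df : TriPerc.sec v false (occ A B) ⊆ occ Af Bt ∪ occ At Bf := by
      rintro ω ⟨ω₁, h1, ω₂, h2, h⟩
      have hv := h v
      cases e : ω₁ v
      · left
        have w2 := (hv.1 e).2
        refine ⟨Function.update ω₁ v true, ?_, ω₂, (sec_self w2).2 h2, fun w => ?_⟩
        · change Function.update (Function.update ω₁ v true) v false ∈ A
          rw [Function.update_idem, ← e, Function.update_eq_self]; exact h1
        · by_cases hwv : w = v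
          · subst hwv; simp [w2]
          · have := h w
            simpa only [Function.update_of_ne hwv] using this
      · right
        refine ⟨ω₁, (sec_self e).2 h1, Function.update ω₂ v true, ?_, fun w => ?_⟩
        · change Function.update (Function.update ω₂ v true) v false ∈ B
          rw [Function.update_idem]
          refine hB ω₂ _ (fun w hw => ?_) h2
          by_cases hwv : w = v
          · subst hwv; simp
          · simpa only [Function.update_of_ne hwv] using hw
        · by_cases hwv : w = v
          · subst hwv; simp [e]
          · have := h w
            simpa only [Function.update_of_ne hwv] using this
    have sA : At ⊆ Af := hA.sec_subset v
    have sB : Bt ⊆ Bf := hB.sec_subset v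
    have dAt : Dep S At := sec_dep _ dA
    have dAf : Dep S Af := sec_dep _ dA
    have dBt : Dep S Bt := sec_dep _ dB
    have dBf : Dep S Bf := sec_dep _ dB
    have u := Pr_union_add_inter (A := occ Af Bt) hS (occ_dep dAt dBf)
    have i := Pr_mono (Set.subset_inter (occ_mono sA (le_refl Bt)) (occ_mono (le_refl At) sB))
    have i1 := ih (hA.sec v false) (hB.sec v true) dAf dBt
    have i2 := ih (hA.sec v true) (hB.sec v false) dAt dBf
    have m1 := Pr_mono dt
    have m2 := Pr_mono df
    have a := Pr_mono sA
    have b := Pr_mono sB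
    have : Pr At * Pr Bf + Pr Af * Pr Bt ≤ Pr At * Pr Bt + Pr Af * Pr Bf := by
      nlinarith [mul_nonneg (sub_nonneg.2 a) (sub_nonneg.2 b)]
    change (Pr (TriPerc.sec v true (occ A B)) + Pr (TriPerc.sec v false (occ A B))) / 2 ≤
      (Pr At + Pr Af) / 2 * ((Pr Bt + Pr Bf) / 2)
    nlinarith

/-- `k` disjoint sets of closed sites each realize `A`. -/
def DisjOcc (A : Set Config) (k : ℕ) : Set Config :=
  {ω | ∃ s : ℕ → Set Site, (∀ i < k, ∀ v ∈ s i, ω v = false) ∧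
    (∀ i < k, ∀ j < k, i ≠ j → Disjoint (s i) (s j)) ∧
    ∀ i < k, ∀ ω' : Config, (∀ v ∈ s i, ω' v = false) → ω' ∈ A}

lemma Dec.disjOcc (A : Set Config) (k : ℕ) : Dec (DisjOcc A k) := by
  rintro ω ω' hh ⟨s, h1, h2, h3⟩
  exact ⟨s, fun i hi v hv => hh v (h1 i hi v hv), h2, h3⟩

lemma disjOcc_dep {S : Set Site} {A : Set Config} (hA : Dep S A) (k : ℕ) :
    Dep S (DisjOcc A k) := by
  classical
  refine dep_of_imp ?_
  rintro ω ω' hh ⟨s, h1, h2, h3⟩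
  refine ⟨fun i => s i ∩ S, fun i hi v hv => by rw [← hh v hv.2]; exact h1 i hi v hv.1,
    fun i hi j hj hij => (h2 i hi j hj hij).mono Set.inter_subset_left Set.inter_subset_left,
    fun i hi ω'' hω => ?_⟩
  have := h3 i hi (fun v => if v ∈ S then ω'' v else false) (fun v hv => by
    by_cases hvS : v ∈ S
    · simp only [hvS, if_true]; exact hω v ⟨hv, hvS⟩
    · simp [hvS])
  exact (hA _ _ fun v hv => by simp [hv]).1 this

lemma Pr_disjOcc_le {S : Set Site} (hS : S.Finite) {A : Set Config} (hA : Dec A)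
    (dA : Dep S A) (k : ℕ) : Pr (DisjOcc A k) ≤ Pr A ^ k := by
  classical
  induction k with
  | zero => simpa using Pr_le_one _
  | succ k ih =>
    have : DisjOcc A (k + 1) ⊆ occ (DisjOcc A k) A := by
      rintro ω ⟨s, h1, h2, h3⟩
      refine ⟨fun v => !decide (∃ i < k, v ∈ s i),
        ⟨s, fun i hi v hv => ?_, fun i hi j hj => h2 i (by omega) j (by omega),
          fun i hi => h3 i (by omega)⟩,
        fun v => !decide (v ∈ s k), h3 k (by omega) _ (by simp), fun v => ⟨fun hv => ?_, fun hv => ?_⟩⟩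
      · simpa using ⟨i, hi, hv⟩
      · have hv' : ∃ i < k, v ∈ s i := by simpa using hv
        obtain ⟨i, hi, hvi⟩ := hv'
        refine ⟨h1 i (by omega) v hvi, ?_⟩
        have := Set.disjoint_left.1 (h2 i (by omega) k (by omega) (by omega)) hvi
        simpa using this
      · exact h1 k (by omega) v (by simpa using hv)
    calc Pr (DisjOcc A (k + 1)) ≤ Pr (occ (DisjOcc A k) A) := Pr_mono this
      _ ≤ Pr (DisjOcc A k) * Pr A := bk hS (Dec.disjOcc A k) hA (disjOcc_dep dA k) dA
      _ ≤ Pr A ^ k * Pr A := mul_le_mul_of_nonneg_right ih (Pr_nonneg A)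
      _ = Pr A ^ (k + 1) := (pow_succ _ _).symm

/-- Comparison of conditional probabilities along an exploration `κ`. -/
lemma explore_le {Ω S : Set Site} (hΩ : Ω.Finite) (hS : S.Finite) (κ : Config → Set Site)
    (hκ : ∀ ω, κ ω ⊆ Ω) (Z : Set Site → Set Site) (hZ : ∀ k, Z k ⊆ S)
    (hdep : ∀ k, Dep (Z k) {ω | κ ω = k}) (e e' : Set Site → Set Config)
    (de : ∀ k, Dep (S \ Z k) (e k)) (de' : ∀ k, Dep (S \ Z k) (e' k)) {c : ℝ}
    (h : ∀ k, c * Pr (e k) ≤ Pr (e' k)) :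
    c * Pr {ω | ω ∈ e (κ ω)} ≤ Pr {ω | ω ∈ e' (κ ω)} := by
  classical
  have key : ∀ f : Set Site → Set Config, (∀ k, Dep (S \ Z k) (f k)) →
      Pr {ω | ω ∈ f (κ ω)} = ∑ k ∈ hΩ.finite_subsets.toFinset, Pr {ω | κ ω = k} * Pr (f k) := by
    intro f hf
    have e1 : {ω | ω ∈ f (κ ω)} = ⋃ k ∈ hΩ.finite_subsets.toFinset, {ω | κ ω = k} ∩ f k := by
      ext ω
      simp only [Set.mem_ofPred_eq, Set.mem_iUnion, Set.Finite.mem_toFinset, Set.mem_inter_iff,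
        exists_prop]
      exact ⟨fun h => ⟨_, hκ ω, rfl, h⟩, fun ⟨k, _, h1, h2⟩ => h1 ▸ h2⟩
    rw [e1, Pr, measureReal_biUnion_finset]
    · refine Finset.sum_congr rfl fun k _ => ?_
      exact Pr_indep (hS.subset (hZ k)) Set.disjoint_sdiff_right (hdep k) (hf k)
    · intro k _ k' _ hkk
      refine Set.disjoint_left.2 fun ω h1 h2 => hkk ?_
      exact h1.1.symm.trans h2.1
    · intro k _
      exact ((hdep k).mono (hZ k)).inter ((hf k).mono Set.sdiff_subset) |>.measurableSet hS
  rw [key e de, key e' de', Finset.mul_sum]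
  refine Finset.sum_le_sum fun k _ => ?_
  have := mul_le_mul_of_nonneg_left (h k) (Pr_nonneg {ω | κ ω = k})
  linarith

/-- Expected number of occurring events, via tail probabilities. -/
lemma sum_Pr_le_of_tail {ι : Type*} [DecidableEq ι] (F : Finset ι) {S : Set Site} (hS : S.Finite)
    (A : ι → Set Config) (hA : ∀ i ∈ F, Dep S (A i)) {q : ℝ} (hq0 : 0 ≤ q) (hq1 : q < 1)
    (h : ∀ k : ℕ, Pr {ω | ∃ G ⊆ F, G.card = k ∧ ∀ i ∈ G, ω ∈ A i} ≤ q ^ k) :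
    ∑ i ∈ F, Pr (A i) ≤ q / (1 - q) := by
  classical
  set T : ℕ → Set Config := fun k => {ω | ∃ G ⊆ F, G.card = k ∧ ∀ i ∈ G, ω ∈ A i}
  have mA : ∀ i ∈ F, MeasurableSet (A i) := fun i hi => (hA i hi).measurableSet hS
  have mT : ∀ k, MeasurableSet (T k) := fun k => by
    refine Dep.measurableSet hS (dep_of_imp ?_)
    rintro ω ω' hh ⟨G, h1, h2, h3⟩
    exact ⟨G, h1, h2, fun i hi => (hA i (h1 hi) ω ω' hh).1 (h3 i hi)⟩
  have pt : ∀ ω, ∑ i ∈ F, (A i).indicator (fun _ => (1 : ℝ)) ω =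
      ∑ k ∈ Finset.range F.card, (T (k + 1)).indicator (fun _ => (1 : ℝ)) ω := by
    intro ω
    simp only [Set.indicator_apply, Finset.sum_boole]
    have : ∀ k, ω ∈ T k ↔ k ≤ (F.filter fun i => ω ∈ A i).card := by
      intro k
      constructor
      · rintro ⟨G, h1, h2, h3⟩
        rw [← h2]
        exact Finset.card_le_card fun i hi => Finset.mem_filter.2 ⟨h1 hi, h3 i hi⟩
      · intro hk
        obtain ⟨G, hG, hc⟩ := Finset.exists_subset_card_eq hk
        exact ⟨G, hG.trans (Finset.filter_subset _ _), hc, fun i hi =>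
          (Finset.mem_filter.1 (hG hi)).2⟩
    simp only [this, Finset.sum_boole]
    have hle : (F.filter fun i => ω ∈ A i).card ≤ F.card := Finset.card_filter_le _ _
    have : (Finset.range F.card).filter (fun k => k + 1 ≤ (F.filter fun i => ω ∈ A i).card) =
        Finset.range (F.filter fun i => ω ∈ A i).card := by
      ext k; simp only [Finset.mem_filter, Finset.mem_range]; omega
    rw [this, Finset.card_range]
  have int : ∀ B : Set Config, MeasurableSet B →
      Integrable (B.indicator fun _ => (1 : ℝ)) mu0 := fun B hB =>
    (integrable_const 1).indicator hB
  have eqP : ∀ B : Set Config, MeasurableSet B →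
      ∫ ω, B.indicator (fun _ => (1 : ℝ)) ω ∂mu0 = Pr B := fun B hB => by
    rw [integral_indicator_const _ hB]; simp [Pr]
  have e : ∑ i ∈ F, Pr (A i) = ∑ k ∈ Finset.range F.card, Pr (T (k + 1)) := by
    calc ∑ i ∈ F, Pr (A i) = ∑ i ∈ F, ∫ ω, (A i).indicator (fun _ => (1 : ℝ)) ω ∂mu0 :=
          Finset.sum_congr rfl fun i hi => (eqP _ (mA i hi)).symm
      _ = ∫ ω, ∑ i ∈ F, (A i).indicator (fun _ => (1 : ℝ)) ω ∂mu0 :=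
          (integral_finsetSum _ fun i hi => int _ (mA i hi)).symm
      _ = ∫ ω, ∑ k ∈ Finset.range F.card, (T (k + 1)).indicator (fun _ => (1 : ℝ)) ω ∂mu0 := by
          simp only [pt]
      _ = ∑ k ∈ Finset.range F.card, ∫ ω, (T (k + 1)).indicator (fun _ => (1 : ℝ)) ω ∂mu0 :=
          integral_finsetSum _ fun k _ => int _ (mT _)
      _ = _ := Finset.sum_congr rfl fun k _ => eqP _ (mT _)
  rw [e]
  have hgeo : ∀ n : ℕ, ∑ k ∈ Finset.range n, q ^ (k + 1) ≤ q / (1 - q) := by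
    intro n
    have h1 : 0 < 1 - q := by linarith
    rw [le_div_iff₀ h1]
    have : (∑ k ∈ Finset.range n, q ^ (k + 1)) * (1 - q) = q - q ^ (n + 1) := by
      induction n with
      | zero => simp
      | succ n ih => rw [Finset.sum_range_succ, add_mul, ih]; ring
    rw [this]
    linarith [pow_nonneg hq0 (n + 1)]
  exact (Finset.sum_le_sum fun k _ => h (k + 1)).trans (hgeo _)

lemma adj_iff {a b : Site} : Adj a b ↔
    (b.1 = a.1 + 1 ∧ b.2 = a.2) ∨ (b.1 = a.1 - 1 ∧ b.2 = a.2) ∨ (b.1 = a.1 ∧ b.2 = a.2 + 1) ∨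
    (b.1 = a.1 ∧ b.2 = a.2 - 1) ∨ (b.1 = a.1 + 1 ∧ b.2 = a.2 - 1) ∨
    (b.1 = a.1 - 1 ∧ b.2 = a.2 + 1) := by
  simp only [Adj, Set.mem_insert_iff, Set.mem_singleton_iff, Prod.mk.injEq]
  omega

lemma adj_symm {a b : Site} (h : Adj a b) : Adj b a := by
  rw [adj_iff] at h ⊢; omega

lemma adj_bound {a b : Site} (h : Adj a b) :
    b.1 ≤ a.1 + 1 ∧ a.1 ≤ b.1 + 1 ∧ b.2 ≤ a.2 + 1 ∧ a.2 ≤ b.2 + 1 := by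
  rw [adj_iff] at h; omega

/-- Connection by a lattice path inside `A`. -/
def Con (A : Set Site) (u v : Site) : Prop :=
  u ∈ A ∧ Relation.ReflTransGen (fun a b => a ∈ A ∧ b ∈ A ∧ Adj a b) u v

section Con
variable {A B H : Set Site} {u v w : Site}

lemma Con.refl (h : u ∈ A) : Con A u u := ⟨h, .refl⟩

lemma Con.left_mem (h : Con A u v) : u ∈ A := h.1

lemma Con.step (h : Con A u v) (hw : w ∈ A) (ha : Adj v w) : Con A u w := by
  obtain ⟨hu, h⟩ := h
  refine ⟨hu, h.tail ⟨?_, hw, ha⟩⟩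
  rcases Relation.ReflTransGen.cases_tail h with e | ⟨_, _, h2⟩
  · rw [e]; exact hu
  · exact h2.2.1

/-- Induction along a connection. -/
lemma Con.rec_on {P : Site → Prop} (h : Con A u v) (h0 : P u)
    (hs : ∀ a b, Con A u a → b ∈ A → Adj a b → P a → P b) : P v := by
  obtain ⟨hu, h⟩ := h
  induction h with
  | refl => exact h0
  | @tail b c hb hbc ih => exact hs b c ⟨hu, hb⟩ hbc.2.1 hbc.2.2 ih

lemma Con.right_mem (h : Con A u v) : v ∈ A := by
  refine h.rec_on (P := fun x => x ∈ A) h.1 fun a b _ hb _ _ => hb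

lemma Con.trans (h : Con A u v) (h' : Con A v w) : Con A u w :=
  h'.rec_on (P := fun x => Con A u x) h fun _ _ _ hb hab hc => hc.step hb hab

lemma Con.single (hu : u ∈ A) (hv : v ∈ A) (h : Adj u v) : Con A u v := (Con.refl hu).step hv h

lemma Con.symm (h : Con A u v) : Con A v u := by
  refine h.rec_on (P := fun x => Con A x u) (Con.refl h.1) fun a b ha hb hab hc => ?_
  exact (Con.single hb ha.right_mem (adj_symm hab)).trans hc

lemma Con.mono (h : Con A u v) (hAB : A ⊆ B) : Con B u v :=
  h.rec_on (P := fun x => Con B u x) (Con.refl (hAB h.1)) fun _ _ _ hb hab hc => hc.step (hAB hb) hab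

/-- The path up to its first visit to `H`. -/
lemma Con.enter (h : Con A u v) (hu : u ∉ H) (hv : v ∈ H) :
    ∃ w' w, Con (A \ H) u w' ∧ Adj w' w ∧ w ∈ A ∧ w ∈ H := by
  by_contra hcon
  push Not at hcon
  refine absurd hv (h.rec_on (P := fun x => Con (A \ H) u x) (Con.refl ⟨h.1, hu⟩) ?_).right_mem.2
  intro a b _ hb hab ih
  exact ih.step ⟨hb, hcon a b ih hab hb⟩ hab

/-- The path after its last visit to `H`. -/
lemma Con.leave (h : Con A u v) (hu : u ∈ H) (hv : v ∉ H) :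
    ∃ w w', w ∈ A ∧ w ∈ H ∧ Adj w w' ∧ Con (A \ H) w' v := by
  obtain ⟨w', w, h1, h2, h3, h4⟩ := h.symm.enter hv hu
  exact ⟨w, w', h3, h4, adj_symm h2, h1.symm⟩

/-- A path that starts in `H` either stays in `H` or leaves it. -/
lemma Con.stay_or_exit (h : Con A u v) (hu : u ∈ H) :
    Con (A ∩ H) u v ∨ ∃ w w', Con (A ∩ H) u w ∧ Adj w w' ∧ w' ∈ A ∧ w' ∉ H := by
  by_contra hcon
  push Not at hcon
  refine hcon.1 (h.rec_on (P := fun x => Con (A ∩ H) u x) (Con.refl ⟨h.1, hu⟩) ?_)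
  intro a b _ hb hab ih
  by_contra hb'
  by_cases hbH : b ∈ H
  · exact hb' (ih.step ⟨hb, hbH⟩ hab)
  · exact hbH (hcon.2 a b ih hab hb)

/-- Intermediate values along a path for a function with unit steps. -/
lemma Con.hit (h : Con A u v) (f : Site → ℤ) (hf : ∀ a b, Adj a b → f b ≤ f a + 1) {c : ℤ}
    (hu : f u ≤ c) (hv : c ≤ f v) :
    ∃ w, f w = c ∧ Con (A ∩ {x | f x ≤ c}) u w := by
  by_cases hu' : f u = c
  · exact ⟨u, hu', Con.refl ⟨h.1, hu⟩⟩
  obtain ⟨w', w, h1, h2, h3, h4⟩ := h.enter (H := {x | c ≤ f x}) (by simp; omega) hv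
  have h5 := hf _ _ h2
  have h6 := h1.right_mem.2
  simp only [Set.mem_ofPred_eq, not_le] at h4 h6
  refine ⟨w, by omega, (h1.mono ?_).step ⟨h3, ?_⟩ h2⟩
  · rintro x ⟨hx, hx2⟩
    simp only [Set.mem_ofPred_eq, not_le] at hx2
    exact ⟨hx, hx2.le⟩
  · simp only [Set.mem_ofPred_eq]; omega

lemma Con.walk (h : Con A u v) : ∃ (N : ℕ) (p : ℕ → Site), p 0 = u ∧ p N = v ∧
    (∀ i ≤ N, p i ∈ A) ∧ ∀ i < N, Adj (p i) (p (i + 1)) := by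
  refine h.rec_on (P := fun x => ∃ (N : ℕ) (p : ℕ → Site), p 0 = u ∧ p N = x ∧
    (∀ i ≤ N, p i ∈ A) ∧ ∀ i < N, Adj (p i) (p (i + 1))) ⟨0, fun _ => u, rfl, rfl, fun _ _ => h.1,
      fun i hi => by omega⟩ ?_
  rintro a b _ hb hab ⟨N, p, h0, hN, hA, hp⟩
  refine ⟨N + 1, fun i => if i ≤ N then p i else b, by simp [h0], by simp, fun i hi => ?_,
    fun i hi => ?_⟩
  · by_cases h' : i ≤ N
    · simp only [h', if_true]; exact hA i h'
    · simp only [h', if_false]; exact hb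
  · by_cases h' : i < N
    · simp only [show i ≤ N by omega, show i + 1 ≤ N by omega, if_true]; exact hp i h'
    · have : i = N := by omega
      subst this
      simp [hN, hab]

lemma Con.map {f : Site → Site} (hf : ∀ a b, Adj a b → Adj (f a) (f b)) (h : Con A u v)
    (hAB : ∀ x ∈ A, f x ∈ B) : Con B (f u) (f v) :=
  h.rec_on (P := fun x => Con B (f u) (f x)) (Con.refl (hAB _ h.1)) fun _ _ _ hb hab hc =>
    hc.step (hAB _ hb) (hf _ _ hab)

/-- Horizontal segment. -/
lemma con_horiz {y x x' : ℤ} (h : x ≤ x') (hA : ∀ t, x ≤ t → t ≤ x' → (t, y) ∈ A) :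
    Con A (x, y) (x', y) := by
  obtain ⟨n, rfl⟩ := Int.le.dest h
  clear h
  induction n with
  | zero => simpa using Con.refl (hA x le_rfl (by simp))
  | succ n ih =>
    refine (ih fun t h1 h2 => hA t h1 (by push_cast; omega)).step
      (hA _ (by push_cast; omega) le_rfl) ?_
    rw [adj_iff]; push_cast; simp; omega

/-- Vertical segment. -/
lemma con_vert {x y y' : ℤ} (h : y ≤ y') (hA : ∀ t, y ≤ t → t ≤ y' → (x, t) ∈ A) :
    Con A (x, y) (x, y') := by
  obtain ⟨n, rfl⟩ := Int.le.dest h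
  clear h
  induction n with
  | zero => simpa using Con.refl (hA y le_rfl (by simp))
  | succ n ih =>
    refine (ih fun t h1 h2 => hA t h1 (by push_cast; omega)).step
      (hA _ (by push_cast; omega) le_rfl) ?_
    rw [adj_iff]; push_cast; simp; omega

end Con

/-- The edge `ab` crosses from column `v.1` to `v.1+1` below `v`. -/
def under (v a b : Site) : Prop :=
  (a.1 = v.1 ∧ b.1 = v.1 + 1 ∧ a.2 < v.2) ∨ (b.1 = v.1 ∧ a.1 = v.1 + 1 ∧ b.2 < v.2)

instance (v a b : Site) : Decidable (under v a b) := by unfold under; infer_instance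

/-- Number of crossings below `v`, mod 2. -/
def parity (N : ℕ) (p : ℕ → Site) (v : Site) : ZMod 2 :=
  ∑ i ∈ Finset.range N, if under v (p i) (p (i + 1)) then 1 else 0

lemma zmod2_sum_indicator (N : ℕ) (s : ℕ → Prop) [DecidablePred s] :
    ∑ i ∈ Finset.range N, ((if s i then 1 else 0) + (if s (i + 1) then (1 : ZMod 2) else 0)) =
      (if s 0 then 1 else 0) + (if s N then 1 else 0) := by
  have h2 : ∀ a : ZMod 2, a + a = 0 := by decide
  induction N with
  | zero => simp [h2]
  | succ N ih =>
    rw [Finset.sum_range_succ, ih]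
    generalize (if s 0 then (1 : ZMod 2) else 0) = a
    generalize (if s N then (1 : ZMod 2) else 0) = b
    generalize (if s (N + 1) then (1 : ZMod 2) else 0) = c
    calc a + b + (b + c) = a + (b + b) + c := by ring
      _ = _ := by rw [h2]; ring

lemma zmod2_ite {P Q R S : Prop} [Decidable P] [Decidable Q] [Decidable R] [Decidable S]
    (h : (P ↔ Q) ↔ (R ↔ S)) :
    ((if P then 1 else 0) : ZMod 2) = (if Q then 1 else 0) + ((if R then 1 else 0) +
      (if S then 1 else 0)) := by
  by_cases hP : P <;> by_cases hQ : Q <;> by_cases hR : R <;> by_cases hS : S <;>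
    simp_all <;> decide

/-- One step of the parity argument: the column to the right below height `t`. -/
lemma parity_step {N : ℕ} {p : ℕ → Site} (hp : ∀ i < N, Adj (p i) (p (i + 1))) {v w : Site}
    (hv : ∀ i ≤ N, p i ≠ v) (hw : ∀ i ≤ N, p i ≠ w)
    (h : (w.1 = v.1 ∧ w.2 = v.2 + 1) ∨ (w.1 = v.1 + 1 ∧ w.2 = v.2) ∨
      (w.1 = v.1 + 1 ∧ w.2 = v.2 - 1))
    (h0 : (p 0).1 < v.1 + 1 ∨ w.1 = v.1) (hN : v.1 + 1 < (p N).1 ∨ w.1 = v.1) :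
    parity N p v = parity N p w := by
  rcases h with h | h
  · refine Finset.sum_congr rfl fun i hi => ?_
    have hi := Finset.mem_range.1 hi
    have h1 := hv i hi.le
    have h2 := hv (i + 1) hi
    simp only [ne_eq, Prod.ext_iff] at h1 h2
    congr 1
    simp only [under, eq_iff_iff]
    omega
  · have e : parity N p v = parity N p w + ∑ i ∈ Finset.range N,
        ((if ((p i).1 = w.1 ∧ (p i).2 < w.2) then 1 else 0) +
          (if ((p (i + 1)).1 = w.1 ∧ (p (i + 1)).2 < w.2) then (1 : ZMod 2) else 0)) := by
      rw [parity, parity, ← Finset.sum_add_distrib]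
      refine Finset.sum_congr rfl fun i hi => ?_
      have hi := Finset.mem_range.1 hi
      have h1 := hv i hi.le
      have h2 := hv (i + 1) hi
      have h3 := hw i hi.le
      have h4 := hw (i + 1) hi
      have h5 := adj_iff.1 (hp i hi)
      simp only [ne_eq, Prod.ext_iff] at h1 h2 h3 h4
      apply zmod2_ite
      simp only [under]
      generalize p i = a at *
      generalize p (i + 1) = b at *
      rcases h with ⟨e1, e2⟩ | ⟨e1, e2⟩ <;>
      rcases h5 with ⟨f1, f2⟩ | ⟨f1, f2⟩ | ⟨f1, f2⟩ | ⟨f1, f2⟩ | ⟨f1, f2⟩ | ⟨f1, f2⟩ <;>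
      · simp only [e1, e2, f1, f2] at *; clear e1 e2 f1 f2; omega
    rw [e, zmod2_sum_indicator N (fun i => (p i).1 = w.1 ∧ (p i).2 < w.2)]
    have n0 : ¬ ((p 0).1 = w.1 ∧ (p 0).2 < w.2) := by omega
    have nN : ¬ ((p N).1 = w.1 ∧ (p N).2 < w.2) := by omega
    simp [n0, nN]

lemma parity_column (N : ℕ) (p : ℕ → Site) (v : Site) (hp : ∀ i < N, Adj (p i) (p (i + 1)))
    (h : ∀ i ≤ N, (p i).1 = v.1 → (p i).2 < v.2) (h0 : (p 0).1 ≤ v.1) (hN : v.1 < (p N).1) :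
    parity N p v = 1 := by
  have : parity N p v = ∑ i ∈ Finset.range N,
        ((if ((p i).1 ≤ v.1) then 1 else 0) +
          (if ((p (i + 1)).1 ≤ v.1) then (1 : ZMod 2) else 0)) := by
    rw [parity]
    refine Finset.sum_congr rfl fun i hi => ?_
    have hi := Finset.mem_range.1 hi
    have h5 := adj_bound (hp i hi)
    have h1 := h i hi.le
    have h2 := h (i + 1) hi
    have := zmod2_ite (P := under v (p i) (p (i + 1))) (Q := False) (R := (p i).1 ≤ v.1)
      (S := (p (i + 1)).1 ≤ v.1) (by
        simp only [under, iff_false]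
        by_cases k1 : (p i).1 = v.1
        · have := h1 k1
          constructor <;> intro _ <;> omega
        · by_cases k2 : (p (i + 1)).1 = v.1
          · have := h2 k2
            constructor <;> intro _ <;> omega
          · constructor <;> intro _ <;> omega)
    simpa using this
  rw [this, zmod2_sum_indicator N (fun i => (p i).1 ≤ v.1)]
  simp [h0, hN]

/-- A left-right path and a top-bottom path of the same rectangle meet. -/
theorem crossings_meet {A B : Set Site} {x0 x1 y0 y1 : ℤ} {a b c e : Site} (hA : Con A a b)
    (hB : Con B c e) (hAy : ∀ v ∈ A, y0 ≤ v.2 ∧ v.2 ≤ y1) (hBx : ∀ v ∈ B, x0 ≤ v.1 ∧ v.1 ≤ x1)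
    (ha : a.1 ≤ x0) (hb : x1 ≤ b.1) (hc : c.2 ≤ y0) (he : y1 ≤ e.2) : (A ∩ B).Nonempty := by
  by_contra hd
  have hd' : ∀ v ∈ A, v ∉ B := fun v h1 h2 => hd ⟨v, h1, h2⟩
  have hb1 : Adj b (x1 + 1 + (b.1 - x1), b.2) := by rw [adj_iff]; simp; omega
  set A' := A ∪ {(x1 + 1 + (b.1 - x1), b.2)} with hA'
  have hAA : Con A' a (x1 + 1 + (b.1 - x1), b.2) :=
    (hA.mono subset_union_left).step (Or.inr rfl) hb1
  have hAy' : ∀ v ∈ A', y0 ≤ v.2 ∧ v.2 ≤ y1 := by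
    rintro v (h | rfl)
    · exact hAy v h
    · exact hAy b hA.right_mem
  have hdd : ∀ v ∈ A', v ∉ B := by
    rintro v (h | rfl) hB'
    · exact hd' v h hB'
    · have := (hBx _ hB').2; simp only at this; omega
  obtain ⟨N, p, h0, hN, hpA, hp⟩ := hAA.walk
  have hne : ∀ v ∈ B, ∀ i ≤ N, p i ≠ v := fun v hv i hi hh => hdd _ (hpA i hi) (hh ▸ hv)
  have c0 : parity N p c = 0 := by
    refine Finset.sum_eq_zero fun i hi => ?_
    have hi := Finset.mem_range.1 hi
    have h1 := (hAy' _ (hpA i hi.le)).1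
    have h2 := (hAy' _ (hpA (i + 1) hi)).1
    rw [if_neg]
    simp only [under]; omega
  have e1 : parity N p e = 1 := by
    refine parity_column N p e hp (fun i hi hh => ?_) ?_ ?_
    · have h1 := (hAy' _ (hpA i hi)).2
      have h2 := hne e hB.right_mem i hi
      rw [ne_eq, Prod.ext_iff] at h2
      omega
    · rw [h0]; exact ha.trans (hBx _ hB.right_mem).1
    · rw [hN]; have := (hBx _ hB.right_mem).2; simp only; omega
  have inv : parity N p e = 0 := by
    refine hB.rec_on (P := fun x => parity N p x = 0) c0 ?_
    intro v w hv hw hvw ih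
    have hvB := hv.right_mem
    have b1 := hBx _ hvB
    have b2 := hBx _ hw
    have k0 : (p 0).1 ≤ x0 := by rw [h0]; exact ha
    have kN : x1 + 1 ≤ (p N).1 := by rw [hN]; simp only; omega
    by_cases hcase : (w.1 = v.1 ∧ w.2 = v.2 + 1) ∨ (w.1 = v.1 + 1 ∧ w.2 = v.2) ∨
      (w.1 = v.1 + 1 ∧ w.2 = v.2 - 1)
    · rw [← parity_step hp (hne v hvB) (hne w hw) hcase (by omega) (by omega)]; exact ih
    · rw [adj_iff] at hvw
      rw [parity_step hp (hne w hw) (hne v hvB) (by omega) (by omega) (by omega)]; exact ih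
  rw [inv] at e1
  exact absurd e1 (by decide)

/-- The small lift of a difference of labels modulo 4. -/
def lift4 (a b : ℤ) : ℤ := if b - a = 3 then -1 else if b - a = -3 then 1 else b - a

lemma lift4_triangle {a b c : ℤ} (ha : 0 ≤ a ∧ a ≤ 3) (hb : 0 ≤ b ∧ b ≤ 3) (hc : 0 ≤ c ∧ c ≤ 3)
    (hab : b - a ≠ 2 ∧ b - a ≠ -2) (hbc : c - b ≠ 2 ∧ c - b ≠ -2)
    (hac : c - a ≠ 2 ∧ c - a ≠ -2) : lift4 a b + lift4 b c = lift4 a c := by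
  unfold lift4; split_ifs <;> omega

lemma no_labeling (W H : ℕ) (l : ℕ → ℕ → ℤ) (hl : ∀ i j, 0 ≤ l i j ∧ l i j ≤ 3)
    (h1 : ∀ i j, i < W → j ≤ H → l (i + 1) j - l i j ≠ 2 ∧ l (i + 1) j - l i j ≠ -2)
    (h2 : ∀ i j, i ≤ W → j < H → l i (j + 1) - l i j ≠ 2 ∧ l i (j + 1) - l i j ≠ -2)
    (h3 : ∀ i j, i < W → j < H → l i (j + 1) - l (i + 1) j ≠ 2 ∧ l i (j + 1) - l (i + 1) j ≠ -2)
    (hL : ∀ j ≤ H, l 0 j ≠ 2) (hT : ∀ i ≤ W, l i H ≠ 1) (hR : ∀ j ≤ H, l W j ≠ 0)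
    (hB : ∀ i ≤ W, l i 0 ≠ 3) : False := by
  set h : ℕ → ℕ → ℤ := fun i j => l 0 0 + (∑ k ∈ Finset.range i, lift4 (l k 0) (l (k + 1) 0)) +
    ∑ k ∈ Finset.range j, lift4 (l i k) (l i (k + 1)) with hh
  have hv : ∀ i j, h i (j + 1) = h i j + lift4 (l i j) (l i (j + 1)) := by
    intro i j; simp only [hh, Finset.sum_range_succ]; ring
  have hz : ∀ j i, i < W → j ≤ H → h (i + 1) j = h i j + lift4 (l i j) (l (i + 1) j) := by
    intro j
    induction j with
    | zero => intro i _ _; simp [hh, Finset.sum_range_succ]; ring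
    | succ j ih =>
      intro i hi hj
      rw [hv, hv, ih i hi (by omega)]
      have e1 := lift4_triangle (hl i j) (hl (i + 1) j) (hl i (j + 1)) (h1 i j hi (by omega))
        (h3 i j hi hj) (h2 i j hi.le hj)
      have e2 := lift4_triangle (hl (i + 1) j) (hl i (j + 1)) (hl (i + 1) (j + 1)) (h3 i j hi hj)
        (h1 i (j + 1) hi hj) (h2 (i + 1) j hi hj)
      omega
  have hstep : ∀ a b : ℤ, 0 ≤ a ∧ a ≤ 3 → 0 ≤ b ∧ b ≤ 3 → b - a ≠ 2 ∧ b - a ≠ -2 →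
      -1 ≤ lift4 a b ∧ lift4 a b ≤ 1 ∧ (4 ∣ lift4 a b - (b - a)) := by
    intro a b ha hb hab
    unfold lift4; split_ifs <;> omega
  have hmod0 : ∀ i ≤ W, 4 ∣ h i 0 - l i 0 := by
    intro i
    induction i with
    | zero => intro _; simp [hh]
    | succ i ih =>
      intro hi
      have := ih (by omega)
      have := hstep _ _ (hl i 0) (hl (i + 1) 0) (h1 i 0 hi (by omega))
      have := hz 0 i hi (by omega)
      omega
  have hmod : ∀ j ≤ H, ∀ i ≤ W, 4 ∣ h i j - l i j := by
    intro j
    induction j with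
    | zero => intro _ i hi; exact hmod0 i hi
    | succ j ih =>
      intro hj i hi
      have := ih (by omega) i hi
      have := hstep _ _ (hl i j) (hl i (j + 1)) (h2 i j hi hj)
      have := hv i j
      omega
  have left : ∀ j ≤ H, -1 ≤ h 0 j ∧ h 0 j ≤ 1 := by
    intro j
    induction j with
    | zero =>
      intro _
      have := hL 0 (by omega); have := hB 0 (by omega); have := hl 0 0
      simp only [hh, Finset.range_zero, Finset.sum_empty]; omega
    | succ j ih =>
      intro hj
      have := ih (by omega); have := hL (j + 1) hj; have := hl 0 (j + 1)
      have := hmod (j + 1) hj 0 (by omega)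
      have := hstep _ _ (hl 0 j) (hl 0 (j + 1)) (h2 0 j (by omega) hj)
      have := hv 0 j
      omega
  have top : ∀ i ≤ W, -2 ≤ h i H ∧ h i H ≤ 0 := by
    intro i
    induction i with
    | zero =>
      intro _
      have := left H le_rfl; have := hL H le_rfl; have := hT 0 (by omega); have := hl 0 H
      have := hmod H le_rfl 0 (by omega)
      omega
    | succ i ih =>
      intro hi
      have := ih (by omega); have := hT (i + 1) hi; have := hl (i + 1) H
      have := hmod H le_rfl (i + 1) hi
      have := hstep _ _ (hl i H) (hl (i + 1) H) (h1 i H hi le_rfl)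
      have := hz H i hi le_rfl
      omega
  have right : ∀ j ≤ H, -3 ≤ h W (H - j) ∧ h W (H - j) ≤ -1 := by
    intro j
    induction j with
    | zero =>
      intro _
      simp only [Nat.sub_zero]
      have := top W le_rfl; have := hR H le_rfl; have := hT W le_rfl; have := hl W H
      have := hmod H le_rfl W le_rfl
      omega
    | succ j ih =>
      intro hj
      obtain ⟨k, hk, hk'⟩ : ∃ k, H - j = k + 1 ∧ H - (j + 1) = k := ⟨H - (j + 1), by omega, rfl⟩
      have ih := ih (by omega)
      rw [hk] at ih
      rw [hk']
      have := hR k (by omega); have := hl W k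
      have := hmod k (by omega) W le_rfl
      have := hstep _ _ (hl W k) (hl W (k + 1)) (h2 W k le_rfl (by omega))
      have := hv W k
      omega
  have bot : ∀ i ≤ W, -4 ≤ h (W - i) 0 ∧ h (W - i) 0 ≤ -2 := by
    intro i
    induction i with
    | zero =>
      intro _
      have := right H le_rfl
      rw [Nat.sub_self] at this
      simp only [Nat.sub_zero]
      have := hR 0 (by omega); have := hB W le_rfl; have := hl W 0
      have := hmod 0 (by omega) W le_rfl
      omega
    | succ i ih =>
      intro hj
      obtain ⟨k, hk, hk'⟩ : ∃ k, W - i = k + 1 ∧ W - (i + 1) = k := ⟨W - (i + 1), by omega, rfl⟩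
      have ih := ih (by omega)
      rw [hk] at ih
      rw [hk']
      have := hB k (by omega); have := hl k 0
      have := hmod 0 (by omega) k (by omega)
      have := hstep _ _ (hl k 0) (hl (k + 1) 0) (h1 k 0 (by omega) (by omega))
      have := hz 0 k (by omega) (by omega)
      omega
  have := bot W le_rfl
  rw [Nat.sub_self] at this
  have := left 0 (by omega)
  omega

/-- Existence of crossings: every two-colouring of a rectangle has a left-right crossing of the
first colour or a top-bottom crossing of the second. -/
theorem exists_crossing (O : Set Site) {x0 x1 y0 y1 : ℤ} (hx : x0 ≤ x1) (hy : y0 ≤ y1) :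
    (∃ a b, Con (rect x0 x1 y0 y1 ∩ O) a b ∧ a.1 = x0 ∧ b.1 = x1) ∨
    (∃ a b, Con (rect x0 x1 y0 y1 \ O) a b ∧ a.2 = y0 ∧ b.2 = y1) := by
  classical
  by_contra hcon
  push Not at hcon
  obtain ⟨hO, hC⟩ := hcon
  set R := rect x0 x1 y0 y1 with hR
  set L : Set Site := {v | ∃ a, Con (R ∩ O) a v ∧ a.1 = x0}
  set D : Set Site := {v | ∃ a, Con (R \ O) a v ∧ a.2 = y0}
  set lab : Site → ℤ := fun v => if v ∈ O then (if v ∈ L then 0 else 2) else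
    (if v ∈ D then 1 else 3) with hlab
  obtain ⟨W, hW⟩ := Int.le.dest hx
  obtain ⟨H, hH⟩ := Int.le.dest hy
  have key : ∀ v w, v ∈ R → w ∈ R → Adj v w → lab w - lab v ≠ 2 ∧ lab w - lab v ≠ -2 := by
    intro v w hv hw hvw
    have l1 : v ∈ O → w ∈ O → (v ∈ L ↔ w ∈ L) := fun a b =>
      ⟨fun ⟨c, h, hc⟩ => ⟨c, h.step ⟨hw, b⟩ hvw, hc⟩,
        fun ⟨c, h, hc⟩ => ⟨c, h.step ⟨hv, a⟩ (adj_symm hvw), hc⟩⟩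
    have l2 : v ∉ O → w ∉ O → (v ∈ D ↔ w ∈ D) := fun a b =>
      ⟨fun ⟨c, h, hc⟩ => ⟨c, h.step ⟨hw, b⟩ hvw, hc⟩,
        fun ⟨c, h, hc⟩ => ⟨c, h.step ⟨hv, a⟩ (adj_symm hvw), hc⟩⟩
    simp only [hlab]
    by_cases a1 : v ∈ O <;> by_cases a2 : w ∈ O
    · simp only [a1, a2, if_true, l1 a1 a2]; split_ifs <;> norm_num
    · simp only [a1, a2, if_true, if_false]; split_ifs <;> norm_num
    · simp only [a1, a2, if_true, if_false]; split_ifs <;> norm_num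
    · simp only [a1, a2, if_false, l2 a1 a2]; split_ifs <;> norm_num
  have v0 : ∀ v, lab v = 0 → v ∈ O ∧ v ∈ L := by
    intro v; simp only [hlab]; split_ifs <;> intro h <;>
      first | exact ⟨by assumption, by assumption⟩ | exact absurd h (by norm_num)
  have v1 : ∀ v, lab v = 1 → v ∉ O ∧ v ∈ D := by
    intro v; simp only [hlab]; split_ifs <;> intro h <;>
      first | exact ⟨by assumption, by assumption⟩ | exact absurd h (by norm_num)
  have v2 : ∀ v, lab v = 2 → v ∈ O ∧ v ∉ L := by
    intro v; simp only [hlab]; split_ifs <;> intro h <;>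
      first | exact ⟨by assumption, by assumption⟩ | exact absurd h (by norm_num)
  have v3 : ∀ v, lab v = 3 → v ∉ O ∧ v ∉ D := by
    intro v; simp only [hlab]; split_ifs <;> intro h <;>
      first | exact ⟨by assumption, by assumption⟩ | exact absurd h (by norm_num)
  have mem : ∀ i j : ℕ, i ≤ W → j ≤ H → ((x0 + i, y0 + j) : Site) ∈ R := by
    intro i j hi hj
    simp only [hR, rect, Set.mem_ofPred_eq]; omega
  refine no_labeling W H (fun i j => lab (x0 + i, y0 + j)) ?_ ?_ ?_ ?_ ?_ ?_ ?_ ?_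
  · intro i j; simp only [hlab]; split_ifs <;> omega
  · intro i j hi hj
    exact key _ _ (mem i j hi.le hj) (mem (i + 1) j hi hj) (by rw [adj_iff]; push_cast; simp; omega)
  · intro i j hi hj
    exact key _ _ (mem i j hi hj.le) (mem i (j + 1) hi hj) (by rw [adj_iff]; push_cast; simp; omega)
  · intro i j hi hj
    exact key _ _ (mem (i + 1) j hi hj.le) (mem i (j + 1) hi.le hj)
      (by rw [adj_iff]; push_cast; simp; omega)
  · intro j hj h2
    obtain ⟨c1, c2⟩ := v2 _ h2
    exact c2 ⟨_, Con.refl ⟨mem 0 j (by omega) hj, c1⟩, by simp⟩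
  · intro i hi h2
    obtain ⟨c1, a, h, ha⟩ := v1 _ h2
    exact hC _ _ h ha (by simpa using hH)
  · intro j hj h2
    obtain ⟨c1, a, h, ha⟩ := v0 _ h2
    exact hO _ _ h ha (by simpa using hW)
  · intro i hi h2
    obtain ⟨c1, c2⟩ := v3 _ h2
    exact c2 ⟨_, Con.refl ⟨mem i 0 hi (by omega), c1⟩, by simp⟩

/-- Open sites. -/
def op (ω : Config) : Set Site := {v | ω v = true}

/-- Closed sites. -/
def cl (ω : Config) : Set Site := {v | ω v = false}

lemma mem_op {ω : Config} {v : Site} : v ∈ op ω ↔ ω v = true := Iff.rfl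
lemma mem_cl {ω : Config} {v : Site} : v ∈ cl ω ↔ ω v = false := Iff.rfl

lemma cl_eq_compl (ω : Config) : cl ω = (op ω)ᶜ := by
  ext v; simp [op, cl]

lemma op_flip (ω : Config) : op (flip ω) = cl ω := by
  ext v; simp [op, cl, flip]

lemma inter_op_congr {A : Set Site} {ω ω' : Config} (h : ∀ v ∈ A, ω v = ω' v) :
    A ∩ op ω = A ∩ op ω' := by
  ext v
  constructor
  · rintro ⟨h1, h2⟩; exact ⟨h1, by rw [mem_op, ← h v h1]; exact h2⟩
  · rintro ⟨h1, h2⟩; exact ⟨h1, by rw [mem_op, h v h1]; exact h2⟩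

lemma inter_cl_congr {A : Set Site} {ω ω' : Config} (h : ∀ v ∈ A, ω v = ω' v) :
    A ∩ cl ω = A ∩ cl ω' := by
  ext v
  constructor
  · rintro ⟨h1, h2⟩; exact ⟨h1, by rw [mem_cl, ← h v h1]; exact h2⟩
  · rintro ⟨h1, h2⟩; exact ⟨h1, by rw [mem_cl, h v h1]; exact h2⟩

lemma dep_op (A : Set Site) (P : Set Site → Prop) : Dep A {ω | P (A ∩ op ω)} := fun ω ω' h => by
  simp only [Set.mem_ofPred_eq, inter_op_congr h]

lemma dep_cl (A : Set Site) (P : Set Site → Prop) : Dep A {ω | P (A ∩ cl ω)} := fun ω ω' h => by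
  simp only [Set.mem_ofPred_eq, inter_cl_congr h]

lemma inc_op {A : Set Site} {P : Set Site → Prop} (h : ∀ S T, S ⊆ T → P S → P T) :
    Inc {ω | P (A ∩ op ω)} := fun _ _ hh => h _ _ fun v hv => ⟨hv.1, hh v hv.2⟩

lemma dec_cl {A : Set Site} {P : Set Site → Prop} (h : ∀ S T, S ⊆ T → P S → P T) :
    Dec {ω | P (A ∩ cl ω)} := fun _ _ hh => h _ _ fun v hv => ⟨hv.1, hh v hv.2⟩

/-- A connection inside `S` from `X` to `Y`. -/
def Link (S X Y : Set Site) : Prop := ∃ u v, u ∈ X ∧ v ∈ Y ∧ Con S u v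

lemma Link.mono {S T X Y X' Y' : Set Site} (h : Link S X Y) (hST : S ⊆ T) (hX : X ∩ S ⊆ X')
    (hY : Y ∩ S ⊆ Y') : Link T X' Y' := by
  obtain ⟨u, v, hu, hv, h⟩ := h
  exact ⟨u, v, hX ⟨hu, h.left_mem⟩, hY ⟨hv, h.right_mem⟩, h.mono hST⟩

lemma Link.of_subset {S T X Y : Set Site} (hST : S ⊆ T) (h : Link S X Y) : Link T X Y :=
  h.mono hST Set.inter_subset_left Set.inter_subset_left

lemma dec_link (A X Y : Set Site) : Dec {ω | Link (A ∩ cl ω) X Y} :=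
  dec_cl (P := fun S => Link S X Y) fun _ _ h => Link.of_subset h

lemma inc_link (A X Y : Set Site) : Inc {ω | Link (A ∩ op ω) X Y} :=
  inc_op (P := fun S => Link S X Y) fun _ _ h => Link.of_subset h

lemma dep_link_cl (A X Y : Set Site) : Dep A {ω | Link (A ∩ cl ω) X Y} :=
  dep_cl A (fun S => Link S X Y)

lemma dep_link_op (A X Y : Set Site) : Dep A {ω | Link (A ∩ op ω) X Y} :=
  dep_op A (fun S => Link S X Y)

/-- Closed cluster of `src` in `Ω`. -/
def clus (Ω src : Set Site) (ω : Config) : Set Site := {v | ∃ s ∈ src, Con (Ω ∩ cl ω) s v}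

/-- Sites revealed by the exploration when the cluster is `k`. -/
def Zb (Ω src k : Set Site) : Set Site := k ∪ {v | v ∈ Ω ∧ (v ∈ src ∨ ∃ w ∈ k, Adj w v)}

section Clus
variable {Ω src k : Set Site} {ω : Config} {v w : Site}

lemma clus_subset : clus Ω src ω ⊆ Ω ∩ cl ω := fun _ ⟨_, _, h⟩ => h.right_mem

lemma clus_step (hv : v ∈ clus Ω src ω) (hw : w ∈ Ω) (hc : ω w = false) (h : Adj v w) :
    w ∈ clus Ω src ω := by
  obtain ⟨s, hs, hv⟩ := hv
  exact ⟨s, hs, hv.step ⟨hw, hc⟩ h⟩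

lemma clus_src (hw : w ∈ Ω) (hs : w ∈ src) (hc : ω w = false) : w ∈ clus Ω src ω :=
  ⟨w, hs, Con.refl ⟨hw, hc⟩⟩

lemma clus_con (h : Con (Ω ∩ cl ω) v w) (hv : v ∈ clus Ω src ω) : w ∈ clus Ω src ω :=
  h.rec_on (P := fun x => x ∈ clus Ω src ω) hv fun _ _ _ hb hab ih =>
    clus_step ih hb.1 hb.2 hab

lemma Zb_closed (hv : v ∈ Zb Ω src (clus Ω src ω)) (hc : ω v = false) : v ∈ clus Ω src ω := by
  rcases hv with hv | ⟨h1, h2 | ⟨w, h2, h3⟩⟩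
  · exact hv
  · exact clus_src h1 h2 hc
  · exact clus_step h2 h1 hc h3

lemma Zb_subset (hk : k ⊆ Ω) : Zb Ω src k ⊆ Ω := by
  rintro v (h | h)
  · exact hk h
  · exact h.1

/-- Inside its cluster a site is joined to the source. -/
lemma clus_path (hv : v ∈ clus Ω src ω) : ∃ s ∈ src, Con (clus Ω src ω) s v := by
  obtain ⟨s, hs, h⟩ := hv
  refine ⟨s, hs, h.rec_on (P := fun x => Con (clus Ω src ω) s x) (Con.refl ⟨s, hs, Con.refl h.1⟩) ?_⟩
  intro a b _ hb hab ih
  exact ih.step (clus_step ih.right_mem hb.1 hb.2 hab) hab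

/-- An open or revealed site is joined to the source through the cluster. -/
lemma Zb_path (hv : v ∈ Zb Ω src (clus Ω src ω)) :
    ∃ s ∈ src, Con (clus Ω src ω ∪ {v}) s v := by
  rcases hv with hv | ⟨h1, h2 | ⟨w, h2, h3⟩⟩
  · obtain ⟨s, hs, h⟩ := clus_path hv
    exact ⟨s, hs, h.mono subset_union_left⟩
  · exact ⟨v, h2, Con.refl (Or.inr rfl)⟩
  · obtain ⟨s, hs, h⟩ := clus_path h2
    exact ⟨s, hs, (h.mono subset_union_left).step (Or.inr rfl) h3⟩

lemma clus_dep (Ω src k : Set Site) : Dep (Zb Ω src k) {ω | clus Ω src ω = k} := by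
  refine dep_of_imp ?_
  intro ω ω' hh hk
  simp only [Set.mem_ofPred_eq] at hk ⊢
  apply Set.Subset.antisymm
  · rintro v ⟨s, hs, h⟩
    refine h.rec_on (P := fun x => x ∈ k) ?_ ?_
    · have hz : s ∈ Zb Ω src k := Or.inr ⟨h.1.1, Or.inl hs⟩
      rw [← hk] at hz ⊢
      exact Zb_closed hz (by rw [hh s (by rwa [hk] at hz)]; exact h.1.2)
    · intro a b _ hb hab ih
      have hz : b ∈ Zb Ω src k := Or.inr ⟨hb.1, Or.inr ⟨a, ih, hab⟩⟩
      rw [← hk] at hz ⊢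
      exact Zb_closed hz (by rw [hh b (by rwa [hk] at hz)]; exact hb.2)
  · intro v hv
    have hv' := hv
    rw [← hk] at hv'
    obtain ⟨s, hs, h⟩ := clus_path hv'
    rw [hk] at h
    refine ⟨s, hs, h.mono fun x hx => ?_⟩
    have hx' := hx
    rw [← hk] at hx'
    refine ⟨(clus_subset hx').1, ?_⟩
    rw [mem_cl, ← hh x (Or.inl hx)]
    exact (clus_subset hx').2

end Clus

/-- Sites of the symmetric strip. -/
def strip (b a1 a2 : ℤ) : Set Site :=
  {v | 0 ≤ v.2 ∧ v.2 ≤ b ∧ a1 ≤ 2 * v.1 + v.2 ∧ 2 * v.1 + v.2 ≤ a2}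

lemma rect_finite (x0 x1 y0 y1 : ℤ) : (rect x0 x1 y0 y1).Finite := by
  refine ((Set.finite_Icc x0 x1).prod (Set.finite_Icc y0 y1)).subset ?_
  rintro ⟨x, y⟩ h
  simp only [rect, Set.mem_ofPred_eq] at h
  exact ⟨⟨h.1, h.2.1⟩, ⟨h.2.2.1, h.2.2.2⟩⟩

lemma strip_finite (b a1 a2 : ℤ) : (strip b a1 a2).Finite := by
  refine (rect_finite (-(|a1| + |a2| + |b|)) (|a1| + |a2| + |b|) 0 b).subset ?_
  rintro ⟨x, y⟩ h
  simp only [strip, rect, Set.mem_ofPred_eq] at h ⊢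
  have := neg_abs_le a1; have := le_abs_self a2; have := le_abs_self b
  have := abs_nonneg a1; have := abs_nonneg a2; have := abs_nonneg b
  omega

/-- Open crossing of a strip. -/
def stripCross (b a : ℤ) : Set Config :=
  {ω | Link (strip b 0 a ∩ op ω) {v | 2 * v.1 + v.2 ≤ 1} {v | a - 1 ≤ 2 * v.1 + v.2}}

/-- Crossing of two paths in a slanted strip: `S` joins the left side or the top left part to
the right side or the bottom right part, `T` joins the top to the bottom in between. -/
lemma strip_meet {b a : ℤ} (hb : 0 ≤ b) {S T : Set Site} {s e t f : Site} (hSR : S ⊆ strip b 0 a)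
    (hTR : T ⊆ strip b 0 a) (hS : Con S s e) (hT : Con T t f) (ht : t.2 = b) (hf : f.2 = 0)
    (hs : 2 * s.1 + s.2 ≤ 1 ∨ (s.2 = b ∧ s.1 ≤ t.1))
    (he : a - 1 ≤ 2 * e.1 + e.2 ∨ (e.2 = 0 ∧ f.1 ≤ e.1)) : (S ∩ T).Nonempty := by
  by_contra hd
  have hd' : ∀ v ∈ S, v ∉ T := fun v h1 h2 => hd ⟨v, h1, h2⟩
  set X : ℤ := |b| + |a| + 2 with hX
  have hbX : ∀ v ∈ strip b 0 a, -X ≤ v.1 ∧ v.1 ≤ X := by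
    intro v hv
    simp only [strip, Set.mem_ofPred_eq] at hv
    have := le_abs_self b; have := le_abs_self a; have := abs_nonneg a
    omega
  have hsb := hbX s (hSR hS.left_mem)
  have heb := hbX e (hSR hS.right_mem)
  have hTb : ∀ v ∈ T, 0 ≤ v.2 ∧ v.2 ≤ b := fun v hv => ⟨(hTR hv).1, (hTR hv).2.1⟩
  have hSb : ∀ v ∈ S, 0 ≤ v.2 ∧ v.2 ≤ b := fun v hv => ⟨(hSR hv).1, (hSR hv).2.1⟩
  have hss := hSb s hS.left_mem
  have hee := hSb e hS.right_mem
  obtain ⟨L, l, hl, hL, hLp⟩ : ∃ (L : Set Site) (l : Site), l.1 ≤ -X ∧ Con (S ∪ L) l s ∧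
      ∀ v ∈ L, (0 ≤ v.2 ∧ v.2 ≤ b + 1) ∧ v ∉ T ∧ (v.2 = b + 1 → v.1 < t.1) := by
    rcases hs with hs | ⟨hs, hst⟩
    · refine ⟨{v | v.2 = s.2 ∧ v.1 < s.1}, (-X - 1, s.2), by simp, ?_, ?_⟩
      · have h1 : Con {v : Site | v.2 = s.2 ∧ v.1 < s.1} (-X - 1, s.2) (s.1 - 1, s.2) :=
          con_horiz (by omega) fun t _ h => ⟨rfl, by simp only; omega⟩
        exact (h1.mono subset_union_right).step (Or.inl hS.left_mem) (by rw [adj_iff]; simp)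
      · rintro v ⟨h1, h2⟩
        refine ⟨by omega, fun h => ?_, by omega⟩
        have := (hTR h).2.2.1
        omega
    · have hst' : s.1 < t.1 := by
        rcases hst.lt_or_eq with h | h
        · exact h
        · have : s = t := Prod.ext h (hs.trans ht.symm)
          exact absurd (this ▸ hT.left_mem) (hd' s hS.left_mem)
      refine ⟨{v | v.2 = b + 1 ∧ v.1 ≤ s.1}, (-X, b + 1), le_rfl, ?_, ?_⟩
      · have h1 : Con {v : Site | v.2 = b + 1 ∧ v.1 ≤ s.1} (-X, b + 1) (s.1, b + 1) :=
          con_horiz (by omega) fun t _ h => ⟨rfl, h⟩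
        exact (h1.mono subset_union_right).step (Or.inl hS.left_mem) (by rw [adj_iff]; simp; omega)
      · rintro v ⟨h1, h2⟩
        exact ⟨by omega, fun h => by have := hTb v h; omega, by omega⟩
  obtain ⟨Q, q, hq, hQ, hQp⟩ : ∃ (Q : Set Site) (q : Site), X ≤ q.1 ∧ Con (S ∪ Q) e q ∧
      ∀ v ∈ Q, (-1 ≤ v.2 ∧ v.2 ≤ b) ∧ v ∉ T ∧ (v.2 = -1 → f.1 < v.1) := by
    rcases he with he | ⟨he, hfe⟩
    · refine ⟨{v | v.2 = e.2 ∧ e.1 < v.1}, (X + 1, e.2), by simp, ?_, ?_⟩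
      · have h1 : Con {v : Site | v.2 = e.2 ∧ e.1 < v.1} (e.1 + 1, e.2) (X + 1, e.2) :=
          con_horiz (by omega) fun t h _ => ⟨rfl, by simp only; omega⟩
        exact (Con.single (Or.inl hS.right_mem) (Or.inr h1.left_mem)
          (by rw [adj_iff]; simp)).trans (h1.mono subset_union_right)
      · rintro v ⟨h1, h2⟩
        refine ⟨by omega, fun h => ?_, by omega⟩
        have := (hTR h).2.2.2
        omega
    · have hfe' : f.1 < e.1 := by
        rcases hfe.lt_or_eq with h | h
        · exact h
        · have : f = e := Prod.ext h (hf.trans he.symm)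
          exact absurd (this ▸ hT.right_mem) (hd' e hS.right_mem)
      refine ⟨{v | v.2 = -1 ∧ e.1 ≤ v.1}, (X, -1), le_rfl, ?_, ?_⟩
      · have h1 : Con {v : Site | v.2 = -1 ∧ e.1 ≤ v.1} (e.1, -1) (X, -1) :=
          con_horiz (by omega) fun t h _ => ⟨rfl, h⟩
        exact (Con.single (Or.inl hS.right_mem) (Or.inr h1.left_mem)
          (by rw [adj_iff]; simp; omega)).trans (h1.mono subset_union_right)
      · rintro v ⟨h1, h2⟩
        exact ⟨by omega, fun h => by have := hTb v h; omega, by omega⟩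
  set B : Set Site := T ∪ {(t.1, b + 1), (f.1, -1)}
  have hB : Con B (f.1, -1) (t.1, b + 1) := by
    have h1 : Con B (f.1, -1) f := Con.single (Or.inr (Or.inr rfl)) (Or.inl hT.right_mem)
      (by rw [adj_iff]; simp; omega)
    have h2 : Con B t (t.1, b + 1) := Con.single (Or.inl hT.left_mem) (Or.inr (Or.inl rfl))
      (by rw [adj_iff]; simp; omega)
    exact h1.trans ((hT.symm.mono subset_union_left).trans h2)
  have hBx : ∀ v ∈ B, -X ≤ v.1 ∧ v.1 ≤ X := by
    rintro v (h | rfl | rfl)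
    · exact hbX v (hTR h)
    · exact hbX t (hTR hT.left_mem)
    · exact hbX f (hTR hT.right_mem)
  have hA : Con (S ∪ (L ∪ Q)) l q :=
    (hL.mono (by rw [← union_assoc]; exact subset_union_left)).trans
      ((hS.mono subset_union_left).trans (hQ.mono (union_subset_union_right S subset_union_right)))
  obtain ⟨v, hv1, hv2⟩ := crossings_meet (x0 := -X) (x1 := X) (y0 := -1) (y1 := b + 1) hA hB
    (by
      rintro v (h | h | h)
      · have := hSb v h; omega
      · have := hLp v h; omega
      · have := hQp v h; omega) hBx hl hq (by simp) (by simp)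
  rcases hv1 with h1 | h1 | h1 <;> rcases hv2 with h2 | rfl | rfl
  · exact hd' v h1 h2
  · have := hSb _ h1; simp only at this; omega
  · have := hSb _ h1; simp only at this; omega
  · exact (hLp _ h1).2.1 h2
  · have := (hLp _ h1).2.2 rfl; simp only at this; omega
  · have := (hLp _ h1).1; simp only at this; omega
  · exact (hQp _ h1).2.1 h2
  · have := (hQp _ h1).1; simp only at this; omega
  · have := (hQp _ h1).2.2 rfl; simp only at this; omega

/-- Reflection of the slanted strip. -/
def refl (c : ℤ) (v : Site) : Site := (c - v.1 - v.2, v.2)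

lemma refl_refl (c : ℤ) (v : Site) : refl c (refl c v) = v := by
  refine Prod.ext ?_ rfl
  simp only [refl]; omega

lemma refl_adj (c : ℤ) {v w : Site} (h : Adj v w) : Adj (refl c v) (refl c w) := by
  rw [adj_iff] at h ⊢; simp only [refl]; omega

/-- Right side or bottom right part of the strip. -/
def rsTarget (c : ℤ) : Set Site :=
  {v | 2 * c - 1 ≤ 2 * v.1 + v.2 ∨ (v.2 = 0 ∧ c ≤ 2 * v.1 + v.2)}

/-- Sites explored from the top of the left half. -/
def rsZ (b c : ℤ) (k : Set Site) : Set Site := Zb (strip b 0 (c - 1)) {v | v.2 = b} k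

/-- Unexplored sites with unexplored mirror image. -/
def rsFree (b c : ℤ) (k : Set Site) : Set Site :=
  strip b 0 (2 * c) \ (rsZ b c k ∪ {v | refl c v ∈ rsZ b c k})

/-- An open path from the explored region to the target. -/
def rsOpen (b c : ℤ) (k : Set Site) : Set Config :=
  {ω | Link (rsFree b c k ∩ op ω) {v | ∃ z ∈ rsZ b c k, Adj z v} (rsTarget c)}

/-- The mirror event with colours exchanged. -/
def rsClosed (b c : ℤ) (k : Set Site) : Set Config :=
  {ω | Link (rsFree b c k ∩ cl ω) {v | ∃ z ∈ rsZ b c k, Adj z (refl c v)}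
    {v | refl c v ∈ rsTarget c}}

lemma Pr_rsClosed_le (b c : ℤ) (k : Set Site) : Pr (rsClosed b c k) ≤ Pr (rsOpen b c k) := by
  have hinv : Function.Involutive (refl c) := refl_refl c
  rw [← Pr_flip (rsOpen b c k), ← Pr_reindex hinv.toPerm (flip ⁻¹' rsOpen b c k)]
  refine Pr_mono ?_
  rintro ω ⟨u, v, ⟨z, hz, hzu⟩, hv, h⟩
  refine ⟨refl c u, refl c v, ⟨z, hz, hzu⟩, hv, h.map (fun a b => refl_adj c) ?_⟩
  rintro x ⟨⟨hx1, hx2⟩, hx3⟩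
  refine ⟨⟨?_, ?_⟩, ?_⟩
  · simp only [strip, refl, Set.mem_ofPred_eq] at hx1 ⊢; omega
  · rintro (h | h)
    · exact hx2 (Or.inr h)
    · exact hx2 (Or.inl (by simpa [refl_refl] using h))
  · rw [mem_cl] at hx3
    simp [mem_op, flip, refl_refl, hx3]

lemma rsOpen_or_rsClosed {b c g : ℤ} (hb : 0 ≤ b) (hg : 1 ≤ g) (hc : c = 2 * g) {k : Set Site}
    (hk : k ⊆ strip b 0 (c - 1)) (ω : Config) : ω ∈ rsOpen b c k ∨ ω ∈ rsClosed b c k := by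
  set R := strip b 0 (2 * c) with hR
  set Z := rsZ b c k with hZ
  have hZ1 : Z ⊆ strip b 0 (c - 1) := Zb_subset hk
  have hZtop : ∀ v : Site, v.2 = b → 0 ≤ 2 * v.1 + v.2 → 2 * v.1 + v.2 ≤ c - 1 → v ∈ Z := by
    intro v h1 h2 h3
    exact Or.inr ⟨⟨by omega, by omega, h2, h3⟩, Or.inl h1⟩
  have hmR : ∀ v : Site, v ∈ R ↔ 0 ≤ v.2 ∧ v.2 ≤ b ∧ 0 ≤ 2 * v.1 + v.2 ∧ 2 * v.1 + v.2 ≤ 2 * c :=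
    fun v => Iff.rfl
  have hmZ : ∀ v ∈ Z, 0 ≤ v.2 ∧ v.2 ≤ b ∧ 0 ≤ 2 * v.1 + v.2 ∧ 2 * v.1 + v.2 ≤ c - 1 :=
    fun v hv => hZ1 hv
  set O : Set Site := {v | (v.2 = b + 1 ∧ 2 * (v.1 + 1) + b ≤ c - 1) ∨
    (v.2 = -1 ∧ c ≤ 2 * (v.1 - 1)) ∨ (0 ≤ v.2 ∧ v.2 ≤ b ∧ (2 * c < 2 * v.1 + v.2 ∨
      (v ∈ R ∧ (v ∈ Z ∨ (refl c v ∉ Z ∧ ω v = true)))))} with hO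
  have hmO : ∀ v : Site, v ∈ O ↔ (v.2 = b + 1 ∧ 2 * (v.1 + 1) + b ≤ c - 1) ∨
    (v.2 = -1 ∧ c ≤ 2 * (v.1 - 1)) ∨ (0 ≤ v.2 ∧ v.2 ≤ b ∧ (2 * c < 2 * v.1 + v.2 ∨
      (v ∈ R ∧ (v ∈ Z ∨ (refl c v ∉ Z ∧ ω v = true))))) := fun v => Iff.rfl
  clear_value O
  set X : ℤ := b + c + 2 with hX
  have hF : ∀ v, v ∈ rsFree b c k ↔ v ∈ R ∧ v ∉ Z ∧ refl c v ∉ Z := by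
    intro v; simp only [rsFree, ← hR, ← hZ, mem_sdiff, mem_union, not_or]; rfl
  rcases exists_crossing O (x0 := -X) (x1 := X) (y0 := -1) (y1 := b + 1) (by omega) (by omega) with
    ⟨u, w, h, hu, hw⟩ | ⟨u, w, h, hu, hw⟩
  · left
    have hu1 := h.left_mem
    have hw1 := h.right_mem
    have huH : u ∈ ({v | v.2 = b + 1} ∪ Z : Set Site) := by
      rcases (hmO u).1 hu1.2 with h | h | ⟨h1, h2, h | ⟨h, _⟩⟩
      · exact Or.inl h.1
      · omega
      · omega
      · rw [hmR] at h; omega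
    have hwH : w ∉ ({v | v.2 = b + 1} ∪ Z : Set Site) := by
      rintro (h | h)
      · simp only [Set.mem_ofPred_eq] at h
        rcases (hmO w).1 hw1.2 with h' | h' | h'
        · omega
        · omega
        · omega
      · have := hmZ w h; omega
    obtain ⟨z, f, _, hzH, hzf, hf⟩ := h.leave huH hwH
    have hzO : z ∈ O := by rename_i hz; exact hz.2
    obtain ⟨⟨_, hfO⟩, hfH⟩ := hf.left_mem
    rw [mem_union, not_or] at hfH
    obtain ⟨hf1, hf2⟩ := hfH
    simp only [Set.mem_ofPred_eq] at hf1
    have hfZ : ∃ z ∈ Z, Adj z f := by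
      rcases hzH with hz | hz
      · exfalso
        simp only [Set.mem_ofPred_eq] at hz
        rcases (hmO z).1 hzO with h' | h' | h'
        · have ha := adj_iff.1 hzf
          rcases (hmO f).1 hfO with h | h | ⟨h1, h2, h3⟩
          · omega
          · omega
          · have : f.2 = b := by omega
            by_cases h4 : 0 ≤ 2 * f.1 + f.2
            · exact hf2 (hZtop f this h4 (by omega))
            · rcases h3 with h3 | ⟨h3, _⟩
              · omega
              · rw [hmR] at h3; omega
        · omega
        · omega
      · exact ⟨z, hz, hzf⟩
    obtain ⟨z', hz', hzf'⟩ := hfZ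
    have ha := adj_iff.1 hzf'
    have hb' := hmZ z' hz'
    have hfF : f ∈ rsFree b c k := by
      rw [hF]
      rcases (hmO f).1 hfO with h | h | ⟨h1, h2, h | ⟨h, h' | h'⟩⟩
      · omega
      · omega
      · omega
      · exact absurd h' hf2
      · exact ⟨h, hf2, h'.1⟩
    rcases hf.stay_or_exit hfF with h' | ⟨a, a', h1, h2, h3, h4⟩
    · have := ((hF w).1 h'.right_mem.2).1
      rw [hmR] at this; omega
    · refine ⟨f, a, ⟨z', hz', hzf'⟩, ?_, h1.mono ?_⟩
      · have haF := (hF a).1 h1.right_mem.2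
        have haR := (hmR a).1 haF.1
        have ha := adj_iff.1 h2
        simp only [rsTarget, Set.mem_ofPred_eq]
        obtain ⟨⟨_, h5⟩, h6⟩ := h3
        rw [mem_union, not_or] at h6
        rcases (hmO a').1 h5 with h | h | ⟨h1, h2, h | ⟨h, h' | h'⟩⟩
        · exact absurd h.1 h6.1
        · omega
        · omega
        · exact absurd h' h6.2
        · exact absurd ((hF a').2 ⟨h, h6.2, h'.1⟩) h4
      · rintro x ⟨⟨⟨_, hx1⟩, hx2⟩, hx3⟩
        refine ⟨hx3, ?_⟩
        obtain ⟨h1, h2, h3⟩ := (hF x).1 hx3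
        have h1' := (hmR x).1 h1
        rcases (hmO x).1 hx1 with h | h | ⟨h1, h2, h | ⟨h, h' | h'⟩⟩
        · omega
        · omega
        · omega
        · exact absurd h' (by assumption)
        · exact h'.2
  · right
    have hu1 := h.left_mem
    have hw1 := h.right_mem
    have huH : u ∉ ({v | v.2 = b + 1} ∪ {v | refl c v ∈ Z} : Set Site) := by
      rintro (h | h)
      · simp only [Set.mem_ofPred_eq] at h; omega
      · have := hmZ _ h; simp only [refl] at this; omega
    obtain ⟨z, f, hz0, hzH, hzf, hf⟩ := h.symm.leave
      (H := ({v | v.2 = b + 1} ∪ {v | refl c v ∈ Z} : Set Site)) (Or.inl hw) huH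
    obtain ⟨⟨hfr, hfO⟩, hfH⟩ := hf.left_mem
    rw [mem_union, not_or] at hfH
    obtain ⟨hf1, hf2⟩ := hfH
    simp only [Set.mem_ofPred_eq] at hf1 hf2
    have ha := adj_iff.1 hzf
    have hfr2 : -1 ≤ f.2 ∧ f.2 ≤ b + 1 := ⟨hfr.2.2.1, hfr.2.2.2⟩
    have hzO := hz0.2
    have key : f ∈ R ∧ ∃ z ∈ Z, Adj z (refl c f) := by
      rcases hzH with hz | hz
      · simp only [Set.mem_ofPred_eq] at hz
        have hz2 : c ≤ 2 * (z.1 + 1) + b := by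
          by_contra hcon
          exact hzO ((hmO z).2 (Or.inl ⟨hz, by omega⟩))
        have hfb : f.2 = b := by omega
        have hfR : f ∈ R := by
          rw [hmR]
          by_cases h5 : 2 * c < 2 * f.1 + f.2
          · exact absurd ((hmO f).2 (Or.inr (Or.inr ⟨by omega, by omega, Or.inl h5⟩))) hfO
          · omega
        refine ⟨hfR, ?_⟩
        have hfR' := (hmR f).1 hfR
        have hfZ : f ∉ Z := fun hfZ =>
          hfO ((hmO f).2 (Or.inr (Or.inr ⟨by omega, by omega, Or.inr ⟨hfR, Or.inl hfZ⟩⟩)))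
        have h1 : c ≤ 2 * f.1 + f.2 := by
          by_contra hcon
          exact hfZ (hZtop f hfb (by omega) (by omega))
        have h2 : 2 * f.1 + f.2 ≤ c := by
          by_contra hcon
          refine hf2 (hZtop _ hfb ?_ ?_) <;> simp only [refl] <;> omega
        refine ⟨(f.1 - 1, b), hZtop _ rfl ?_ ?_, ?_⟩
        · simp only; omega
        · simp only; omega
        · rw [adj_iff]; simp only [refl]; omega
      · have hzZ := hmZ _ hz
        simp only [refl] at hzZ
        refine ⟨?_, _, hz, refl_adj c hzf⟩
        rw [hmR]
        by_cases h4 : f.2 = -1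
        · exact absurd ((hmO f).2 (Or.inr (Or.inl ⟨h4, by omega⟩))) hfO
        · by_cases h5 : 2 * c < 2 * f.1 + f.2
          · exact absurd ((hmO f).2 (Or.inr (Or.inr ⟨by omega, by omega, Or.inl h5⟩))) hfO
          · omega
    obtain ⟨hfR, z', hz', hzf'⟩ := key
    have nZ : ∀ v : Site, v ∈ R → v ∉ O → v ∉ Z := fun v h1 h2 h3 => by
      have := (hmR v).1 h1
      exact h2 ((hmO v).2 (Or.inr (Or.inr ⟨by omega, by omega, Or.inr ⟨h1, Or.inl h3⟩⟩)))
    have hfF : f ∈ rsFree b c k := (hF f).2 ⟨hfR, nZ f hfR hfO, hf2⟩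
    rcases hf.stay_or_exit hfF with h' | ⟨a, a', h1, h2, h3, h4⟩
    · have := ((hF u).1 h'.right_mem.2).1
      rw [hmR] at this; omega
    · refine ⟨f, a, ⟨z', hz', hzf'⟩, ?_, h1.mono ?_⟩
      · have haF := (hF a).1 h1.right_mem.2
        have haR := (hmR a).1 haF.1
        have ha := adj_iff.1 h2
        simp only [rsTarget, Set.mem_ofPred_eq, refl]
        obtain ⟨⟨h7, h5⟩, h6⟩ := h3
        rw [mem_union, not_or] at h6
        simp only [Set.mem_ofPred_eq] at h6
        have h8 : a' ∉ R := fun h => h4 ((hF a').2 ⟨h, nZ _ h h5, h6.2⟩)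
        rw [hmR] at h8
        have h9 : -1 ≤ a'.2 ∧ a'.2 ≤ b + 1 := ⟨h7.2.2.1, h7.2.2.2⟩
        by_cases h10 : a'.2 = -1
        · have : ¬ c ≤ 2 * (a'.1 - 1) := fun h => h5 ((hmO a').2 (Or.inr (Or.inl ⟨h10, h⟩)))
          omega
        · have : ¬ 2 * c < 2 * a'.1 + a'.2 := fun h =>
            h5 ((hmO a').2 (Or.inr (Or.inr ⟨by omega, by omega, Or.inl h⟩)))
          omega
      · rintro x ⟨⟨⟨_, hx1⟩, hx2⟩, hx3⟩
        refine ⟨hx3, ?_⟩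
        obtain ⟨h1, h2, h3⟩ := (hF x).1 hx3
        have h1' := (hmR x).1 h1
        rw [mem_cl]
        by_contra hcon
        rw [Bool.not_eq_false] at hcon
        exact hx1 ((hmO x).2 (Or.inr (Or.inr ⟨by omega, by omega, Or.inr ⟨h1, Or.inr ⟨h3, hcon⟩⟩⟩)))

lemma half_le_Pr_rsOpen {b c g : ℤ} (hb : 0 ≤ b) (hg : 1 ≤ g) (hc : c = 2 * g) {k : Set Site}
    (hk : k ⊆ strip b 0 (c - 1)) : 1 / 2 ≤ Pr (rsOpen b c k) := by
  have h1 : Pr (rsOpen b c k ∪ rsClosed b c k) = 1 := by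
    rw [← Pr_univ]; congr 1
    exact Set.eq_univ_of_forall fun ω => rsOpen_or_rsClosed hb hg hc hk ω
  have := Pr_union_le (rsOpen b c k) (rsClosed b c k)
  have := Pr_rsClosed_le b c k
  linarith

/-- Exploration of a closed cluster: conditionally on the cluster the unexplored sites are still
independent. -/
lemma explore_clus {Ω S src : Set Site} (hΩ : Ω ⊆ S) (hS : S.Finite) {c : ℝ}
    (e e' : Set Site → Set Config) (de : ∀ k, k ⊆ Ω → Dep (S \ Zb Ω src k) (e k))
    (de' : ∀ k, k ⊆ Ω → Dep (S \ Zb Ω src k) (e' k)) (h : ∀ k, k ⊆ Ω → c * Pr (e k) ≤ Pr (e' k)) :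
    c * Pr {ω | ω ∈ e (clus Ω src ω)} ≤ Pr {ω | ω ∈ e' (clus Ω src ω)} := by
  have hsub : ∀ ω, clus Ω src ω ⊆ Ω := fun ω v hv => (clus_subset hv).1
  have key := explore_le (c := c) (S := S) (hS.subset hΩ) hS (clus Ω src) hsub
    (fun k => Zb Ω src (k ∩ Ω)) (fun k => (Zb_subset inter_subset_right).trans hΩ) ?_
    (fun k => e (k ∩ Ω)) (fun k => e' (k ∩ Ω)) (fun k => de _ inter_subset_right)
    (fun k => de' _ inter_subset_right) (fun k => h _ inter_subset_right)
  · have h1 : ∀ ω, clus Ω src ω ∩ Ω = clus Ω src ω := fun ω => inter_eq_left.2 (hsub ω)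
    simpa only [h1] using key
  · intro k
    by_cases hk : k ⊆ Ω
    · rw [inter_eq_left.2 hk]; exact clus_dep Ω src k
    · have : {ω | clus Ω src ω = k} = ∅ := by
        rw [Set.eq_empty_iff_forall_notMem]
        rintro ω rfl
        exact hk (hsub ω)
      rw [this]; exact dep_const _ False

/-- An open path from the left side to the right side or the bottom right part. -/
def rsE (b c : ℤ) : Set Config :=
  {ω | Link (strip b 0 (2 * c) ∩ op ω) {v | 2 * v.1 + v.2 ≤ 1} (rsTarget c)}

set_option maxHeartbeats 1000000 in
lemma rsE_of_rsOpen {b c g : ℤ} (hb : 0 ≤ b) (hg : 1 ≤ g) (hc : c = 2 * g) {ω : Config}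
    (hK : ∀ v ∈ clus (strip b 0 (c - 1)) {v | v.2 = b} ω, v.2 ≠ 0)
    (h0 : ω ∈ rsOpen b c (clus (strip b 0 (c - 1)) {v | v.2 = b} ω)) : ω ∈ rsE b c := by
  set K := clus (strip b 0 (c - 1)) {v | v.2 = b} ω with hKd
  set R := strip b 0 (2 * c) with hR
  have hmR : ∀ v : Site, v ∈ R ↔ 0 ≤ v.2 ∧ v.2 ≤ b ∧ 0 ≤ 2 * v.1 + v.2 ∧ 2 * v.1 + v.2 ≤ 2 * c :=
    fun v => Iff.rfl
  have hK1 : ∀ v ∈ K, 0 ≤ v.2 ∧ v.2 ≤ b ∧ 0 ≤ 2 * v.1 + v.2 ∧ 2 * v.1 + v.2 ≤ c - 1 :=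
    fun v hv => (clus_subset hv).1
  have hZ1 : ∀ v ∈ rsZ b c K, 0 ≤ v.2 ∧ v.2 ≤ b ∧ 0 ≤ 2 * v.1 + v.2 ∧ 2 * v.1 + v.2 ≤ c - 1 :=
    fun v hv => Zb_subset (fun _ hx => (clus_subset hx).1) hv
  have hKc : ∀ v ∈ K, ω v = false := fun v hv => (clus_subset hv).2
  set O : Set Site := {v | (v.2 = -1 ∧ c ≤ 2 * (v.1 - 1)) ∨
    (0 ≤ v.2 ∧ (2 * v.1 + v.2 < 0 ∨ 2 * c < 2 * v.1 + v.2 ∨ (v ∈ R ∧ ω v = true)))} with hO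
  have hmO : ∀ v : Site, v ∈ O ↔ (v.2 = -1 ∧ c ≤ 2 * (v.1 - 1)) ∨
    (0 ≤ v.2 ∧ (2 * v.1 + v.2 < 0 ∨ 2 * c < 2 * v.1 + v.2 ∨ (v ∈ R ∧ ω v = true))) :=
    fun v => Iff.rfl
  clear_value O
  set X : ℤ := b + c + 2 with hX
  rcases exists_crossing O (x0 := -X) (x1 := X) (y0 := -1) (y1 := b) (by omega) (by omega) with
    ⟨u, w, h, hu, hw⟩ | ⟨u, w, h, hu, hw⟩
  · have hur := h.left_mem.1
    have hwr := h.right_mem.1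
    simp only [rect, Set.mem_ofPred_eq] at hur hwr
    have hw1 : ¬ (0 ≤ w.2 ∧ 2 * w.1 + w.2 < 0) := by omega
    have hu1 : 0 ≤ u.2 ∧ 2 * u.1 + u.2 < 0 := by
      rcases (hmO u).1 h.left_mem.2 with h | h
      · omega
      · exact ⟨h.1, by omega⟩
    obtain ⟨p, p', _, hp, hpp, hp'⟩ := h.leave (H := {v : Site | 0 ≤ v.2 ∧ 2 * v.1 + v.2 < 0}) hu1 hw1
    have ha := adj_iff.1 hpp
    simp only [Set.mem_ofPred_eq] at hp
    obtain ⟨⟨hp1, hp2⟩, hp3⟩ := hp'.left_mem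
    simp only [Set.mem_ofPred_eq] at hp3
    have hpR : p' ∈ R ∩ op ω := by
      rcases (hmO p').1 hp2 with h | ⟨h1, h | h | h⟩
      · omega
      · omega
      · omega
      · exact h
    rcases hp'.stay_or_exit hpR with h' | ⟨a, a', h1, h2, h3, h4⟩
    · have := (hmR w).1 h'.right_mem.2.1; omega
    · refine ⟨p', a, by simp only [Set.mem_ofPred_eq]; omega, ?_, h1.mono inter_subset_right⟩
      have haR := (hmR a).1 h1.right_mem.2.1
      have ha := adj_iff.1 h2
      obtain ⟨⟨h5, h6⟩, h7⟩ := h3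
      simp only [Set.mem_ofPred_eq] at h7
      simp only [rsTarget, Set.mem_ofPred_eq]
      rcases (hmO a').1 h6 with h | ⟨h8, h | h | h⟩
      · omega
      · omega
      · omega
      · exact absurd h h4
  · exfalso
    have hur := h.left_mem.1
    have hwr := h.right_mem.1
    simp only [rect, Set.mem_ofPred_eq] at hur hwr
    have hnO : ∀ v : Site, v ∉ O → 0 ≤ v.2 → v.2 ≤ b → v ∈ R ∩ cl ω := by
      intro v h1 h2 h3
      rw [hmO] at h1
      simp only [not_or, not_and] at h1
      obtain ⟨h4, h5, h6⟩ := h1.2 h2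
      have h7 : v ∈ R := (hmR v).2 (by omega)
      refine ⟨h7, ?_⟩
      rw [mem_cl, ← Bool.not_eq_true]; exact h6 h7
    have hwR := hnO w h.right_mem.2 (by omega) (by omega)
    have huR : u ∉ R := by rw [hmR]; omega
    obtain ⟨f, hf0, hfc, hζ⟩ : ∃ f : Site, f.2 = 0 ∧ 2 * f.1 + f.2 ≤ c ∧ Con (R ∩ cl ω) w f := by
      rcases h.symm.stay_or_exit hwR.1 with h' | ⟨f, a', h1, h2, h3, h4⟩
      · exact absurd h'.right_mem.2 huR
      · have hfR := (hmR f).1 h1.right_mem.2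
        have ha := adj_iff.1 h2
        obtain ⟨h5, h6⟩ := h3
        simp only [rect, Set.mem_ofPred_eq] at h5
        have h7 : a'.2 = -1 := by
          by_contra hcon
          exact h4 (hnO a' h6 (by omega) (by omega)).1
        have h8 : ¬ c ≤ 2 * (a'.1 - 1) := fun h => h6 ((hmO a').2 (Or.inl ⟨h7, h⟩))
        refine ⟨f, by omega, by omega, h1.mono ?_⟩
        rintro x ⟨⟨_, hx1⟩, hx2⟩
        have := (hmR x).1 hx2
        exact hnO x hx1 (by omega) (by omega)
    obtain ⟨u', q, ⟨z, hz, hzu⟩, hq, hcon⟩ := h0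
    obtain ⟨s, hs, hsz⟩ : ∃ s ∈ {v : Site | v.2 = b}, Con (K ∪ {z}) s z := Zb_path hz
    simp only [Set.mem_ofPred_eq] at hs
    set S : Set Site := K ∪ {z} ∪ (rsFree b c K ∩ op ω) with hSd
    have hSc : Con S s q := ((hsz.mono subset_union_left).step (Or.inr hcon.left_mem) hzu).trans
      (hcon.mono subset_union_right)
    have hSR : S ⊆ R := by
      rintro v ((h | h) | h)
      · have := hK1 v h; rw [hmR]; omega
      · rw [mem_singleton_iff] at h; subst h; have := hZ1 _ hz; rw [hmR]; omega
      · exact h.1.1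
    have hs1 : 2 * s.1 + s.2 ≤ c - 1 := by
      rcases hsz.left_mem with h | h
      · exact (hK1 s h).2.2.2
      · rw [mem_singleton_iff] at h; rw [h]; exact (hZ1 z hz).2.2.2
    set T0 : Set Site := R ∩ cl ω ∩ Kᶜ with hT0
    have hST0 : ∀ v ∈ S, v ∉ T0 := by
      rintro v ((h | h) | h) hv
      · exact hv.2 h
      · rw [mem_singleton_iff] at h; subst h; exact hv.2 (Zb_closed hz hv.1.2)
      · have h1 : ω v = true := h.2
        have h2 : ω v = false := hv.1.2
        simp [h1] at h2
    have hq' : ∀ f : Site, f.2 = 0 → 2 * f.1 + f.2 ≤ c →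
        2 * c - 1 ≤ 2 * q.1 + q.2 ∨ (q.2 = 0 ∧ f.1 ≤ q.1) := by
      intro f h1 h2
      rcases hq with h | h
      · exact Or.inl h
      · exact Or.inr ⟨h.1, by omega⟩
    rcases hζ.symm.stay_or_exit (H := Kᶜ) (fun h => hK f h hf0) with h' | ⟨a, a', h1, h2, h3, h4⟩
    · have hwK : w ∉ K := h'.right_mem.2
      have hwR' := (hmR w).1 hwR.1
      have hcw : c ≤ 2 * w.1 + w.2 := by
        by_contra hcon
        exact hwK (clus_src ⟨by omega, by omega, by omega, by omega⟩ hw hwR.2)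
      obtain ⟨v, hv1, hv2⟩ := strip_meet hb hSR (fun v hv => hv.1.1) hSc h'.symm hw hf0
        (Or.inr ⟨hs, by omega⟩) (hq' f hf0 hfc)
      exact hST0 v hv1 hv2
    · rw [mem_compl_iff, not_not] at h4
      have ha := adj_iff.1 h2
      have ha1 := h1.right_mem
      have haR := (hmR a).1 ha1.1.1
      have ha'K := hK1 a' h4
      have hac : c ≤ 2 * a.1 + a.2 := by
        by_contra hcon
        exact ha1.2 (clus_step h4 ⟨by omega, by omega, by omega, by omega⟩ ha1.1.2 (adj_symm h2))
      obtain ⟨s', hs', hsa⟩ := clus_path h4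
      simp only [Set.mem_ofPred_eq] at hs'
      have hs'K := hK1 s' hsa.left_mem
      set T : Set Site := T0 ∪ {v | refl c v ∈ K} with hTd
      have hmap : Con {v | refl c v ∈ K} (refl c s') (refl c a') :=
        hsa.map (fun _ _ => refl_adj c) fun v hv => by
          simp only [Set.mem_ofPred_eq, refl_refl]; exact hv
      have hT : Con T (refl c s') f := by
        have e1 : Con T (refl c s') (refl c a') := hmap.mono subset_union_right
        have e2 : Con T a f := h1.symm.mono subset_union_left
        by_cases heq : a = refl c a'
        · rw [← heq] at e1; exact e1.trans e2
        · refine (e1.step e2.left_mem ?_).trans e2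
          have : ¬ (a.1 = c - a'.1 - a'.2 ∧ a.2 = a'.2) := fun h => heq (Prod.ext h.1 h.2)
          clear hmap hq' hZ1 hK hs'K haR hur hwr
          rw [adj_iff]; simp only [refl]; omega
      have hTR : T ⊆ R := by
        rintro v (h | h)
        · exact h.1.1
        · have := hK1 _ h; simp only [refl] at this; rw [hmR]; omega
      have g1 : (refl c s').2 = b := hs'
      have g2 : s.1 ≤ (refl c s').1 := by
        clear hmap hq' hZ1 hK haR hur hwr ha
        simp only [refl]; omega
      obtain ⟨v, hv1, hv2⟩ := strip_meet hb hSR hTR hSc hT g1 hf0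
        (Or.inr ⟨hs, g2⟩) (hq' f hf0 hfc)
      rcases hv2 with hv2 | hv2
      · exact hST0 v hv1 hv2
      · have hv3 := hK1 _ hv2
        simp only [refl] at hv3
        rcases hv1 with (h | h) | h
        · have := hK1 v h; omega
        · rw [mem_singleton_iff] at h; subst h; have := hZ1 _ hz; omega
        · exact h.1.2 (Or.inr (Or.inl hv2))

lemma no_bottom_of_stripCross {b a : ℤ} (hb : 0 ≤ b) {ω : Config} (h : ω ∈ stripCross b a) :
    ∀ v ∈ clus (strip b 0 a) {v | v.2 = b} ω, v.2 ≠ 0 := by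
  intro v hv hv0
  obtain ⟨s, hs, hsv⟩ := clus_path hv
  obtain ⟨p, q, hp, hq, hpq⟩ := h
  obtain ⟨x, hx1, hx2⟩ := strip_meet hb inter_subset_left (fun x hx => (clus_subset hx).1) hpq hsv
    hs hv0 (Or.inl hp) (Or.inl hq)
  have h1 : ω x = true := hx1.2
  have h2 : ω x = false := (clus_subset hx2).2
  simp [h1] at h2

lemma Pr_rsE_ge {b c g : ℤ} (hb : 0 ≤ b) (hg : 1 ≤ g) (hc : c = 2 * g) :
    1 / 2 * Pr (stripCross b (c - 1)) ≤ Pr (rsE b c) := by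
  classical
  have key := explore_clus (c := 1 / 2) (Ω := strip b 0 (c - 1)) (S := strip b 0 (2 * c))
    (src := {v | v.2 = b}) (fun v hv => ⟨hv.1, hv.2.1, hv.2.2.1, by have := hv.2.2.2; omega⟩)
    (strip_finite _ _ _) (fun k => if ∀ v ∈ k, v.2 ≠ 0 then univ else ∅)
    (fun k => if ∀ v ∈ k, v.2 ≠ 0 then rsOpen b c k else ∅) ?_ ?_ ?_
  · refine le_trans ?_ (key.trans (Pr_mono ?_))
    · refine mul_le_mul_of_nonneg_left (Pr_mono ?_) (by norm_num)
      intro ω h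
      simp only [Set.mem_ofPred_eq]
      rw [if_pos (no_bottom_of_stripCross hb h)]; trivial
    · intro ω h
      simp only [Set.mem_ofPred_eq] at h
      split_ifs at h with h3
      · exact rsE_of_rsOpen hb hg hc h3 h
      · exact absurd h (Set.notMem_empty _)
  · intro k _
    split_ifs
    · exact fun _ _ _ => Iff.rfl
    · exact fun _ _ _ => Iff.rfl
  · intro k _
    beta_reduce
    split_ifs
    · refine (dep_link_op _ _ _).mono ?_
      rintro v ⟨h1, h2⟩
      exact ⟨h1, fun h => h2 (Or.inl h)⟩
    · exact fun _ _ _ => Iff.rfl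
  · intro k hk
    beta_reduce
    split_ifs
    · rw [Pr_univ, mul_one]; exact half_le_Pr_rsOpen hb hg hc hk
    · rw [Pr_empty, mul_zero]

/-- A path stays in the component of its starting point. -/
lemma Con.comp {A : Set Site} {u v : Site} (h : Con A u v) : Con {x | Con A u x} u v :=
  h.rec_on (P := fun x => Con {x | Con A u x} u x) (Con.refl (Con.refl h.1))
    fun _ _ hu hb hab ih => ih.step (hu.step hb hab) hab

lemma Link.shrink_strip {O : Set Site} {a b : ℤ} {u v : Site} (ha : 1 ≤ a)
    (hO : ∀ v ∈ O, 0 ≤ v.2 ∧ v.2 ≤ b)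
    (h : Con O u v) (hu : 2 * u.1 + u.2 ≤ 1) (hv : a - 1 ≤ 2 * v.1 + v.2) :
    Link (strip b 0 a ∩ O) {v | 2 * v.1 + v.2 ≤ 1} {v | a - 1 ≤ 2 * v.1 + v.2} := by
  obtain ⟨u', hu', hu2, h'⟩ : ∃ u' : Site, 0 ≤ 2 * u'.1 + u'.2 ∧ 2 * u'.1 + u'.2 ≤ 1 ∧
      Con (O ∩ {v | 0 ≤ 2 * v.1 + v.2}) u' v := by
    by_cases h0 : 0 ≤ 2 * u.1 + u.2
    · by_cases hex : Con (O ∩ {v | 0 ≤ 2 * v.1 + v.2}) u v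
      · exact ⟨u, h0, hu, hex⟩
      · obtain ⟨w, w', h1, h2, h3, h4⟩ := h.symm.stay_or_exit (H := {v | 0 ≤ 2 * v.1 + v.2})
          (by simp only [Set.mem_ofPred_eq]; omega) |>.resolve_left (fun h => hex h.symm)
        have := h1.right_mem.2
        have ha := adj_iff.1 h2
        simp only [Set.mem_ofPred_eq] at this h4
        exact ⟨w, by omega, by omega, h1.symm⟩
    · obtain ⟨w, w', h1, h2, h3, h4⟩ := h.leave (H := {v : Site | 2 * v.1 + v.2 < 0})
        (by simp only [Set.mem_ofPred_eq]; omega) (by simp only [Set.mem_ofPred_eq]; omega)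
      have := h4.left_mem.2
      have ha := adj_iff.1 h3
      simp only [Set.mem_ofPred_eq] at this h2
      refine ⟨w', by omega, by omega, h4.mono ?_⟩
      rintro x ⟨hx1, hx2⟩
      simp only [Set.mem_ofPred_eq] at hx2
      exact ⟨hx1, by simp only [Set.mem_ofPred_eq]; omega⟩
  have hsub : ∀ v, v ∈ O ∩ {v | 0 ≤ 2 * v.1 + v.2} ∩ {v | 2 * v.1 + v.2 ≤ a} →
      v ∈ strip b 0 a ∩ O := fun v hv => ⟨⟨(hO v hv.1.1).1, (hO v hv.1.1).2, hv.1.2, hv.2⟩, hv.1.1⟩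
  rcases h'.stay_or_exit (H := {v | 2 * v.1 + v.2 ≤ a}) (by simp only [Set.mem_ofPred_eq]; omega)
    with h'' | ⟨w, w', h1, h2, h3, h4⟩
  · exact ⟨u', v, hu2, hv, h''.mono hsub⟩
  · have ha := adj_iff.1 h2
    simp only [Set.mem_ofPred_eq] at h4
    exact ⟨u', w, hu2, by simp only [Set.mem_ofPred_eq]; omega, h1.mono hsub⟩

lemma stripCross_anti {b a a' : ℤ} (ha : 1 ≤ a) (h : a ≤ a') : stripCross b a' ⊆ stripCross b a := by
  rintro ω ⟨u, v, hu, hv, huv⟩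
  simp only [Set.mem_ofPred_eq] at hu hv
  have := Link.shrink_strip ha (O := strip b 0 a' ∩ op ω) (fun v hv => ⟨hv.1.1, hv.1.2.1⟩) huv hu
    (by omega)
  refine this.of_subset ?_
  rintro x ⟨h1, h2⟩
  exact ⟨h1, h2.2⟩

lemma stripCross_of_rsE {b c : ℤ} (hb : 0 ≤ b) {ω : Config} (h1 : ω ∈ rsE b c)
    (h2 : (fun v => ω (refl c v)) ∈ rsE b c) : ω ∈ stripCross b (2 * c) := by
  set R := strip b 0 (2 * c) with hR
  have hmR : ∀ v : Site, v ∈ R ↔ 0 ≤ v.2 ∧ v.2 ≤ b ∧ 0 ≤ 2 * v.1 + v.2 ∧ 2 * v.1 + v.2 ≤ 2 * c :=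
    fun v => Iff.rfl
  obtain ⟨s, e, hs, he, h1⟩ := h1
  obtain ⟨t', f', ht, hf, h2⟩ := h2
  have h3 : Con (R ∩ op ω) (refl c t') (refl c f') := h2.map (fun _ _ => refl_adj c) (by
    rintro x ⟨hx1, hx2⟩
    refine ⟨?_, hx2⟩
    have := (hmR x).1 hx1
    rw [hmR]; simp only [refl]; omega)
  clear h2
  simp only [Set.mem_ofPred_eq, rsTarget] at hs he ht hf
  set t := refl c t' with htd
  set f := refl c f' with hfd
  have ht1 : 2 * c - 1 ≤ 2 * t.1 + t.2 := by simp only [htd, refl]; omega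
  have hf1 : 2 * f.1 + f.2 ≤ 1 ∨ (f.2 = 0 ∧ 2 * f.1 + f.2 ≤ c) := by
    simp only [hfd, refl]; omega
  clear_value t f
  rcases he with he | he
  · exact ⟨s, e, hs, he, h1⟩
  rcases hf1 with hf1 | hf1
  · exact ⟨f, t, hf1, ht1, h3.symm⟩
  have htR := (hmR t).1 h3.left_mem.1
  set Lg : Set Site := {v | v.1 = t.1 + 1 ∧ t.2 ≤ v.2 ∧ v.2 ≤ b} with hLg
  have hl : Con Lg (t.1 + 1, t.2) (t.1 + 1, b) := con_vert htR.2.1 fun y h1 h2 => ⟨rfl, h1, h2⟩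
  set T : Set Site := {x | Con (R ∩ op ω) t x} ∪ Lg
  have hT : Con T (t.1 + 1, b) f := by
    have e1 : Con T (t.1 + 1, b) (t.1 + 1, t.2) := hl.symm.mono subset_union_right
    exact (e1.step (Or.inl (Con.refl h3.left_mem)) (by rw [adj_iff]; simp)).trans
      (h3.comp.mono subset_union_left)
  have hSR : {x | Con (R ∩ op ω) s x} ⊆ strip b 0 (2 * c + b + 2) := by
    intro v hv
    have := (hmR v).1 hv.right_mem.1
    exact ⟨by omega, by omega, by omega, by omega⟩
  have hTR : T ⊆ strip b 0 (2 * c + b + 2) := by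
    rintro v (hv | ⟨h4, h5, h6⟩)
    · have := (hmR v).1 hv.right_mem.1
      exact ⟨by omega, by omega, by omega, by omega⟩
    · exact ⟨by omega, by omega, by omega, by omega⟩
  obtain ⟨x, hx1, hx2⟩ := strip_meet hb hSR hTR h1.comp hT rfl hf1.1 (Or.inl hs)
    (Or.inr ⟨he.1, by omega⟩)
  rcases hx2 with hx2 | ⟨h4, h5, h6⟩
  · exact ⟨s, t, hs, ht1, Con.trans hx1 (Con.symm hx2)⟩
  · have := (hmR x).1 hx1.right_mem.1
    omega

lemma Pr_stripCross_double {b c g : ℤ} (hb : 0 ≤ b) (hg : 1 ≤ g) (hc : c = 2 * g) {p : ℝ}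
    (hp0 : 0 ≤ p) (hp : p ≤ Pr (stripCross b (c - 1))) : p ^ 2 / 4 ≤ Pr (stripCross b (2 * c)) := by
  have h1 := Pr_rsE_ge hb hg hc
  have hinv : Function.Involutive (refl c) := refl_refl c
  set E2 : Set Config := (fun (ω : Config) v => ω ((Function.Involutive.toPerm (refl c) hinv) v)) ⁻¹' rsE b c with hE2
  have h2 : Pr E2 = Pr (rsE b c) := Pr_reindex (Function.Involutive.toPerm (refl c) hinv) (rsE b c)
  have hE2' : ∀ ω, ω ∈ E2 ↔ (fun v => ω (refl c v)) ∈ rsE b c := fun ω => Iff.rfl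
  have d1 : Dep (strip b 0 (2 * c)) (rsE b c) := dep_link_op _ _ _
  have i1 : Inc (rsE b c) := inc_link _ _ _
  have d2 : Dep (strip b 0 (2 * c)) E2 := by
    intro ω ω' h
    rw [hE2', hE2']
    refine d1 _ _ fun v hv => h _ ?_
    have h1 := hv.1; have h2 := hv.2.1; have h3 := hv.2.2.1; have h4 := hv.2.2.2
    refine ⟨?_, ?_, ?_, ?_⟩ <;> simp only [refl] <;> omega
  have i2 : Inc E2 := fun ω ω' h => i1 _ _ fun v => h (refl c v)
  have h3 := harris (X := univ) (strip_finite b 0 (2 * c)) (i1.incOn _) (i2.incOn _) d1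
    (by rw [inter_univ]; exact d2)
  have h4 : rsE b c ∩ E2 ⊆ stripCross b (2 * c) := fun ω h => stripCross_of_rsE hb h.1 h.2
  have h5 := Pr_mono h4
  rw [h2] at h3
  have : p / 2 ≤ Pr (rsE b c) := by linarith
  nlinarith

/-- Swap of the coordinates. -/
def swp : Site ≃ Site := Equiv.prodComm ℤ ℤ

lemma swp_apply (v : Site) : swp v = (v.2, v.1) := rfl

lemma swp_adj {v w : Site} (h : Adj v w) : Adj (swp v) (swp w) := by
  rw [adj_iff] at h ⊢; simp only [swp_apply]; omega

/-- Translation. -/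
def trl (z : Site) : Site ≃ Site := Equiv.addRight z

lemma trl_apply (z v : Site) : trl z v = (v.1 + z.1, v.2 + z.2) := rfl

lemma trl_adj (z : Site) {v w : Site} (h : Adj v w) : Adj (trl z v) (trl z w) := by
  rw [adj_iff] at h ⊢; simp only [trl_apply]; omega

/-- Open left-right crossing of a rectangle. -/
def lrOp (x0 x1 y0 y1 : ℤ) : Set Config :=
  {ω | Link (rect x0 x1 y0 y1 ∩ op ω) {v | v.1 ≤ x0} {v | x1 ≤ v.1}}

/-- Open bottom-top crossing of a rectangle. -/
def btOp (x0 x1 y0 y1 : ℤ) : Set Config :=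
  {ω | Link (rect x0 x1 y0 y1 ∩ op ω) {v | v.2 ≤ y0} {v | y1 ≤ v.2}}

/-- Closed left-right crossing of a rectangle. -/
def lrCl (x0 x1 y0 y1 : ℤ) : Set Config :=
  {ω | Link (rect x0 x1 y0 y1 ∩ cl ω) {v | v.1 ≤ x0} {v | x1 ≤ v.1}}

/-- Closed bottom-top crossing of a rectangle. -/
def btCl (x0 x1 y0 y1 : ℤ) : Set Config :=
  {ω | Link (rect x0 x1 y0 y1 ∩ cl ω) {v | v.2 ≤ y0} {v | y1 ≤ v.2}}

lemma Pr_lrCl (x0 x1 y0 y1 : ℤ) : Pr (lrCl x0 x1 y0 y1) = Pr (lrOp x0 x1 y0 y1) := by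
  rw [← Pr_flip (lrOp x0 x1 y0 y1)]
  congr 1; ext ω; simp only [lrCl, lrOp, mem_preimage, Set.mem_ofPred_eq, op_flip]

lemma Pr_btCl (x0 x1 y0 y1 : ℤ) : Pr (btCl x0 x1 y0 y1) = Pr (btOp x0 x1 y0 y1) := by
  rw [← Pr_flip (btOp x0 x1 y0 y1)]
  congr 1; ext ω; simp only [btCl, btOp, mem_preimage, Set.mem_ofPred_eq, op_flip]

lemma Pr_lrOp_le_btOp (x0 x1 y0 y1 : ℤ) : Pr (lrOp x0 x1 y0 y1) ≤ Pr (btOp y0 y1 x0 x1) := by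
  rw [← Pr_reindex swp (lrOp x0 x1 y0 y1)]
  refine Pr_mono ?_
  rintro ω ⟨u, v, hu, hv, h⟩
  refine ⟨swp u, swp v, hu, hv, h.map (fun _ _ => swp_adj) ?_⟩
  rintro x ⟨⟨h1, h2, h3, h4⟩, h5⟩
  exact ⟨⟨h3, h4, h1, h2⟩, h5⟩

lemma Pr_btOp_le_lrOp (x0 x1 y0 y1 : ℤ) : Pr (btOp x0 x1 y0 y1) ≤ Pr (lrOp y0 y1 x0 x1) := by
  rw [← Pr_reindex swp (btOp x0 x1 y0 y1)]
  refine Pr_mono ?_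
  rintro ω ⟨u, v, hu, hv, h⟩
  refine ⟨swp u, swp v, hu, hv, h.map (fun _ _ => swp_adj) ?_⟩
  rintro x ⟨⟨h1, h2, h3, h4⟩, h5⟩
  exact ⟨⟨h3, h4, h1, h2⟩, h5⟩

lemma Pr_lrOp_trl (x0 x1 y0 y1 a b : ℤ) :
    Pr (lrOp x0 x1 y0 y1) ≤ Pr (lrOp (x0 + a) (x1 + a) (y0 + b) (y1 + b)) := by
  rw [← Pr_reindex (trl (a, b)) (lrOp x0 x1 y0 y1)]
  refine Pr_mono ?_
  rintro ω ⟨u, v, hu, hv, h⟩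
  simp only [Set.mem_ofPred_eq] at hu hv
  refine ⟨trl (a, b) u, trl (a, b) v, ?_, ?_, h.map (fun _ _ => trl_adj _) ?_⟩
  · simp only [trl_apply, Set.mem_ofPred_eq]; omega
  · simp only [trl_apply, Set.mem_ofPred_eq]; omega
  rintro x ⟨⟨h1, h2, h3, h4⟩, h5⟩
  refine ⟨⟨?_, ?_, ?_, ?_⟩, h5⟩ <;> simp only [trl_apply] <;> omega

lemma half_le_Pr_lrOp_square {N : ℤ} (hN : 0 ≤ N) : 1 / 2 ≤ Pr (lrOp 0 N 0 N) := by
  have h1 : Pr (lrOp 0 N 0 N ∪ btCl 0 N 0 N) = 1 := by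
    rw [← Pr_univ]; congr 1
    refine Set.eq_univ_of_forall fun ω => ?_
    rcases exists_crossing (op ω) hN hN with ⟨a, b, h, h1, h2⟩ | ⟨a, b, h, h1, h2⟩
    · exact Or.inl ⟨a, b, h1.le, h2.ge, h⟩
    · refine Or.inr ⟨a, b, h1.le, h2.ge, ?_⟩
      rwa [cl_eq_compl]
  have := Pr_union_le (lrOp 0 N 0 N) (btCl 0 N 0 N)
  have := Pr_btCl 0 N 0 N
  have := Pr_btOp_le_lrOp 0 N 0 N
  linarith

lemma half_le_Pr_stripCross {g : ℤ} (hg : 1 ≤ g) : 1 / 2 ≤ Pr (stripCross (2 * g) (2 * g)) := by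
  refine (half_le_Pr_lrOp_square (N := 2 * g) (by omega)).trans
    ((Pr_lrOp_trl 0 (2 * g) 0 (2 * g) (-g) 0).trans (Pr_mono ?_))
  rintro ω ⟨u, v, hu, hv, h⟩
  simp only [Set.mem_ofPred_eq] at hu hv
  have hu' := h.left_mem.1
  have hv' := h.right_mem.1
  simp only [rect, Set.mem_ofPred_eq] at hu' hv'
  have := Link.shrink_strip (a := 2 * g) (b := 2 * g) (by omega) ?_ h (by omega) (by omega)
  · refine this.of_subset ?_
    rintro x ⟨h1, h2⟩
    exact ⟨h1, h2.2⟩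
  · rintro x ⟨⟨h1, h2, h3, h4⟩, _⟩
    exact ⟨by omega, by omega⟩

lemma exists_Pr_stripCross_ge (i : ℕ) :
    ∃ p : ℝ, 0 < p ∧ ∀ g : ℤ, 1 ≤ g → p ≤ Pr (stripCross (2 * g) (2 ^ i * (2 * g))) := by
  induction i with
  | zero => exact ⟨1 / 2, by norm_num, fun g hg => by simpa using half_le_Pr_stripCross hg⟩
  | succ i ih =>
    obtain ⟨p, hp, h⟩ := ih
    refine ⟨p ^ 2 / 4, by positivity, fun g hg => ?_⟩
    have h1 : (1 : ℤ) ≤ 2 ^ i := one_le_pow₀ (by norm_num)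
    have h2 : 1 ≤ 2 ^ i * g := by nlinarith
    have := Pr_stripCross_double (b := 2 * g) (c := 2 ^ i * (2 * g)) (g := 2 ^ i * g) (by omega) h2
      (by ring) hp.le ((h g hg).trans (Pr_mono (stripCross_anti ?_ (by omega))))
    · have e : (2 : ℤ) ^ (i + 1) * (2 * g) = 2 * (2 ^ i * (2 * g)) := by ring
      rw [e]; exact this
    · have : 2 ^ i * (2 * g) = 2 * (2 ^ i * g) := by ring
      omega

/-- A portion of a path crossing the slab `x0 ≤ f ≤ x1`. -/
lemma Con.shrink {O : Set Site} {u v : Site} (h : Con O u v) {f : Site → ℤ}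
    (hf : ∀ a b, Adj a b → f b ≤ f a + 1 ∧ f a ≤ f b + 1) {x0 x1 : ℤ} (hu : f u ≤ x0)
    (hx : x0 ≤ x1) (hv : x1 ≤ f v) :
    ∃ a b, f a = x0 ∧ f b = x1 ∧ Con (O ∩ {x | x0 ≤ f x ∧ f x ≤ x1}) a b := by
  obtain ⟨b, hb, h1⟩ := h.hit f (fun a b hab => (hf a b hab).1) (c := x1) (by omega) hv
  obtain ⟨a, ha, h2⟩ := h1.symm.hit (fun x => -f x)
    (fun a b hab => by have := (hf a b hab).2; omega) (c := -x0) (by omega)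
    (by omega)
  refine ⟨a, b, by omega, hb, h2.symm.mono ?_⟩
  rintro x ⟨⟨h3, h4⟩, h5⟩
  simp only [Set.mem_ofPred_eq] at h4 h5
  exact ⟨h3, by omega, h4⟩

lemma lrOp_mono {x0 x1 x1' y0 y1 y1' : ℤ} (hx : x0 ≤ x1) (h1 : x1 ≤ x1') (h2 : y1' ≤ y1) :
    lrOp x0 x1' y0 y1' ⊆ lrOp x0 x1 y0 y1 := by
  rintro ω ⟨u, v, hu, hv, h⟩
  obtain ⟨a, e, ha, he, hae⟩ := h.shrink (f := fun v => v.1)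
    (fun a b hab => by have := adj_bound hab; omega) hu hx (h1.trans hv)
  refine ⟨a, e, ha.le, he.ge, hae.mono ?_⟩
  rintro x ⟨⟨b1, b2⟩, b3, b4⟩
  exact ⟨⟨b3, b4, b1.2.2.1, b1.2.2.2.trans h2⟩, b2⟩

lemma Pr_site_open (v : Site) : Pr {ω | ω v = true} = 1 / 2 := by
  have h1 : Pr {ω | ω v = false} = Pr {ω | ω v = true} := by
    rw [← Pr_flip {ω | ω v = true}]
    congr 1; ext ω; simp [flip]
  have h2 : Pr {ω | ω v = true}ᶜ = 1 - Pr {ω | ω v = true} :=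
    Pr_compl (Set.finite_singleton v) fun ω ω' h => by simp [h v rfl]
  have h3 : {ω : Config | ω v = true}ᶜ = {ω | ω v = false} := by ext ω; simp
  rw [h3, h1] at h2
  linarith

lemma Pr_row_pos (L : ℕ) : 0 < Pr (lrOp 0 L 0 0) := by
  suffices h : ∃ A : Set Config, Inc A ∧ Dep (rect 0 L 0 0) A ∧ 0 < Pr A ∧
      ∀ ω ∈ A, ∀ x : ℤ, 0 ≤ x → x ≤ L → ω (x, 0) = true by
    obtain ⟨A, _, _, h1, h2⟩ := h
    refine h1.trans_le (Pr_mono fun ω hω => ?_)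
    exact ⟨(0, 0), (L, 0), le_refl (0 : ℤ), le_refl (L : ℤ), con_horiz (by positivity) fun t ht1 ht2 =>
      ⟨⟨ht1, ht2, le_rfl, le_rfl⟩, h2 ω hω t ht1 ht2⟩⟩
  induction L with
  | zero =>
    refine ⟨{ω | ω (0, 0) = true}, fun ω ω' h => h _, fun ω ω' h => ?_, by rw [Pr_site_open]; norm_num,
      fun ω h x h1 h2 => ?_⟩
    · have := h (0, 0) ⟨le_rfl, by simp, le_rfl, le_rfl⟩
      simp [this]
    · have : x = 0 := by push_cast at h2; omega
      subst this; exact h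
  | succ L ih =>
    obtain ⟨A, i1, d1, h1, h2⟩ := ih
    have d2 : Dep (rect 0 (L + 1 : ℕ) 0 0) {ω : Config | ω ((L : ℤ) + 1, 0) = true} := fun ω ω' h => by
      have := h ((L : ℤ) + 1, 0) ⟨by simp only; omega, by simp, le_rfl, le_rfl⟩
      simp [this]
    have d1' : Dep (rect 0 (L + 1 : ℕ) 0 0) A :=
      d1.mono fun v hv => ⟨hv.1, by have := hv.2.1; push_cast; omega, hv.2.2⟩
    have i2 : Inc {ω : Config | ω ((L : ℤ) + 1, 0) = true} := fun ω ω' h => h _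
    refine ⟨A ∩ {ω | ω ((L : ℤ) + 1, 0) = true}, fun ω ω' h hA => ⟨i1 _ _ h hA.1, i2 _ _ h hA.2⟩,
      d1'.inter d2, ?_, ?_⟩
    · have := harris (X := univ) (rect_finite 0 (L + 1 : ℕ) 0 0) (i1.incOn _) (i2.incOn _) d1'
        (by rw [inter_univ]; exact d2)
      rw [Pr_site_open] at this
      linarith
    · rintro ω ⟨hA, hB⟩ x hx1 hx2
      push_cast at hx2
      by_cases hx : x ≤ L
      · exact h2 ω hA x hx1 hx
      · have : x = L + 1 := by omega
        subst this; exact hB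

lemma exists_lt_Pr_lrOp (k : ℕ) :
    ∃ c : ℝ, 0 < c ∧ ∀ L h : ℤ, 0 ≤ h → 0 ≤ L → L ≤ k * (h + 1) → c ≤ Pr (lrOp 0 L 0 h) := by
  obtain ⟨p, hp, h⟩ := exists_Pr_stripCross_ge (4 * k + 2)
  refine ⟨min p (Pr (lrOp 0 (2 * k : ℕ) 0 0)), lt_min hp (Pr_row_pos _), fun L H hH hL0 hL => ?_⟩
  by_cases h1 : H ≤ 1
  · refine (min_le_right _ _).trans (Pr_mono (lrOp_mono hL0 ?_ hH))
    push_cast; nlinarith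
  · refine (min_le_left _ _).trans ?_
    obtain ⟨g, hg⟩ : ∃ g : ℤ, H = 2 * g ∨ H = 2 * g + 1 := ⟨H / 2, by omega⟩
    have hg1 : 1 ≤ g := by omega
    refine ((h g hg1).trans ?_).trans (Pr_mono (lrOp_mono hL0 le_rfl (y1' := 2 * g) (by omega)))
    refine Pr_mono ?_
    rintro ω ⟨u, v, hu, hv, huv⟩
    simp only [Set.mem_ofPred_eq] at hu hv
    have hu' := huv.left_mem.1
    have hv' := huv.right_mem.1
    simp only [strip, Set.mem_ofPred_eq] at hu' hv'
    have h2 : (4 * k + 2 : ℤ) + 1 ≤ 2 ^ (4 * k + 2) := by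
      exact_mod_cast Nat.lt_two_pow_self (n := 4 * k + 2)
    have h3 : (4 * k + 2 + 1) * (2 * g) ≤ 2 ^ (4 * k + 2) * (2 * g) :=
      mul_le_mul_of_nonneg_right h2 (by omega)
    have h4 : L ≤ k * (2 * g + 2) := hL.trans (mul_le_mul_of_nonneg_left (by omega) (by omega))
    have h5 : (k : ℤ) ≤ k * g := le_mul_of_one_le_right (by omega) hg1
    have h6 : (4 * k + 2 + 1) * (2 * g) = 8 * (k * g) + 6 * g := by ring
    have h7 : (k : ℤ) * (2 * g + 2) = 2 * (k * g) + 2 * k := by ring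
    obtain ⟨a, e, ha, he, hae⟩ := huv.shrink (f := fun v => v.1) (fun a b hab => by
      have := adj_bound hab; omega) (x0 := 0) (x1 := L) (by omega) hL0
      (by omega)
    refine ⟨a, e, ha.le, he.ge, hae.mono ?_⟩
    rintro x ⟨⟨b1, b2⟩, b3, b4⟩
    exact ⟨⟨b3, b4, b1.1, b1.2.1⟩, b2⟩

/-- Russo--Seymour--Welsh lower bounds for crossings of rectangles. -/
theorem rsw (k : ℕ) : ∃ c : ℝ, 0 < c ∧ ∀ x0 x1 y0 y1 : ℤ, y0 ≤ y1 → x0 ≤ x1 →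
    (x1 - x0 ≤ k * (y1 - y0 + 1) → c ≤ Pr (lrOp x0 x1 y0 y1) ∧ c ≤ Pr (lrCl x0 x1 y0 y1)) ∧
    (y1 - y0 ≤ k * (x1 - x0 + 1) → c ≤ Pr (btOp x0 x1 y0 y1) ∧ c ≤ Pr (btCl x0 x1 y0 y1)) := by
  obtain ⟨c, hc, h⟩ := exists_lt_Pr_lrOp k
  have key : ∀ x0 x1 y0 y1 : ℤ, y0 ≤ y1 → x0 ≤ x1 → x1 - x0 ≤ k * (y1 - y0 + 1) →
      c ≤ Pr (lrOp x0 x1 y0 y1) := by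
    intro x0 x1 y0 y1 h1 h2 h3
    have h4 := h (x1 - x0) (y1 - y0) (by omega) (by omega) h3
    have h5 := Pr_lrOp_trl 0 (x1 - x0) 0 (y1 - y0) x0 y0
    simp only [zero_add, sub_add_cancel] at h5
    exact h4.trans h5
  refine ⟨c, hc, fun x0 x1 y0 y1 h1 h2 => ⟨fun h3 => ?_, fun h3 => ?_⟩⟩
  · rw [Pr_lrCl]
    exact ⟨key _ _ _ _ h1 h2 h3, key _ _ _ _ h1 h2 h3⟩
  · rw [Pr_btCl]
    have := (key _ _ _ _ h2 h1 h3).trans (Pr_lrOp_le_btOp _ _ _ _)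
    exact ⟨this, this⟩

/-- Two paths in a rectangle whose end points interlace on the boundary intersect. -/
lemma cross4 {x0 x1 y0 y1 : ℤ} {S T : Set Site} {s e t f : Site} (hS : Con S s e) (hT : Con T t f)
    (hSR : S ⊆ rect x0 x1 y0 y1) (hTR : T ⊆ rect x0 x1 y0 y1) (hs : s.2 = y0)
    (ht : t.2 = y0 ∨ t.1 = x1) (he : e.2 = y0 ∨ e.1 = x1)
    (hst : s.1 + s.2 ≤ t.1 + t.2) (hte : t.1 + t.2 ≤ e.1 + e.2)
    (hf : f.2 = y1 ∨ f.1 = x0 ∨ ((f.2 = y0 ∨ f.1 = x1) ∧ e.1 + e.2 ≤ f.1 + f.2)) :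
    (S ∩ T).Nonempty := by
  by_contra hd
  have hd' : ∀ v ∈ S, v ∉ T := fun v h1 h2 => hd ⟨v, h1, h2⟩
  have hSb : ∀ v ∈ S, x0 ≤ v.1 ∧ v.1 ≤ x1 ∧ y0 ≤ v.2 ∧ v.2 ≤ y1 := fun v hv => hSR hv
  have hTb : ∀ v ∈ T, x0 ≤ v.1 ∧ v.1 ≤ x1 ∧ y0 ≤ v.2 ∧ v.2 ≤ y1 := fun v hv => hTR hv
  have hsb := hSb s hS.left_mem
  have heb := hSb e hS.right_mem
  have htb := hTb t hT.left_mem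
  have hfb := hTb f hT.right_mem
  have hst' : ¬ (s.1 = t.1 ∧ s.2 = t.2) := fun h => by
    have h' : s = t := Prod.ext h.1 h.2
    exact hd' s hS.left_mem (h' ▸ hT.left_mem)
  have het' : ¬ (e.1 = t.1 ∧ e.2 = t.2) := fun h => by
    have h' : e = t := Prod.ext h.1 h.2
    exact hd' e hS.right_mem (h' ▸ hT.left_mem)
  have hef' : ¬ (e.1 = f.1 ∧ e.2 = f.2) := fun h => by
    have h' : e = f := Prod.ext h.1 h.2
    exact hd' e hS.right_mem (h' ▸ hT.right_mem)
  -- left extension of `S`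
  have hL : Con (S ∪ {v | v.2 = y0 - 1 ∧ v.1 ≤ s.1 ∧ x0 - 1 ≤ v.1}) (x0 - 1, y0 - 1) s := by
    have h1 : Con {v : Site | v.2 = y0 - 1 ∧ v.1 ≤ s.1 ∧ x0 - 1 ≤ v.1} (x0 - 1, y0 - 1) (s.1, y0 - 1) :=
      con_horiz (by omega) fun t h1 h2 => ⟨rfl, h2, h1⟩
    exact (h1.mono subset_union_right).step (Or.inl hS.left_mem) (by rw [adj_iff]; simp; omega)
  -- right extension of `S`
  obtain ⟨Q, q, hq, hQ, hQp⟩ : ∃ (Q : Set Site) (q : Site), q.1 = x1 + 1 ∧ Con (S ∪ Q) e q ∧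
      ∀ v ∈ Q, (e.1 = x1 ∧ v.1 = x1 + 1 ∧ v.2 = e.2) ∨
        (e.2 = y0 ∧ ((v.1 = e.1 ∧ v.2 = y0 - 1) ∨ (v.2 = y0 - 2 ∧ e.1 ≤ v.1))) := by
    rcases he with he | he
    · refine ⟨{v | (v.1 = e.1 ∧ v.2 = y0 - 1) ∨ (v.2 = y0 - 2 ∧ e.1 ≤ v.1)}, (x1 + 1, y0 - 2), rfl,
        ?_, fun v hv => Or.inr ⟨he, hv⟩⟩
      have h1 : Con {v : Site | (v.1 = e.1 ∧ v.2 = y0 - 1) ∨ (v.2 = y0 - 2 ∧ e.1 ≤ v.1)}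
          (e.1, y0 - 2) (x1 + 1, y0 - 2) := con_horiz (by omega) fun t h1 h2 => Or.inr ⟨rfl, h1⟩
      have h2 : Con (S ∪ {v : Site | (v.1 = e.1 ∧ v.2 = y0 - 1) ∨ (v.2 = y0 - 2 ∧ e.1 ≤ v.1)})
          e (e.1, y0 - 1) := Con.single (Or.inl hS.right_mem) (Or.inr (Or.inl ⟨rfl, rfl⟩))
            (by rw [adj_iff]; simp; omega)
      exact (h2.step (Or.inr h1.left_mem) (by rw [adj_iff]; simp; omega)).trans
        (h1.mono subset_union_right)
    · refine ⟨{v | v.1 = x1 + 1 ∧ v.2 = e.2}, (x1 + 1, e.2), rfl, ?_,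
        fun v hv => Or.inl ⟨he, hv.1, hv.2⟩⟩
      exact Con.single (Or.inl hS.right_mem) (Or.inr ⟨rfl, rfl⟩) (by rw [adj_iff]; simp; omega)
  -- lower extension of `T`
  obtain ⟨D, g, hg, hD, hDp⟩ : ∃ (D : Set Site) (g : Site), g.2 = y0 - 2 ∧ Con (T ∪ D) g t ∧
      ∀ v ∈ D, (t.1 = x1 ∧ v.1 = x1 + 1 ∧ v.2 ≤ t.2 ∧ y0 - 2 ≤ v.2 ∧ (t.2 = y0 → v.2 = y0)) ∨
        (t.2 = y0 ∧ v.1 = t.1 ∧ y0 - 2 ≤ v.2 ∧ v.2 ≤ y0 - 1) := by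
    by_cases ht2 : t.2 = y0
    · refine ⟨{v | v.1 = t.1 ∧ y0 - 2 ≤ v.2 ∧ v.2 ≤ y0 - 1}, (t.1, y0 - 2), rfl, ?_,
        fun v hv => Or.inr ⟨ht2, hv⟩⟩
      have h1 : Con {v : Site | v.1 = t.1 ∧ y0 - 2 ≤ v.2 ∧ v.2 ≤ y0 - 1} (t.1, y0 - 2) (t.1, y0 - 1) :=
        con_vert (by omega) fun x h1 h2 => ⟨rfl, h1, h2⟩
      exact (h1.mono subset_union_right).step (Or.inl hT.left_mem) (by rw [adj_iff]; simp; omega)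
    · have ht1 : t.1 = x1 := ht.resolve_left ht2
      refine ⟨{v | v.1 = x1 + 1 ∧ v.2 ≤ t.2 ∧ y0 - 2 ≤ v.2}, (x1 + 1, y0 - 2), rfl, ?_,
        fun v hv => Or.inl ⟨ht1, hv.1, hv.2.1, hv.2.2, fun h => absurd h ht2⟩⟩
      have h1 : Con {v : Site | v.1 = x1 + 1 ∧ v.2 ≤ t.2 ∧ y0 - 2 ≤ v.2} (x1 + 1, y0 - 2) (x1 + 1, t.2) :=
        con_vert (by omega) fun x h1 h2 => ⟨rfl, h2, h1⟩
      exact (h1.mono subset_union_right).step (Or.inl hT.left_mem) (by rw [adj_iff]; simp; omega)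
  -- upper extension of `T`
  obtain ⟨E, h, hh, hE, hEp⟩ : ∃ (E : Set Site) (h : Site), h.2 = y1 + 1 ∧ Con (T ∪ E) f h ∧
      ∀ v ∈ E, (v.2 = y1 + 1 ∧ x0 ≤ v.1 ∧ v.1 ≤ x1) ∨ (v.1 = x0 - 1 ∧ y0 ≤ v.2 ∧ v.2 ≤ y1 + 1) ∨
        (f.1 = x1 ∧ v.1 = x1 + 1 ∧ f.2 ≤ v.2 ∧ v.2 ≤ y1 + 1 ∧ e.1 + e.2 ≤ f.1 + f.2) ∨
        (f.2 = y0 ∧ f.1 ≤ v.1 ∧ v.1 ≤ x1 + 1 ∧ (v.2 = y0 - 1 ∨ (v.1 = x1 + 1 ∧ y0 - 1 ≤ v.2)) ∧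
          v.2 ≤ y1 + 1 ∧ e.1 + e.2 ≤ f.1 + f.2) := by
    rcases hf with hf | hf | ⟨hf | hf, hef⟩
    · refine ⟨{v | v.2 = y1 + 1 ∧ v.1 = f.1}, (f.1, y1 + 1), rfl, ?_,
        fun v hv => Or.inl ⟨hv.1, by have := hv.2; omega, by have := hv.2; omega⟩⟩
      exact Con.single (Or.inl hT.right_mem) (Or.inr ⟨rfl, rfl⟩) (by rw [adj_iff]; simp; omega)
    · refine ⟨{v | v.1 = x0 - 1 ∧ f.2 ≤ v.2 ∧ v.2 ≤ y1 + 1}, (x0 - 1, y1 + 1), rfl, ?_,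
        fun v hv => Or.inr (Or.inl ⟨hv.1, by have := hv.2.1; omega, hv.2.2⟩)⟩
      have h1 : Con {v : Site | v.1 = x0 - 1 ∧ f.2 ≤ v.2 ∧ v.2 ≤ y1 + 1} (x0 - 1, f.2) (x0 - 1, y1 + 1) :=
        con_vert (by omega) fun x h1 h2 => ⟨rfl, h1, h2⟩
      exact (Con.single (Or.inl hT.right_mem) (Or.inr h1.left_mem) (by rw [adj_iff]; simp; omega)).trans
        (h1.mono subset_union_right)
    · set E : Set Site := {v | f.1 ≤ v.1 ∧ v.1 ≤ x1 + 1 ∧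
        (v.2 = y0 - 1 ∨ (v.1 = x1 + 1 ∧ y0 - 1 ≤ v.2)) ∧ v.2 ≤ y1 + 1}
      refine ⟨E, (x1 + 1, y1 + 1), rfl, ?_, fun v hv =>
        Or.inr (Or.inr (Or.inr ⟨hf, hv.1, hv.2.1, hv.2.2.1, hv.2.2.2, hef⟩))⟩
      have h1 : Con E (f.1, y0 - 1) (x1 + 1, y0 - 1) :=
        con_horiz (by omega) fun x h1 h2 => ⟨h1, h2, Or.inl rfl, by simp only; omega⟩
      have h2 : Con E (x1 + 1, y0 - 1) (x1 + 1, y1 + 1) :=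
        con_vert (by omega) fun x h1 h2 => ⟨by simp only; omega, le_rfl, Or.inr ⟨rfl, h1⟩, h2⟩
      exact (Con.single (Or.inl hT.right_mem) (Or.inr h1.left_mem) (by rw [adj_iff]; simp; omega)).trans
        ((h1.trans h2).mono subset_union_right)
    · refine ⟨{v | v.1 = x1 + 1 ∧ f.2 ≤ v.2 ∧ v.2 ≤ y1 + 1}, (x1 + 1, y1 + 1), rfl, ?_,
        fun v hv => Or.inr (Or.inr (Or.inl ⟨hf, hv.1, hv.2.1, hv.2.2, hef⟩))⟩
      have h1 : Con {v : Site | v.1 = x1 + 1 ∧ f.2 ≤ v.2 ∧ v.2 ≤ y1 + 1} (x1 + 1, f.2) (x1 + 1, y1 + 1) :=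
        con_vert (by omega) fun x h1 h2 => ⟨rfl, h1, h2⟩
      exact (Con.single (Or.inl hT.right_mem) (Or.inr h1.left_mem) (by rw [adj_iff]; simp; omega)).trans
        (h1.mono subset_union_right)
  set L : Set Site := {v | v.2 = y0 - 1 ∧ v.1 ≤ s.1 ∧ x0 - 1 ≤ v.1} with hLd
  have hA : Con (S ∪ (L ∪ Q)) (x0 - 1, y0 - 1) q :=
    (hL.mono (by rw [← union_assoc]; exact subset_union_left)).trans
      ((hS.mono subset_union_left).trans (hQ.mono (union_subset_union_right S subset_union_right)))
  have hB : Con (T ∪ (D ∪ E)) g h :=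
    (hD.mono (by rw [← union_assoc]; exact subset_union_left)).trans
      ((hT.mono subset_union_left).trans (hE.mono (union_subset_union_right T subset_union_right)))
  have hLp : ∀ v ∈ L, v.2 = y0 - 1 ∧ v.1 ≤ s.1 ∧ x0 - 1 ≤ v.1 := fun v hv => hv
  clear_value L
  clear hL hQ hD hE hS hT hd hSR hTR
  obtain ⟨v, hv1, hv2⟩ := crossings_meet (x0 := x0 - 1) (x1 := x1 + 1) (y0 := y0 - 2) (y1 := y1 + 1)
    hA hB (by
      rintro v (h | h | h)
      · have := hSb v h; clear * - this; omega
      · have := hLp v h; omega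
      · have := hQp v h; omega) (by
      rintro v (h | h | h)
      · have := hTb v h; clear * - this; omega
      · have := hDp v h; omega
      · have := hEp v h; omega) le_rfl hq.ge hg.le hh.ge
  rcases hv1 with h1 | h1 | h1 <;> rcases hv2 with h2 | h2 | h2
  · exact hd' v h1 h2
  · have a1 := hSb v h1; have a2 := hDp v h2; omega
  · have a1 := hSb v h1; have a2 := hEp v h2; omega
  · have a1 := hLp v h1; have a2 := hTb v h2; omega
  · have a1 := hLp v h1; have a2 := hDp v h2; omega
  · have a1 := hLp v h1; have a2 := hEp v h2; omega
  · have a1 := hQp v h1; have a2 := hTb v h2; omega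
  · have a1 := hQp v h1; have a2 := hDp v h2; omega
  · have a1 := hQp v h1; have a2 := hEp v h2; omega

/-- Sup-distance in the upper half plane, measured from the boundary point `z`. -/
def nm (z v : Site) : ℤ := max (max (v.1 - z.1) (z.1 - v.1)) (v.2 - z.2)

lemma nm_step (z : Site) {a b : Site} (h : Adj a b) : nm z b ≤ nm z a + 1 ∧ nm z a ≤ nm z b + 1 := by
  have := adj_bound h
  simp only [nm]; omega

/-- Half annulus around `z`, cut at the vertical line at distance `y` to the right of `z`. -/
def Om (z : Site) (y m d : ℤ) : Set Site :=
  {v | z.2 ≤ v.2 ∧ v.1 ≤ z.1 + y ∧ m < nm z v ∧ nm z v ≤ d}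

/-- Half box around `z`, cut at the vertical line at distance `y` to the right of `z`. -/
def Lam (z : Site) (y r : ℤ) : Set Site := {v | z.2 ≤ v.2 ∧ v.1 ≤ z.1 + y ∧ nm z v ≤ r}

/-- Bottom boundary left of `z`. -/
def bl (z : Site) : Set Site := {v | v.2 = z.2 ∧ v.1 < z.1}

/-- Bottom boundary right of `z`. -/
def br (z : Site) : Set Site := {v | v.2 = z.2 ∧ z.1 < v.1}

/-- Neighbors of the half box. -/
def inn (z : Site) (y m : ℤ) : Set Site := {v | ∃ w ∈ Lam z y m, Adj w v}

/-- Sites at distance at least `d`. -/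
def far (z : Site) (d : ℤ) : Set Site := {v | d ≤ nm z v}

lemma mem_Om {z v : Site} {y m d : ℤ} :
    v ∈ Om z y m d ↔ z.2 ≤ v.2 ∧ v.1 ≤ z.1 + y ∧ m < nm z v ∧ nm z v ≤ d := Iff.rfl

lemma mem_Lam {z v : Site} {y r : ℤ} :
    v ∈ Lam z y r ↔ z.2 ≤ v.2 ∧ v.1 ≤ z.1 + y ∧ nm z v ≤ r := Iff.rfl

lemma Om_subset_rect (z : Site) (y m d : ℤ) :
    Om z y m d ⊆ rect (z.1 - d) (z.1 + d) z.2 (z.2 + d) := by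
  rintro v ⟨h1, h2, h3, h4⟩
  simp only [nm] at h4
  exact ⟨by omega, by omega, by omega, by omega⟩

lemma Lam_subset_rect (z : Site) (y d : ℤ) :
    Lam z y d ⊆ rect (z.1 - d) (z.1 + d) z.2 (z.2 + d) := by
  rintro v ⟨h1, h2, h4⟩
  simp only [nm] at h4
  exact ⟨by omega, by omega, by omega, by omega⟩

lemma Om_finite (z : Site) (y m d : ℤ) : (Om z y m d).Finite :=
  (rect_finite _ _ _ _).subset (Om_subset_rect z y m d)

lemma Lam_finite (z : Site) (y d : ℤ) : (Lam z y d).Finite :=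
  (rect_finite _ _ _ _).subset (Lam_subset_rect z y d)

lemma Om_subset_Lam (z : Site) (y m d : ℤ) : Om z y m d ⊆ Lam z y d :=
  fun _ h => ⟨h.1, h.2.1, h.2.2.2⟩

lemma Om_mono {z : Site} {y y' m m' d d' : ℤ} (hy : y ≤ y') (hm : m' ≤ m) (hd : d ≤ d') :
    Om z y m d ⊆ Om z y' m' d' :=
  fun _ h => ⟨h.1, h.2.1.trans (by omega), lt_of_le_of_lt hm h.2.2.1, h.2.2.2.trans hd⟩

lemma Lam_mono {z : Site} {y y' d d' : ℤ} (hy : y ≤ y') (hd : d ≤ d') :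
    Lam z y d ⊆ Lam z y' d' :=
  fun _ h => ⟨h.1, h.2.1.trans (by omega), h.2.2.trans hd⟩

lemma inn_mono {z : Site} {y y' m m' : ℤ} (hy : y ≤ y') (hm : m ≤ m') : inn z y m ⊆ inn z y' m' := by
  rintro v ⟨w, hw, h⟩
  exact ⟨w, Lam_mono hy hm hw, h⟩

lemma inn_nm {z v : Site} {y m : ℤ} (h : v ∈ inn z y m) : nm z v ≤ m + 1 := by
  obtain ⟨w, hw, h⟩ := h
  have := (nm_step z h).1
  have := hw.2.2
  omega

/-- The half box is connected. -/
lemma Lam_con {z v : Site} {y m : ℤ} (hy : 0 ≤ y) (hv : v ∈ Lam z y m) : Con (Lam z y m) z v := by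
  obtain ⟨h1, h2, h3⟩ := hv
  simp only [nm] at h3
  have a1 : Con (Lam z y m) (v.1, z.2) (v.1, v.2) := con_vert h1 fun t ht1 ht2 => by
    refine ⟨ht1, h2, ?_⟩
    simp only [nm]; omega
  refine Con.trans ?_ a1
  rcases le_total z.1 v.1 with h | h
  · exact con_horiz (x := z.1) (x' := v.1) (y := z.2) h fun t ht1 ht2 => by
      refine ⟨le_rfl, ?_, ?_⟩
      · simp only; omega
      · simp only [nm]; omega
  · refine Con.symm (con_horiz (x := v.1) (x' := z.1) (y := z.2) h fun t ht1 ht2 => ?_)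
    refine ⟨le_rfl, ?_, ?_⟩
    · simp only; omega
    · simp only [nm]; omega

/-- An arch over the half box meets every arm from the half box to the outside. -/
lemma arch_meet {z s e t f : Site} {y m d : ℤ} {S T : Set Site} (hy : 0 ≤ y) (hyd : y ≤ d)
    (hm : m ≤ d)
    (hS : Con S s e) (hSO : S ⊆ Om z y m d) (hs : s ∈ bl z)
    (he : e ∈ br z ∨ (e.1 = z.1 + y ∧ y < d)) (hT : Con T t f) (hTL : T ⊆ Lam z y d)
    (ht : t ∈ inn z y m) (hf : f ∈ far z d) : (S ∩ T).Nonempty := by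
  obtain ⟨w, hw, hwt⟩ := ht
  have hT' : Con (T ∪ Lam z y m) z f :=
    ((Lam_con hy hw).mono subset_union_right).trans
      ((Con.single (Or.inr hw) (Or.inl hT.left_mem) hwt).trans (hT.mono subset_union_left))
  have hR : Lam z y d ⊆ rect (z.1 - d) (z.1 + y) z.2 (z.2 + d) := by
    intro v hv
    have := Lam_subset_rect z y d hv
    exact ⟨this.1, hv.2.1, this.2.2⟩
  have hs2 := hSO hS.left_mem
  have he2 := hR (Om_subset_Lam _ _ _ _ (hSO hS.right_mem))
  have hf2 := hR (hTL hT.right_mem)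
  simp only [rect, Set.mem_ofPred_eq] at he2 hf2
  simp only [far, nm, Set.mem_ofPred_eq] at hf
  simp only [bl, Set.mem_ofPred_eq] at hs
  simp only [br, Set.mem_ofPred_eq] at he
  obtain ⟨v, h1, h2 | h2⟩ := cross4 hS hT' ((hSO.trans (Om_subset_Lam _ _ _ _)).trans hR)
    (union_subset (hTL.trans hR) ((Lam_mono le_rfl hm).trans hR)) hs.1
    (Or.inl rfl) (by omega) (by omega) (by omega) (by omega)
  · exact ⟨v, h1, h2⟩
  · have a1 := (hSO h1).2.2.1
    have a2 := h2.2.2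
    omega

/-- Gluing of two or three crossings to an arc. -/
lemma half_arc {O : Set Site} {z : Site} {r X : ℤ} (hX : -r - 1 ≤ X)
    (h1 : Link (rect (z.1 - 2 * r) (z.1 - r - 1) z.2 (z.2 + 2 * r) ∩ O) {v | v.2 ≤ z.2}
      {v | z.2 + 2 * r ≤ v.2})
    (h2 : Link (rect (z.1 - 2 * r) (z.1 + X) (z.2 + r + 1) (z.2 + 2 * r) ∩ O) {v | v.1 ≤ z.1 - 2 * r}
      {v | z.1 + X ≤ v.1}) :
    ∃ s e, s.2 = z.2 ∧ s.1 < z.1 - r ∧ z.1 + X = e.1 ∧ z.2 + r < e.2 ∧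
      Con ((rect (z.1 - 2 * r) (z.1 - r - 1) z.2 (z.2 + 2 * r) ∪
        rect (z.1 - 2 * r) (z.1 + X) (z.2 + r + 1) (z.2 + 2 * r)) ∩ O) s e := by
  obtain ⟨s, u, hs, hu, hsu⟩ := h1
  obtain ⟨a, e, ha, he, hae⟩ := h2
  have hs' := hsu.left_mem.1
  have he' := hae.right_mem.1
  simp only [rect, Set.mem_ofPred_eq] at hs he hs' he' ha hu
  obtain ⟨v, hv1, hv2⟩ := crossings_meet (x0 := z.1 - 2 * r) (x1 := z.1 - r - 1)
    (y0 := z.2 + r + 1) (y1 := z.2 + 2 * r) hae.comp hsu.comp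
    (fun v hv => (Con.right_mem hv).1.2.2) (fun v hv => ⟨(Con.right_mem hv).1.1, (Con.right_mem hv).1.2.1⟩)
    ha (by omega) (by omega) hu
  refine ⟨s, e, by omega, by omega, by omega, by omega, ?_⟩
  have k1 : Con _ s v := hv2
  have k2 : Con _ v e := (Con.symm hv1).trans hae
  exact (k1.mono (inter_subset_inter_left _ subset_union_left)).trans
    (k2.mono (inter_subset_inter_left _ subset_union_right))

lemma full_arc {O : Set Site} {z : Site} {r : ℤ} (hr : 1 ≤ r)
    (h1 : Link (rect (z.1 - 2 * r) (z.1 - r - 1) z.2 (z.2 + 2 * r) ∩ O) {v | v.2 ≤ z.2}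
      {v | z.2 + 2 * r ≤ v.2})
    (h2 : Link (rect (z.1 - 2 * r) (z.1 + 2 * r) (z.2 + r + 1) (z.2 + 2 * r) ∩ O)
      {v | v.1 ≤ z.1 - 2 * r} {v | z.1 + 2 * r ≤ v.1})
    (h3 : Link (rect (z.1 + r + 1) (z.1 + 2 * r) z.2 (z.2 + 2 * r) ∩ O) {v | v.2 ≤ z.2}
      {v | z.2 + 2 * r ≤ v.2}) :
    Link (Om z (2 * r) r (2 * r) ∩ O) (bl z) (br z) := by
  obtain ⟨s, u, hs, hu, hsu⟩ := h1
  obtain ⟨a, e, ha, he, hae⟩ := h2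
  obtain ⟨b, g, hb, hg, hbg⟩ := h3
  have hs' := hsu.left_mem.1
  have hb' := hbg.left_mem.1
  simp only [rect, Set.mem_ofPred_eq] at hs he hs' hb' ha hu hb hg
  obtain ⟨v, hv1, hv2⟩ := crossings_meet (x0 := z.1 - 2 * r) (x1 := z.1 - r - 1)
    (y0 := z.2 + r + 1) (y1 := z.2 + 2 * r) hae.comp hsu.comp
    (fun v hv => (Con.right_mem hv).1.2.2) (fun v hv => ⟨(Con.right_mem hv).1.1, (Con.right_mem hv).1.2.1⟩)
    ha (by omega) (by omega) hu
  obtain ⟨w, hw1, hw2⟩ := crossings_meet (x0 := z.1 + r + 1) (x1 := z.1 + 2 * r)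
    (y0 := z.2 + r + 1) (y1 := z.2 + 2 * r) hae.comp hbg.comp
    (fun v hv => (Con.right_mem hv).1.2.2) (fun v hv => ⟨(Con.right_mem hv).1.1, (Con.right_mem hv).1.2.1⟩)
    (by omega) he (by omega) hg
  have k1 : Con _ s v := hv2
  have k2 : Con _ a v := hv1
  have k3 : Con _ a w := hw1
  have k4 : Con _ b w := hw2
  refine ⟨s, b, ⟨by omega, by omega⟩, ⟨by omega, by omega⟩, ?_⟩
  refine (k1.mono ?_).trans (((k2.symm.trans k3).mono ?_).trans (k4.symm.mono ?_))
  all_goals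
    refine inter_subset_inter_left _ ?_
    rintro x ⟨x1, x2, x3, x4⟩
    refine ⟨by omega, by omega, ?_, ?_⟩ <;> simp only [nm] <;> omega

/-- Closed or open arcs exist with probability bounded below. -/
theorem arcs : ∃ c : ℝ, 0 < c ∧ c ≤ 1 ∧ ∀ (z : Site) (r : ℤ), 1 ≤ r →
    c ≤ Pr {ω | Link (Om z (2 * r) r (2 * r) ∩ cl ω) (bl z) (br z)} ∧
    c ≤ Pr {ω | Link (Om z (2 * r) r (2 * r) ∩ op ω) (bl z) (br z)} := by
  obtain ⟨c, hc, h⟩ := rsw 4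
  have hkey : ∀ (z : Site) (r : ℤ), 1 ≤ r →
      c * c * c ≤ Pr {ω | Link (Om z (2 * r) r (2 * r) ∩ op ω) (bl z) (br z)} := by
    intro z r hr
    have p1 := ((h (z.1 - 2 * r) (z.1 - r - 1) z.2 (z.2 + 2 * r) (by omega) (by omega)).2
      (by push_cast; omega)).1
    have p2 := ((h (z.1 - 2 * r) (z.1 + 2 * r) (z.2 + r + 1) (z.2 + 2 * r) (by omega) (by omega)).1
      (by push_cast; omega)).1
    have p3 := ((h (z.1 + r + 1) (z.1 + 2 * r) z.2 (z.2 + 2 * r) (by omega) (by omega)).2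
      (by push_cast; omega)).1
    set R := rect (z.1 - 2 * r) (z.1 + 2 * r) z.2 (z.2 + 2 * r) with hR
    have hRf : R.Finite := rect_finite _ _ _ _
    have d1 : Dep R (btOp (z.1 - 2 * r) (z.1 - r - 1) z.2 (z.2 + 2 * r)) :=
      (dep_link_op _ _ _).mono fun v hv => ⟨hv.1, hv.2.1.trans (by omega), hv.2.2⟩
    have d2 : Dep R (lrOp (z.1 - 2 * r) (z.1 + 2 * r) (z.2 + r + 1) (z.2 + 2 * r)) :=
      (dep_link_op _ _ _).mono fun v hv =>
        ⟨hv.1, hv.2.1, (by omega : z.2 ≤ z.2 + r + 1).trans hv.2.2.1, hv.2.2.2⟩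
    have d3 : Dep R (btOp (z.1 + r + 1) (z.1 + 2 * r) z.2 (z.2 + 2 * r)) :=
      (dep_link_op _ _ _).mono fun v hv => ⟨(by omega : z.1 - 2 * r ≤ z.1 + r + 1).trans hv.1, hv.2⟩
    have i1 : Inc (btOp (z.1 - 2 * r) (z.1 - r - 1) z.2 (z.2 + 2 * r)) := inc_link _ _ _
    have i2 : Inc (lrOp (z.1 - 2 * r) (z.1 + 2 * r) (z.2 + r + 1) (z.2 + 2 * r)) := inc_link _ _ _
    have i3 : Inc (btOp (z.1 + r + 1) (z.1 + 2 * r) z.2 (z.2 + 2 * r)) := inc_link _ _ _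
    have q1 := harris hRf (i1.incOn univ) (i2.incOn univ) d1 (by rwa [inter_univ])
    have q2 := harris hRf ((i1.incOn univ).inter (i2.incOn univ)) (i3.incOn univ) (d1.inter d2)
      (by rwa [inter_univ])
    refine le_trans ?_ (q2.trans (Pr_mono ?_))
    · refine mul_le_mul (le_trans ?_ q1) p3 hc.le (Pr_nonneg _)
      exact mul_le_mul p1 p2 hc.le (Pr_nonneg _)
    · rintro ω ⟨⟨h1, h2⟩, h3⟩
      exact full_arc hr h1 h2 h3
  refine ⟨c * c * c, by positivity, (hkey (0, 0) 1 le_rfl).trans (Pr_le_one _), fun z r hr =>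
    ⟨?_, hkey z r hr⟩⟩
  refine (hkey z r hr).trans_eq ?_
  rw [← Pr_flip]
  congr 1; ext ω
  simp only [mem_preimage, Set.mem_ofPred_eq, op_flip]

/-- Closed sites of `Ω` that are not joined to `src` inside `Ω`. -/
def free (Ω src : Set Site) (ω : Config) : Set Site := (Ω ∩ cl ω) \ clus Ω src ω

lemma free_eq (Ω src : Set Site) (ω : Config) :
    free Ω src ω = (Ω \ Zb Ω src (clus Ω src ω)) ∩ cl ω := by
  ext v
  constructor
  · rintro ⟨⟨h1, h2⟩, h3⟩
    exact ⟨⟨h1, fun h => h3 (Zb_closed h h2)⟩, h2⟩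
  · rintro ⟨⟨h1, h2⟩, h3⟩
    exact ⟨⟨h1, h3⟩, fun h => h2 (Or.inl h)⟩

lemma free_con {Ω src : Set Site} {ω : Config} {u v : Site} (hu : u ∈ free Ω src ω)
    (h : Con (Ω ∩ cl ω) u v) : Con (free Ω src ω) u v := by
  refine h.rec_on (P := fun x => Con (free Ω src ω) u x) (Con.refl hu) fun a b ha hb hab ih => ?_
  refine ih.step ⟨hb, fun hk => ih.right_mem.2 ?_⟩ hab
  exact clus_step hk ih.right_mem.1.1 ih.right_mem.1.2 (adj_symm hab)

lemma free_mono {Ω Ω' src src' : Set Site} {ω : Config} (h : Ω' ⊆ Ω) (hs : src' ⊆ src) :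
    free Ω src ω ∩ Ω' ⊆ free Ω' src' ω := by
  rintro v ⟨⟨⟨h1, h2⟩, h3⟩, h4⟩
  refine ⟨⟨h4, h2⟩, ?_⟩
  rintro ⟨s, hs', hc⟩
  exact h3 ⟨s, hs hs', hc.mono (inter_subset_inter_left _ h)⟩

/-- There is a closed path in `Ω` from `X` to `Y` which is not joined to `src` inside `Ω`. -/
def FreeArm (Ω src X Y : Set Site) : Set Config := {ω | Link (free Ω src ω) X Y}

lemma clus_congr {Ω src : Set Site} {ω ω' : Config} (h : ∀ v ∈ Ω, ω v = ω' v) :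
    clus Ω src ω = clus Ω src ω' := by
  simp only [clus, inter_cl_congr h]

lemma freeArm_dep (Ω src X Y : Set Site) : Dep Ω (FreeArm Ω src X Y) := fun ω ω' h => by
  simp only [FreeArm, free, Set.mem_ofPred_eq, clus_congr h, inter_cl_congr h]

/-- Closed arm in a cut half annulus not joined to the bottom boundary on the left. -/
def ArmA (z : Site) (y m d : ℤ) : Set Config :=
  FreeArm (Om z y m d) (bl z) (inn z y m) (far z d)

lemma arm_restrict {z u v : Site} {y m m' d d' : ℤ} {O : Set Site} (h : Con O u v)
    (hO : O ⊆ Om z y m d) (hu : u ∈ inn z y m) (hv : v ∈ far z d) (hm : m ≤ m') (hd : d' ≤ d)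
    (hmd : m' < d') : Link (O ∩ Om z y m' d') (inn z y m') (far z d') := by
  have hv' : d ≤ nm z v := hv
  have key : Link (O ∩ {x | m' < nm z x}) (inn z y m') {v} := by
    by_cases hmm : m = m'
    · subst hmm
      exact ⟨u, v, hu, rfl, h.mono fun x hx => ⟨hx, (hO hx).2.2.1⟩⟩
    · have := inn_nm hu
      obtain ⟨w, w', h1, h2, h3, h4⟩ := h.leave (H := {x | nm z x ≤ m'})
        (by simp only [Set.mem_ofPred_eq]; omega) (by simp only [Set.mem_ofPred_eq]; omega)
      refine ⟨w', v, ⟨w, ⟨(hO h1).1, (hO h1).2.1, h2⟩, h3⟩, rfl, h4.mono ?_⟩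
      rintro x ⟨hx1, hx2⟩
      exact ⟨hx1, by simpa using hx2⟩
  obtain ⟨a, b, ha, rfl, hab⟩ := key
  have := inn_nm ha
  obtain ⟨w, hw, h5⟩ := hab.hit (nm z) (fun a b hab => (nm_step z hab).1) (c := d') (by omega)
    (by omega)
  refine ⟨a, w, ha, hw.ge, h5.mono ?_⟩
  rintro x ⟨⟨hx1, hx2⟩, hx3⟩
  exact ⟨hx1, (hO hx1).1, (hO hx1).2.1, hx2, hx3⟩

lemma ArmA_mono {z : Site} {y m m' d d' : ℤ} (hm : m ≤ m') (hd : d' ≤ d) (hmd : m' < d') :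
    ArmA z y m d ⊆ ArmA z y m' d' := by
  rintro ω ⟨u, v, hu, hv, h⟩
  have := arm_restrict h (fun x hx => hx.1.1) hu hv hm hd hmd
  exact this.of_subset (free_mono (Om_mono le_rfl hm hd) subset_rfl)

/-- Segment of the bottom boundary to the right of `z`. -/
def Rs (z : Site) (m : ℤ) : Set Site := {v | v.2 = z.2 ∧ z.1 + 2 * m < v.1 ∧ v.1 ≤ z.1 + 4 * m}

/-- The cluster joins the right segment to the outside, but not to the left. -/
def RightArm (z : Site) (m d : ℤ) (k : Set Site) : Prop :=
  (∃ b ∈ Rs z m, ∃ f ∈ far z d, Con k b f) ∧ ∀ s ∈ bl z, s ∉ k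

lemma ring_subset {z : Site} {m d : ℤ} (hm : 0 ≤ m) (hd : 4 * m ≤ d) :
    Om z (2 * (2 * m)) (2 * m) (2 * (2 * m)) ⊆ Om z d m d :=
  Om_mono (by omega) (by omega) (by omega)

lemma ring_br {z v : Site} {m : ℤ} (hm : 0 ≤ m)
    (hv : v ∈ Om z (2 * (2 * m)) (2 * m) (2 * (2 * m))) (hb : v ∈ br z) : v ∈ Rs z m := by
  simp only [mem_Om, nm] at hv
  obtain ⟨h1, h2⟩ := hb
  exact ⟨h1, by omega, by omega⟩

lemma dep_link_union (R Z X Y : Set Site) : Dep (R \ Z) {ω | Link (R ∩ (Z ∪ cl ω)) X Y} :=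
  fun ω ω' h => by
    have : R ∩ (Z ∪ cl ω) = R ∩ (Z ∪ cl ω') := by
      ext v
      simp only [mem_inter_iff, mem_union, mem_cl]
      by_cases hv : v ∈ R
      · by_cases hz : v ∈ Z
        · simp [hz]
        · rw [h v ⟨hv, hz⟩]
      · simp [hv]
    simp only [Set.mem_ofPred_eq, this]

lemma dep_link_union_op (R Z X Y : Set Site) : Dep (R \ Z) {ω | Link (R ∩ (Z ∪ op ω)) X Y} :=
  fun ω ω' h => by
    have : R ∩ (Z ∪ op ω) = R ∩ (Z ∪ op ω') := by
      ext v
      simp only [mem_inter_iff, mem_union, mem_op]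
      by_cases hv : v ∈ R
      · by_cases hz : v ∈ Z
        · simp [hz]
        · rw [h v ⟨hv, hz⟩]
      · simp [hv]
    simp only [Set.mem_ofPred_eq, this]

lemma dec_link_union (R Z X Y : Set Site) : Dec {ω | Link (R ∩ (Z ∪ cl ω)) X Y} :=
  fun ω ω' h hl => hl.of_subset fun v hv => ⟨hv.1, hv.2.imp_right fun hc => h v hc⟩

/-- Last part, outside the revealed region, of an arch starting from the source. -/
lemma arch_split {R Ω src : Set Site} {ω : Config} {a b : Site} (hR : R ⊆ Ω)
    (h : Con (R ∩ (Zb Ω src (clus Ω src ω) ∪ cl ω)) a b) (ha : a ∈ src) :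
    (∃ s ∈ src, Con (clus Ω src ω ∪ {b}) s b ∧ b ∈ Zb Ω src (clus Ω src ω)) ∨
    ∃ s ∈ src, ∃ w w', w ∈ R ∧ w ∈ Zb Ω src (clus Ω src ω) ∧ Con (clus Ω src ω ∪ {w}) s w ∧
      Adj w w' ∧ Con ((R \ Zb Ω src (clus Ω src ω)) ∩ cl ω) w' b := by
  have haZ : a ∈ Zb Ω src (clus Ω src ω) := Or.inr ⟨hR h.left_mem.1, Or.inl ha⟩
  by_cases hb : b ∈ Zb Ω src (clus Ω src ω)
  · obtain ⟨s, hs, h1⟩ := Zb_path hb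
    exact Or.inl ⟨s, hs, h1, hb⟩
  · obtain ⟨w, w', h1, h2, h3, h4⟩ := h.leave haZ hb
    obtain ⟨s, hs, h5⟩ := Zb_path h2
    refine Or.inr ⟨s, hs, w, w', h1.1, h2, h5, h3, h4.mono ?_⟩
    rintro x ⟨⟨hx1, hx2⟩, hx3⟩
    exact ⟨⟨hx1, hx3⟩, hx2.resolve_left hx3⟩

lemma rightArm_of_arc {z : Site} {m d : ℤ} {ω : Config} (hm : 1 ≤ m) (hd : 4 * m ≤ d)
    (h : ω ∈ ArmA z d m d)
    (harc : Link (Om z (2 * (2 * m)) (2 * m) (2 * (2 * m)) ∩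
      (Zb (Om z d m d) (bl z) (clus (Om z d m d) (bl z) ω) ∪ cl ω)) (bl z) (br z)) :
    RightArm z m d (clus (Om z d m d) (Rs z m) ω) := by
  set Ω := Om z d m d with hΩ
  set K := clus Ω (bl z) ω with hK
  obtain ⟨t, f, ht, hf, h⟩ := h
  have hKΩ : K ⊆ Ω := fun x hx => (clus_subset hx).1
  set T : Set Site := {x | Con (free Ω (bl z) ω) t x} with hT
  have hTT : Con T t f := h.comp
  have hTΩ : T ⊆ Lam z d d := fun x hx => Om_subset_Lam _ _ _ _ (Con.right_mem hx).1.1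
  have hTf : ∀ x ∈ T, x ∈ free Ω (bl z) ω := fun x hx => Con.right_mem hx
  have hTZ : ∀ x ∈ T, x ∉ Zb Ω (bl z) K := fun x hx => by
    have := hTf x hx
    rw [free_eq] at this
    exact this.1.2
  obtain ⟨a, b, ha, hb, hab⟩ := harc
  have hbR : b ∈ Rs z m := ring_br (by omega) hab.right_mem.1 hb
  have hrΩ := ring_subset (z := z) (by omega : 0 ≤ m) hd
  refine ⟨⟨b, hbR, f, hf, ?_⟩, ?_⟩
  · rcases arch_split hrΩ hab ha with ⟨s, hs, h1, h2⟩ | ⟨s, hs, w, w', hwR, hwZ, h1, hww, h2⟩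
    · exfalso
      obtain ⟨x, hx1, hx2⟩ := arch_meet (by omega) le_rfl (by omega) h1
        (union_subset hKΩ (singleton_subset_iff.2 (hrΩ hab.right_mem.1))) hs (Or.inl hb) hTT hTΩ ht hf
      rcases hx1 with hx1 | rfl
      · exact (hTf x hx2).2 hx1
      · exact hTZ x hx2 h2
    · set F : Set Site := {x | Con ((Om z (2 * (2 * m)) (2 * m) (2 * (2 * m)) \ Zb Ω (bl z) K) ∩ cl ω) w' x} with hF
      have hFF : Con F w' b := h2.comp
      have hFc : F ⊆ Ω ∩ cl ω := fun x hx => ⟨hrΩ (Con.right_mem hx).1.1, (Con.right_mem hx).2⟩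
      have hS : Con (K ∪ {w} ∪ F) s b := (h1.mono subset_union_left).trans
        ((Con.single (Or.inl (Or.inr rfl)) (Or.inr hFF.left_mem) hww).trans (hFF.mono subset_union_right))
      obtain ⟨x, hx1, hx2⟩ := arch_meet (by omega) le_rfl (by omega) hS
        (union_subset (union_subset hKΩ (singleton_subset_iff.2 (hrΩ hwR))) fun x hx => (hFc hx).1)
        hs (Or.inl hb) hTT hTΩ ht hf
      rcases hx1 with (hx1 | rfl) | hx1
      · exact absurd hx1 (hTf x hx2).2
      · exact absurd hwZ (hTZ x hx2)
      · have hx2' : Con (free Ω (bl z) ω) t x := hx2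
        have k1 : Con (Ω ∩ cl ω) x f := (hx2'.symm.trans h).mono fun y hy => hy.1
        have hx1' : Con ((Om z (2 * (2 * m)) (2 * m) (2 * (2 * m)) \ Zb Ω (bl z) K) ∩ cl ω) w' x := hx1
        have k2 : Con (Ω ∩ cl ω) b x := (h2.symm.trans hx1').mono fun y hy => ⟨hrΩ hy.1.1, hy.2⟩
        have k3 := k2.trans k1
        have hbc : b ∈ clus Ω (Rs z m) ω := clus_src k2.left_mem.1 hbR k2.left_mem.2
        exact k3.rec_on (P := fun y => Con (clus Ω (Rs z m) ω) b y) (Con.refl hbc)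
          fun u v _ hv huv ih => ih.step (clus_step ih.right_mem hv.1 hv.2 huv) huv
  · rintro s hs ⟨r, hr, hrs⟩
    obtain ⟨x, hx1, hx2⟩ := arch_meet (by omega) le_rfl (by omega) hrs.symm.comp
      (fun y hy => (Con.right_mem hy).1) hs
      (Or.inl ⟨hr.1, by have := hr.2.1; omega⟩) hTT hTΩ ht hf
    have hx1' : Con (Ω ∩ cl ω) s x := hx1
    exact (hTf x hx2).2 ⟨s, hs, hx1'⟩

lemma Pr_rightArm {c : ℝ} (hc : ∀ (z : Site) (r : ℤ), 1 ≤ r →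
    c ≤ Pr {ω | Link (Om z (2 * r) r (2 * r) ∩ cl ω) (bl z) (br z)}) {z : Site} {m d : ℤ}
    (hm : 1 ≤ m) (hd : 4 * m ≤ d) :
    c * Pr (ArmA z d m d) ≤ Pr {ω | RightArm z m d (clus (Om z d m d) (Rs z m) ω)} := by
  set Ω := Om z d m d with hΩ
  set R := Om z (2 * (2 * m)) (2 * m) (2 * (2 * m)) with hR
  have hRΩ : R ⊆ Ω := ring_subset (by omega) hd
  have hΩf : Ω.Finite := Om_finite _ _ _ _
  have key := explore_clus (c := c) (Ω := Ω) (S := Ω) (src := bl z) subset_rfl hΩf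
    (fun k => {ω | Link ((Ω \ Zb Ω (bl z) k) ∩ cl ω) (inn z d m) (far z d)})
    (fun k => {ω | Link ((Ω \ Zb Ω (bl z) k) ∩ cl ω) (inn z d m) (far z d)} ∩
      {ω | Link (R ∩ (Zb Ω (bl z) k ∪ cl ω)) (bl z) (br z)})
    (fun k _ => dep_link_cl _ _ _)
    (fun k _ => (dep_link_cl _ _ _).inter ((dep_link_union _ _ _ _).mono
      (sdiff_subset_sdiff_left hRΩ))) ?_
  · refine le_trans (le_of_eq ?_) (key.trans (Pr_mono ?_))
    · congr 2; ext ω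
      simp only [ArmA, FreeArm, Set.mem_ofPred_eq, free_eq, ← hΩ]
    · rintro ω ⟨h1, h2⟩
      refine rightArm_of_arc hm hd ?_ h2
      simp only [ArmA, FreeArm, Set.mem_ofPred_eq, free_eq]
      exact h1
  · intro k hk
    have h1 := harris_dec (X := univ) hΩf ((dec_link (Ω \ Zb Ω (bl z) k) (inn z d m) (far z d)).decOn _)
      ((dec_link_union R (Zb Ω (bl z) k) (bl z) (br z)).decOn _)
      ((dep_link_cl _ _ _).mono sdiff_subset)
      ((dep_link_union _ _ _ _).mono (by rw [inter_univ]; exact sdiff_subset.trans hRΩ))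
    refine le_trans ?_ h1
    rw [mul_comm]
    refine mul_le_mul_of_nonneg_left ((hc z (2 * m) (by omega)).trans (Pr_mono ?_)) (Pr_nonneg _)
    intro ω hω
    exact Link.of_subset (inter_subset_inter_right _ subset_union_right) hω

/-- A closed path from a bottom segment to the outside, not joined to the left part of the
bottom inside the half box. -/
def CellArm (z : Site) (m d : ℤ) : Set Config :=
  {ω | ∃ r ∈ Rs z m, ∃ f ∈ far z d, Con (Om z d m d ∩ cl ω) r f ∧
    ∀ l : Site, l.2 = z.2 → l.1 < z.1 - 4 * m → ¬ Con (Lam z d d ∩ cl ω) r l}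

lemma cellArm_of_arc {z : Site} {m d : ℤ} {ω : Config} (hm : 1 ≤ m) (hd : 4 * m ≤ d)
    (h : RightArm z m d (clus (Om z d m d) (Rs z m) ω))
    (harc : Link (Om z (2 * (2 * m)) (2 * m) (2 * (2 * m)) ∩
      (Zb (Om z d m d) (Rs z m) (clus (Om z d m d) (Rs z m) ω) ∪ op ω)) (bl z) (br z)) :
    ω ∈ CellArm z m d := by
  set Ω := Om z d m d with hΩ
  set U := clus Ω (Rs z m) ω with hU
  set Z := Zb Ω (Rs z m) U with hZ
  set R := Om z (2 * (2 * m)) (2 * m) (2 * (2 * m)) with hR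
  have hRΩ : R ⊆ Ω := ring_subset (by omega) hd
  have hUΩ : U ⊆ Ω := fun x hx => (clus_subset hx).1
  obtain ⟨⟨r, hr, f, hf, hrf⟩, hno⟩ := h
  refine ⟨r, hr, f, hf, hrf.mono clus_subset, ?_⟩
  intro l hl1 hl2 hrl
  have hrU := hrf.left_mem
  have hlm := hrl.right_mem
  by_cases hex : Con (Ω ∩ cl ω) r l
  · exact hno l ⟨hl1, by omega⟩ (clus_con hex hrU)
  -- the path enters the small half box
  have hnl : l ∉ {x | nm z x ≤ m} := by
    simp only [Set.mem_ofPred_eq, nm]; omega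
  have henter : ∃ w' w, Con ((Lam z d d ∩ cl ω) \ {x | nm z x ≤ m}) l w' ∧ Adj w' w ∧
      w ∈ Lam z d d ∩ cl ω ∧ w ∈ {x | nm z x ≤ m} := by
    by_contra hcon
    refine hex ((hrl.symm.rec_on (P := fun x => Con ((Lam z d d ∩ cl ω) \ {x | nm z x ≤ m}) l x)
      (Con.refl ⟨hlm, hnl⟩) ?_).symm.mono ?_)
    · intro a b _ hb hab ih
      refine ih.step ⟨hb, fun hbm => hcon ⟨a, b, ih, hab, hb, hbm⟩⟩ hab
    · rintro x ⟨⟨⟨h1, h2, h3⟩, h4⟩, h5⟩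
      exact ⟨⟨h1, h2, by simpa using h5, h3⟩, h4⟩
  obtain ⟨w', w, hlw, hww, hwL, hwm⟩ := henter
  have hwLam : w ∈ Lam z d m := ⟨hwL.1.1, hwL.1.2.1, hwm⟩
  have hlw' : Con (Ω ∩ cl ω) l w' := hlw.mono (by
    rintro x ⟨⟨⟨h1, h2, h3⟩, h4⟩, h5⟩
    exact ⟨⟨h1, h2, by simpa using h5, h3⟩, h4⟩)
  set Q : Set Site := {x | Con (Ω ∩ cl ω) l x} with hQ
  have hlU : l ∉ U := hno l ⟨hl1, by omega⟩
  have hQU : ∀ x ∈ Q, x ∉ U := fun x hx hxU => hlU (clus_con (Con.symm hx) hxU)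
  have hQcl : ∀ x ∈ Q, x ∈ Ω ∩ cl ω := fun x hx => Con.right_mem hx
  have hQZ : ∀ x ∈ Q, x ∉ Z := fun x hx hxZ => hQU x hx (Zb_closed hxZ (hQcl x hx).2)
  have hS : Con (Q ∪ Lam z d m) l z := (hlw'.comp.mono subset_union_left).trans
    ((Con.single (Or.inl hlw') (Or.inr hwLam) hww).trans
      ((Lam_con (by omega) hwLam).symm.mono subset_union_right))
  obtain ⟨a, b, ha, hb, hab⟩ := harc
  have hbR : b ∈ Rs z m := ring_br (by omega) hab.right_mem.1 hb
  have hbZ : b ∈ Z := Or.inr ⟨hRΩ hab.right_mem.1, Or.inl hbR⟩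
  -- the barrier
  have hbar : ∃ (B : Set Site) (g : Site), g ∈ Rs z m ∧ Con B a g ∧ B ⊆ Ω ∧
      ∀ x ∈ B, x ∈ Z ∨ ω x = true := by
    by_cases haZ : a ∈ Z
    · obtain ⟨s, hs, h1⟩ := Zb_path haZ
      refine ⟨U ∪ {a}, s, hs, h1.symm, union_subset hUΩ (singleton_subset_iff.2 (hRΩ hab.left_mem.1)), ?_⟩
      rintro x (hx | rfl)
      · exact Or.inl (Or.inl hx)
      · exact Or.inl haZ
    · obtain ⟨p, w, h1, h2, h3, h4⟩ := hab.enter haZ hbZ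
      obtain ⟨s, hs, h5⟩ := Zb_path h4
      refine ⟨(R ∩ (Z ∪ op ω)) \ Z ∪ (U ∪ {w}), s, hs, (h1.mono subset_union_left).trans
        ((Con.single (Or.inl h1.right_mem) (Or.inr h5.right_mem) h2).trans
          (h5.symm.mono subset_union_right)), ?_, ?_⟩
      · refine union_subset (fun x hx => hRΩ hx.1.1) (union_subset hUΩ (singleton_subset_iff.2 (hRΩ h3.1)))
      · rintro x (hx | hx | rfl)
        · exact Or.inr (hx.1.2.resolve_left hx.2)
        · exact Or.inl (Or.inl hx)
        · exact Or.inl h4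
  obtain ⟨B, g, hg, hB, hBΩ, hBp⟩ := hbar
  have ham := hab.left_mem.1
  simp only [hR, mem_Om, nm] at ham
  obtain ⟨ha1, ha2⟩ := ha
  obtain ⟨hg1, hg2, hg3⟩ := hg
  have hΩR : Ω ⊆ rect (z.1 - d) (z.1 + d) z.2 (z.2 + d) := Om_subset_rect _ _ _ _
  obtain ⟨x, hx1, hx2⟩ := cross4 hS hB
    (union_subset (fun x hx => hΩR (hQcl x hx).1) ((Lam_mono le_rfl (by omega)).trans (Lam_subset_rect _ _ _)))
    (hBΩ.trans hΩR) hl1 (Or.inl ha1) (Or.inl rfl) (by omega) (by omega)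
    (Or.inr (Or.inr ⟨Or.inl hg1, by omega⟩))
  rcases hx1 with hx1 | hx1
  · rcases hBp x hx2 with h1 | h1
    · exact hQZ x hx1 h1
    · have := (hQcl x hx1).2
      rw [mem_cl, h1] at this
      exact absurd this (by simp)
  · have a1 := (hBΩ hx2).2.2.1
    have a2 := hx1.2.2
    omega

lemma Pr_cellArm {c : ℝ} (hc : ∀ (z : Site) (r : ℤ), 1 ≤ r →
    c ≤ Pr {ω | Link (Om z (2 * r) r (2 * r) ∩ op ω) (bl z) (br z)}) {z : Site} {m d : ℤ}
    (hm : 1 ≤ m) (hd : 4 * m ≤ d) :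
    c * Pr {ω | RightArm z m d (clus (Om z d m d) (Rs z m) ω)} ≤ Pr (CellArm z m d) := by
  classical
  set Ω := Om z d m d with hΩ
  set R := Om z (2 * (2 * m)) (2 * m) (2 * (2 * m)) with hR
  have hRΩ : R ⊆ Ω := ring_subset (by omega) hd
  have hΩf : Ω.Finite := Om_finite _ _ _ _
  have key := explore_clus (c := c) (Ω := Ω) (S := Ω) (src := Rs z m) subset_rfl hΩf
    (fun k => {_ω | RightArm z m d k})
    (fun k => {_ω | RightArm z m d k} ∩
      {ω | Link (R ∩ (Zb Ω (Rs z m) k ∪ op ω)) (bl z) (br z)})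
    (fun k _ => dep_const _ _)
    (fun k _ => (dep_const _ _).inter ((dep_link_union_op _ _ _ _).mono
      (sdiff_subset_sdiff_left hRΩ))) ?_
  · refine key.trans (Pr_mono ?_)
    rintro ω ⟨h1, h2⟩
    exact cellArm_of_arc hm hd h1 h2
  · intro k hk
    by_cases h : RightArm z m d k
    · have e1 : {_ω : Config | RightArm z m d k} = univ := by ext; simp [h]
      rw [e1, univ_inter, Pr_univ, mul_one]
      refine (hc z (2 * m) (by omega)).trans (Pr_mono ?_)
      intro ω hω
      exact Link.of_subset (inter_subset_inter_right _ subset_union_right) hω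
    · have e1 : {_ω : Config | RightArm z m d k} = ∅ := by ext; simp [h]
      rw [e1, empty_inter, Pr_empty, mul_zero]

lemma trl_symm_adj (w : Site) {a b : Site} (h : Adj a b) : Adj ((trl w).symm a) ((trl w).symm b) := by
  have : (trl w).symm = trl (-w) := by ext v <;> simp [trl]
  rw [this]; exact trl_adj _ h

lemma con_preimage_trl (w : Site) {A : Set Site} {u v : Site} :
    Con (trl w ⁻¹' A) u v ↔ Con A (trl w u) (trl w v) := by
  constructor
  · intro h; exact h.map (fun _ _ => trl_adj w) fun x hx => hx
  · intro h
    have := h.map (f := (trl w).symm) (B := trl w ⁻¹' A) (fun _ _ => trl_symm_adj w) fun x hx => by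
      simpa using hx
    simpa using this

lemma link_preimage_trl (w : Site) {A X Y : Set Site} :
    Link (trl w ⁻¹' A) (trl w ⁻¹' X) (trl w ⁻¹' Y) ↔ Link A X Y := by
  constructor
  · rintro ⟨u, v, hu, hv, h⟩
    exact ⟨_, _, hu, hv, (con_preimage_trl w).1 h⟩
  · rintro ⟨u, v, hu, hv, h⟩
    refine ⟨(trl w).symm u, (trl w).symm v, by simpa using hu, by simpa using hv, ?_⟩
    rw [con_preimage_trl]; simpa using h

lemma free_preimage_trl (w : Site) (Ω src : Set Site) (ω : Config) :
    free (trl w ⁻¹' Ω) (trl w ⁻¹' src) (fun v => ω (trl w v)) = trl w ⁻¹' free Ω src ω := by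
  have h1 : trl w ⁻¹' Ω ∩ cl (fun v => ω (trl w v)) = trl w ⁻¹' (Ω ∩ cl ω) := rfl
  have h2 : clus (trl w ⁻¹' Ω) (trl w ⁻¹' src) (fun v => ω (trl w v)) = trl w ⁻¹' clus Ω src ω := by
    ext v
    simp only [clus, h1, Set.mem_ofPred_eq, mem_preimage]
    constructor
    · rintro ⟨s, hs, h⟩
      exact ⟨_, hs, (con_preimage_trl w).1 h⟩
    · rintro ⟨s, hs, h⟩
      refine ⟨(trl w).symm s, by simpa using hs, ?_⟩
      rw [con_preimage_trl]; simpa using h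
  rw [free, h1, h2]; rfl

lemma Pr_freeArm_trl (w : Site) (Ω src X Y : Set Site) :
    Pr (FreeArm (trl w ⁻¹' Ω) (trl w ⁻¹' src) (trl w ⁻¹' X) (trl w ⁻¹' Y)) =
      Pr (FreeArm Ω src X Y) := by
  rw [← Pr_reindex (trl w)]
  congr 1
  ext ω
  simp only [FreeArm, mem_preimage, Set.mem_ofPred_eq, free_preimage_trl, link_preimage_trl]

lemma nm_trl (w z v : Site) : nm (trl w z) (trl w v) = nm z v := by
  simp only [nm, trl_apply]; omega

lemma Om_trl (w z : Site) (y m d : ℤ) : trl w ⁻¹' Om (trl w z) y m d = Om z y m d := by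
  ext v
  simp only [mem_preimage, mem_Om, nm_trl]
  simp only [trl_apply]
  constructor <;> rintro ⟨h1, h2, h3⟩ <;> exact ⟨by omega, by omega, h3⟩

lemma Lam_trl (w z : Site) (y m : ℤ) : trl w ⁻¹' Lam (trl w z) y m = Lam z y m := by
  ext v
  simp only [mem_preimage, mem_Lam, nm_trl]
  simp only [trl_apply]
  constructor <;> rintro ⟨h1, h2, h3⟩ <;> exact ⟨by omega, by omega, h3⟩

lemma bl_trl (w z : Site) : trl w ⁻¹' bl (trl w z) = bl z := by
  ext v; simp only [mem_preimage, bl, trl_apply, Set.mem_ofPred_eq]; omega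

lemma far_trl (w z : Site) (d : ℤ) : trl w ⁻¹' far (trl w z) d = far z d := by
  ext v; simp only [mem_preimage, far, nm_trl, Set.mem_ofPred_eq]

lemma inn_trl (w z : Site) (y m : ℤ) : trl w ⁻¹' inn (trl w z) y m = inn z y m := by
  ext v
  constructor
  · rintro ⟨u, hu, h⟩
    refine ⟨(trl w).symm u, ?_, by simpa using trl_symm_adj w h⟩
    rw [← Lam_trl w]; simpa using hu
  · rintro ⟨u, hu, h⟩
    refine ⟨trl w u, ?_, trl_adj w h⟩
    rw [← Lam_trl w] at hu; exact hu

lemma trl_sub (z z' : Site) : trl (z' - z) z = z' := by simp [trl]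

lemma Pr_ArmA_trl (z z' : Site) (y m d : ℤ) : Pr (ArmA z y m d) = Pr (ArmA z' y m d) := by
  obtain ⟨w, rfl⟩ : ∃ w, trl w z = z' := ⟨_, trl_sub z z'⟩
  have := Pr_freeArm_trl w (Om (trl w z) y m d) (bl (trl w z)) (inn (trl w z) y m) (far (trl w z) d)
  rw [Om_trl, bl_trl, inn_trl, far_trl] at this
  exact this

lemma ArmA_cut {z : Site} {y y' m d : ℤ} (hm : m ≤ d) (hy : d ≤ y) (hy' : d ≤ y') :
    ArmA z y m d = ArmA z y' m d := by
  have h1 : Om z y m d = Om z y' m d := by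
    ext v
    simp only [mem_Om, nm]
    constructor <;> rintro ⟨h1, h2, h3⟩ <;> exact ⟨h1, by omega, h3⟩
  have h2 : Lam z y m = Lam z y' m := by
    ext v
    simp only [mem_Lam, nm]
    constructor <;> rintro ⟨h1, h2, h3⟩ <;> exact ⟨h1, by omega, h3⟩
  have h3 : inn z y m = inn z y' m := by simp only [inn, h2]
  simp only [ArmA, h1, h3]

/-- Closed crossing of the half annulus between `r` and `2 r`. -/
def CrossHA (z : Site) (r : ℤ) : Set Config :=
  {ω | Link (Lam z (2 * r) (2 * r) ∩ cl ω) {v | nm z v ≤ r} (far z (2 * r))}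

lemma crossHA_no_arc {z : Site} {r : ℤ} {ω : Config} (hr : 1 ≤ r) (h : ω ∈ CrossHA z r)
    (ha : Link (Om z (2 * r) r (2 * r) ∩ op ω) (bl z) (br z)) : False := by
  obtain ⟨u, v, hu, hv, h⟩ := h
  obtain ⟨s, e, hs, he, ha⟩ := ha
  have hv' : 2 * r ≤ nm z v := hv
  obtain ⟨w, w', h1, h2, h3, h4⟩ := h.leave (H := {v | nm z v ≤ r}) hu
    (by simp only [Set.mem_ofPred_eq]; omega)
  obtain ⟨x, hx1, hx2⟩ := arch_meet (by omega) le_rfl (by omega) ha (fun x hx => hx.1) hs (Or.inl he)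
    h4 (fun x hx => hx.1.1) ⟨w, ⟨h1.1.1, h1.1.2.1, h2⟩, h3⟩ hv
  have a1 := hx1.2
  have a2 := hx2.1.2
  rw [mem_op] at a1
  rw [mem_cl, a1] at a2
  exact absurd a2 (by simp)

lemma Pr_crossHA_le {c : ℝ} (hc : ∀ (z : Site) (r : ℤ), 1 ≤ r →
    c ≤ Pr {ω | Link (Om z (2 * r) r (2 * r) ∩ op ω) (bl z) (br z)}) (z : Site) {r : ℤ}
    (hr : 1 ≤ r) : Pr (CrossHA z r) ≤ 1 - c := by
  have h1 := Pr_compl (Om_finite z (2 * r) r (2 * r)) (dep_link_op (Om z (2 * r) r (2 * r)) (bl z) (br z))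
  have h2 : Pr (CrossHA z r) ≤ Pr {ω | Link (Om z (2 * r) r (2 * r) ∩ op ω) (bl z) (br z)}ᶜ :=
    Pr_mono fun ω hω ha => crossHA_no_arc hr hω ha
  have := hc z r hr
  linarith

lemma exists_disjOcc {A : Set Config} {ω : Config} {G : Finset ℕ} (S : ℕ → Set Site)
    (h1 : ∀ i ∈ G, ∀ v ∈ S i, ω v = false) (h2 : ∀ i ∈ G, ∀ j ∈ G, i ≠ j → Disjoint (S i) (S j))
    (h3 : ∀ i ∈ G, ∀ ω' : Config, (∀ v ∈ S i, ω' v = false) → ω' ∈ A) : ω ∈ DisjOcc A G.card := by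
  let e := G.equivFin.symm
  refine ⟨fun j => if h : j < G.card then S (e ⟨j, h⟩) else ∅, ?_, ?_, ?_⟩
  · intro i hi v hv
    simp only [hi, dif_pos] at hv
    exact h1 _ (e ⟨i, hi⟩).2 v hv
  · intro i hi j hj hij
    simp only [hi, hj, dif_pos]
    refine h2 _ (e ⟨i, hi⟩).2 _ (e ⟨j, hj⟩).2 fun heq => hij ?_
    have := e.injective (Subtype.ext heq)
    simpa using this
  · intro i hi ω' hω'
    simp only [hi, dif_pos] at hω'
    exact h3 _ (e ⟨i, hi⟩).2 ω' hω'

lemma link_of_closed {S X Y Λ : Set Site} {ω : Config} (h : Link S X Y) (hS : S ⊆ Λ)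
    (hc : ∀ v ∈ S, ω v = false) : Link (Λ ∩ cl ω) X Y :=
  h.of_subset fun v hv => ⟨hS hv, hc v hv⟩

lemma cellArm_disjOcc {m r : ℤ} {N : ℕ} (hm : 1 ≤ m) (hN : 18 * m * N ≤ r) {ω : Config}
    {G : Finset ℕ} (hG : G ⊆ Finset.range N) (h : ∀ i ∈ G, ω ∈ CellArm (9 * m * i, 0) m (3 * r)) :
    ω ∈ DisjOcc (CrossHA (0, 0) r) G.card := by
  classical
  have hi : ∀ i ∈ G, 0 ≤ 9 * m * (i : ℤ) ∧ 18 * m * (i : ℤ) + 18 * m ≤ r := by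
    intro i hi
    have h1 : i + 1 ≤ N := Finset.mem_range.1 (hG hi)
    have h2 : ((i : ℤ) + 1) ≤ N := by exact_mod_cast h1
    constructor
    · positivity
    · nlinarith
  choose! ρ hρ f hf hρf hno using h
  set P : Set Site := Lam (0, 0) (2 * r) (2 * r) ∩ cl ω with hP
  have hρn : ∀ i ∈ G, nm (0, 0) (ρ i) ≤ r := by
    intro i hiG
    obtain ⟨a1, a2⟩ := hi i hiG
    obtain ⟨b1, b2, b3⟩ := hρ i hiG
    simp only at b1 b2 b3
    simp only [nm, b1]
    generalize m * (i : ℤ) = q at *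
    have e1 : 9 * m * (i : ℤ) = 9 * (m * i) := by ring
    have e2 : 18 * m * (i : ℤ) = 18 * (m * i) := by ring
    rw [e1] at a1 b2 b3
    rw [e2] at a2
    generalize m * (i : ℤ) = q at *
    omega
  have hlink : ∀ i ∈ G, ∃ w, 2 * r ≤ nm (0, 0) w ∧ Con P (ρ i) w := by
    intro i hiG
    obtain ⟨a1, a2⟩ := hi i hiG
    have hff := hf i hiG
    simp only [far, nm, Set.mem_ofPred_eq] at hff
    have e1 : 9 * m * (i : ℤ) = 9 * (m * i) := by ring
    have e2 : 18 * m * (i : ℤ) = 18 * (m * i) := by ring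
    obtain ⟨w, hw, h1⟩ := (hρf i hiG).hit (nm (0, 0)) (fun a b hab => (nm_step _ hab).1) (c := 2 * r)
      (by have := hρn i hiG; nlinarith) (by
        rw [e1] at a1 hff
        rw [e2] at a2
        simp only [nm]
        generalize m * (i : ℤ) = q at *
        omega)
    refine ⟨w, hw.ge, h1.mono ?_⟩
    rintro x ⟨⟨h2, h3⟩, h4⟩
    refine ⟨⟨h2.1, ?_, h4⟩, h3⟩
    simp only [nm, Set.mem_ofPred_eq] at h4
    simp only; omega
  refine exists_disjOcc (fun i => {x | Con P (ρ i) x}) (fun i _ v hv => (Con.right_mem hv).2) ?_ ?_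
  · have key : ∀ i ∈ G, ∀ j ∈ G, i < j → Disjoint {x | Con P (ρ i) x} {x | Con P (ρ j) x} := by
      intro i hiG j hjG hij
      rw [Set.disjoint_left]
      intro x hx1 hx2
      have hcon : Con P (ρ j) (ρ i) := Con.trans hx2 (Con.symm hx1)
      obtain ⟨a1, a2⟩ := hi j hjG
      obtain ⟨b1, b2, b3⟩ := hρ i hiG
      have hij' : (i : ℤ) + 1 ≤ j := by exact_mod_cast hij
      refine hno j hjG (ρ i) b1 ?_ (hcon.mono ?_)
      · simp only at b3 ⊢
        nlinarith
      · rintro v ⟨⟨v1, v2, v3⟩, v4⟩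
        have e1 : 9 * m * (j : ℤ) = 9 * (m * j) := by ring
        have e2 : 18 * m * (j : ℤ) = 18 * (m * j) := by ring
        simp only [nm] at v3 v1 v2
        have q0 : 0 ≤ m * (j : ℤ) := by positivity
        rw [e2] at a2
        refine ⟨⟨v1, ?_, ?_⟩, v4⟩ <;> simp only [nm] <;> rw [e1] <;>
          clear hcon hρf hlink hno hf hρ hρn e1 e2 <;>
          generalize m * (j : ℤ) = q at * <;> clear * - v1 v2 v3 q0 a2 hm <;> omega
    intro i hiG j hjG hij
    rcases lt_or_gt_of_ne hij with h | h
    · exact key i hiG j hjG h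
    · exact (key j hjG i hiG h).symm
  · intro i hiG ω' hω'
    obtain ⟨w, hw, hc⟩ := hlink i hiG
    exact link_of_closed ⟨_, _, hρn i hiG, hw, hc.comp⟩ (fun x hx => (Con.right_mem hx).1) hω'

theorem ArmA_half : ∃ C : ℝ, 0 < C ∧ ∀ (z : Site) (m d : ℤ), 1 ≤ m → m ≤ d →
    Pr (ArmA z d m d) ≤ C * (m / d) := by
  obtain ⟨c, hc0, hc1, hc⟩ := arcs
  have hop := fun z r hr => (hc z r hr).2
  have hcl := fun z r hr => (hc z r hr).1
  have main : ∀ (m r : ℤ) (N : ℕ), 1 ≤ m → 18 * m * N ≤ r → 2 * m ≤ r →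
      N * (c ^ 3 * Pr (ArmA (0, 0) (3 * r) m (3 * r))) ≤ 1 := by
    intro m r N hm hN hr
    have h1 : ∀ i ∈ Finset.range N, c ^ 2 * Pr (ArmA (0, 0) (3 * r) m (3 * r)) ≤
        Pr (CellArm (9 * m * i, 0) m (3 * r)) := by
      intro i _
      have k1 := Pr_rightArm hcl (z := (9 * m * i, 0)) hm (by omega : 4 * m ≤ 3 * r)
      have k2 := Pr_cellArm hop (z := (9 * m * i, 0)) hm (by omega : 4 * m ≤ 3 * r)
      rw [Pr_ArmA_trl _ (0, 0)] at k1
      have := mul_le_mul_of_nonneg_left k1 hc0.le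
      calc _ = c * (c * Pr (ArmA (0, 0) (3 * r) m (3 * r))) := by ring
        _ ≤ _ := this.trans k2
    have h2 : ∑ i ∈ Finset.range N, Pr (CellArm (9 * m * i, 0) m (3 * r)) ≤ (1 - c) / (1 - (1 - c)) := by
      refine sum_Pr_le_of_tail (Finset.range N) (S := ⋃ i ∈ Finset.range N, Lam (9 * m * i, 0) (3 * r) (3 * r))
        ?_ (fun i => CellArm (9 * m * i, 0) m (3 * r)) ?_ (by linarith) (by linarith) ?_
      · exact Set.Finite.biUnion (Finset.finite_toSet _) fun i _ => Lam_finite _ _ _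
      · intro i hi
        refine Dep.mono (S := Lam (9 * m * i, 0) (3 * r) (3 * r)) ?_ (subset_biUnion_of_mem (u := fun i : ℕ => Lam (9 * m * i, 0) (3 * r) (3 * r)) hi)
        intro ω ω' hh
        simp only [CellArm, Set.mem_ofPred_eq, inter_cl_congr hh,
          inter_cl_congr fun v hv => hh v (Om_subset_Lam _ _ _ _ hv)]
      · intro k
        refine le_trans (Pr_mono ?_) ((Pr_disjOcc_le (S := Lam (0, 0) (2 * r) (2 * r)) (Lam_finite _ _ _)
          (dec_link _ _ _) (dep_link_cl _ _ _) k).trans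
          (pow_le_pow_left₀ (Pr_nonneg _) (Pr_crossHA_le hop (0, 0) (r := r) (by omega)) k))
        rintro ω ⟨G, hG, rfl, h⟩
        exact cellArm_disjOcc hm hN hG h
    have h3 := (Finset.sum_le_sum h1).trans h2
    rw [Finset.sum_const, Finset.card_range, nsmul_eq_mul] at h3
    rw [sub_sub_cancel] at h3
    calc N * (c ^ 3 * Pr (ArmA (0, 0) (3 * r) m (3 * r)))
        = c * (N * (c ^ 2 * Pr (ArmA (0, 0) (3 * r) m (3 * r)))) := by ring
      _ ≤ c * ((1 - c) / c) := mul_le_mul_of_nonneg_left h3 hc0.le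
      _ = 1 - c := by field_simp
      _ ≤ 1 := by linarith
  refine ⟨200 / c ^ 3, by positivity, fun z m d hm hmd => ?_⟩
  rw [Pr_ArmA_trl z (0, 0)]
  have hm' : (1 : ℝ) ≤ m := by exact_mod_cast hm
  have hmd' : (m : ℝ) ≤ d := by exact_mod_cast hmd
  have hc3 : c ^ 3 ≤ 1 := pow_le_one₀ hc0.le hc1
  have hc3' : 0 < c ^ 3 := by positivity
  by_cases hd : d < 200 * m
  · have hd' : (d : ℝ) ≤ 200 * m := by exact_mod_cast hd.le
    refine (Pr_le_one _).trans ?_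
    rw [div_mul_div_comm, le_div_iff₀ (by nlinarith)]
    nlinarith
  · push Not at hd
    set r := d / 3 with hr
    have hr1 : 3 * r ≤ d := by omega
    have hr2 : d ≤ 3 * r + 2 := by omega
    set q := r / (18 * m) with hq
    have hq1 : 18 * m * q ≤ r := Int.mul_ediv_self_le (by omega)
    have hq2 : r < 18 * m * q + 18 * m := by
      have := Int.lt_mul_ediv_self_add (x := r) (k := 18 * m) (by omega)
      linarith
    have hq0 : 0 ≤ q := Int.ediv_nonneg (by omega) (by omega)
    lift q to ℕ using hq0 with N
    have hN := main m r N hm hq1 (by omega)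
    have hsub : ArmA (0, 0) d m d ⊆ ArmA (0, 0) (3 * r) m (3 * r) := by
      rw [ArmA_cut (y := 3 * r) (y' := d) (by omega) le_rfl hr1]
      exact ArmA_mono le_rfl hr1 (by omega)
    have hP := Pr_mono hsub
    have hP0 := Pr_nonneg (ArmA (0, 0) d m d)
    have hNd : d ≤ 200 * (m * N) := by nlinarith
    have hNd' : (d : ℝ) ≤ 200 * (m * N) := by exact_mod_cast hNd
    have hd0 : (0 : ℝ) < d := by linarith
    rw [div_mul_div_comm, le_div_iff₀ (by positivity)]
    have e1 : (N : ℝ) * (c ^ 3 * Pr (ArmA (0, 0) d m d)) ≤ 1 :=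
      le_trans (by gcongr) hN
    calc Pr (ArmA (0, 0) d m d) * (c ^ 3 * d) = d * (c ^ 3 * Pr (ArmA (0, 0) d m d)) := by ring
      _ ≤ 200 * (m * N) * (c ^ 3 * Pr (ArmA (0, 0) d m d)) := by gcongr
      _ = 200 * m * (N * (c ^ 3 * Pr (ArmA (0, 0) d m d))) := by ring
      _ ≤ 200 * m * 1 := by gcongr
      _ = 200 * m := by ring

/-- Left and top parts of a half annulus. -/
def HR (z : Site) (r X : ℤ) : Set Site :=
  rect (z.1 - 2 * r) (z.1 - r - 1) z.2 (z.2 + 2 * r) ∪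
    rect (z.1 - 2 * r) (z.1 + X) (z.2 + r + 1) (z.2 + 2 * r)

/-- Right end of the top part of a half annulus. -/
def HE (z : Site) (r X : ℤ) : Set Site := {e | e.1 = z.1 + X ∧ z.2 + r < e.2}

lemma mem_HR {z v : Site} {r X : ℤ} : v ∈ HR z r X ↔
    (z.1 - 2 * r ≤ v.1 ∧ v.1 ≤ z.1 - r - 1 ∧ z.2 ≤ v.2 ∧ v.2 ≤ z.2 + 2 * r) ∨
    (z.1 - 2 * r ≤ v.1 ∧ v.1 ≤ z.1 + X ∧ z.2 + r + 1 ≤ v.2 ∧ v.2 ≤ z.2 + 2 * r) := Iff.rfl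

lemma HR_subset {z : Site} {r X : ℤ} (hr : 0 ≤ r) (h0 : 0 ≤ X) (hX : X ≤ 2 * r) :
    HR z r X ⊆ Om z X r (2 * r) := by
  intro v hv
  rw [mem_HR] at hv
  rw [mem_Om]
  simp only [nm]
  omega

theorem half_arcs : ∃ c : ℝ, 0 < c ∧ c ≤ 1 ∧ ∀ (z : Site) (r X : ℤ), 1 ≤ r → 0 ≤ X → X ≤ 2 * r →
    c ≤ Pr {ω | Link (HR z r X ∩ cl ω) (bl z) (HE z r X)} ∧
    c ≤ Pr {ω | Link (HR z r X ∩ op ω) (bl z) (HE z r X)} := by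
  obtain ⟨c, hc, h⟩ := rsw 4
  have hkey : ∀ (z : Site) (r X : ℤ), 1 ≤ r → 0 ≤ X → X ≤ 2 * r →
      c * c ≤ Pr {ω | Link (HR z r X ∩ op ω) (bl z) (HE z r X)} := by
    intro z r X hr hX0 hX
    have p1 := ((h (z.1 - 2 * r) (z.1 - r - 1) z.2 (z.2 + 2 * r) (by omega) (by omega)).2
      (by push_cast; omega)).1
    have p2 := ((h (z.1 - 2 * r) (z.1 + X) (z.2 + r + 1) (z.2 + 2 * r) (by omega) (by omega)).1
      (by push_cast; omega)).1
    have hRf : (HR z r X).Finite := (rect_finite _ _ _ _).union (rect_finite _ _ _ _)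
    have d1 : Dep (HR z r X) (btOp (z.1 - 2 * r) (z.1 - r - 1) z.2 (z.2 + 2 * r)) :=
      (dep_link_op _ _ _).mono subset_union_left
    have d2 : Dep (HR z r X) (lrOp (z.1 - 2 * r) (z.1 + X) (z.2 + r + 1) (z.2 + 2 * r)) :=
      (dep_link_op _ _ _).mono subset_union_right
    have i1 : Inc (btOp (z.1 - 2 * r) (z.1 - r - 1) z.2 (z.2 + 2 * r)) := inc_link _ _ _
    have i2 : Inc (lrOp (z.1 - 2 * r) (z.1 + X) (z.2 + r + 1) (z.2 + 2 * r)) := inc_link _ _ _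
    have q1 := harris hRf (i1.incOn univ) (i2.incOn univ) d1 (by rwa [inter_univ])
    refine le_trans (mul_le_mul p1 p2 hc.le (Pr_nonneg _)) (q1.trans (Pr_mono ?_))
    rintro ω ⟨h1, h2⟩
    obtain ⟨s, e, a1, a2, a3, a4, a5⟩ := half_arc (by omega) h1 h2
    exact ⟨s, e, ⟨a1, by omega⟩, ⟨a3.symm, a4⟩, a5⟩
  refine ⟨c * c, by positivity, (hkey (0, 0) 1 0 le_rfl le_rfl (by norm_num)).trans (Pr_le_one _),
    fun z r X hr h0 hX => ⟨?_, hkey z r X hr h0 hX⟩⟩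
  refine (hkey z r X hr h0 hX).trans_eq ?_
  rw [← Pr_flip]
  congr 1; ext ω
  simp only [mem_preimage, Set.mem_ofPred_eq, op_flip]

lemma HR_link {z : Site} {r X : ℤ} (hr : 1 ≤ r) (h0 : 0 ≤ X) (hX : X ≤ 2 * r) :
    Link (HR z r X) (bl z) (HE z r X) := by
  obtain ⟨c, hc, -, h⟩ := half_arcs
  by_contra hcon
  have h1 := (h z r X hr h0 hX).1
  have : {ω | Link (HR z r X ∩ cl ω) (bl z) (HE z r X)} = ∅ := by
    ext ω
    simp only [Set.mem_ofPred_eq, mem_empty_iff_false, iff_false]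
    exact fun hl => hcon (hl.of_subset inter_subset_left)
  rw [this, Pr_empty] at h1
  linarith

/-- `k` is a possible value of the cluster of `src`. -/
def Seen (Ω src k : Set Site) : Prop :=
  k ⊆ Ω ∧ ∀ v ∈ Zb Ω src k, ∃ s ∈ src, Con (k ∪ {v}) s v

lemma seen_clus (Ω src : Set Site) (ω : Config) : Seen Ω src (clus Ω src ω) :=
  ⟨fun _ hx => (clus_subset hx).1, fun _ hv => Zb_path hv⟩

lemma Zb_src {Ω src k : Set Site} {v : Site} (h : v ∈ Ω) (hs : v ∈ src) : v ∈ Zb Ω src k :=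
  Or.inr ⟨h, Or.inl hs⟩

/-- An arch from the source to the right boundary meets every arm avoiding the revealed sites,
and can be followed to the right boundary from there. -/
lemma arch_meet_arm {z a b t f : Site} {y m d : ℤ} {k O T : Set Site} (hy : 0 ≤ y) (hyd : y < d)
    (hm : m ≤ d) (hk : Seen (Om z y m d) (bl z) k) (hO : O ⊆ Om z y m d) (h : Con O a b)
    (ha : a ∈ bl z) (hb : b.1 = z.1 + y) (hT : Con T t f)
    (hTO : T ⊆ Om z y m d \ Zb (Om z y m d) (bl z) k)
    (ht : t ∈ inn z y m) (hf : f ∈ far z d) :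
    ∃ x ∈ T, Con (O \ Zb (Om z y m d) (bl z) k) x b := by
  set Ω := Om z y m d with hΩ
  have hTL : T ⊆ Lam z y d := fun x hx => Om_subset_Lam _ _ _ _ (hTO hx).1
  by_cases hbZ : b ∈ Zb Ω (bl z) k
  · obtain ⟨s, hs, h1⟩ := hk.2 b hbZ
    obtain ⟨x, hx1, hx2⟩ := arch_meet hy hyd.le hm h1
      (union_subset hk.1 (singleton_subset_iff.2 (hO h.right_mem))) hs (Or.inr ⟨hb, hyd⟩) hT hTL ht hf
    rcases hx1 with hx1 | rfl
    · exact absurd (Or.inl hx1) (hTO hx2).2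
    · exact absurd hbZ (hTO hx2).2
  · obtain ⟨w, w', h1, h2, h3, h4⟩ := h.leave (Zb_src (hO h.left_mem) ha) hbZ
    obtain ⟨s, hs, h5⟩ := hk.2 w h2
    set F : Set Site := {x | Con (O \ Zb Ω (bl z) k) w' x} with hF
    have hFF : Con F w' b := h4.comp
    have hS : Con (k ∪ {w} ∪ F) s b := (h5.mono subset_union_left).trans
      ((Con.single (Or.inl (Or.inr rfl)) (Or.inr hFF.left_mem) h3).trans (hFF.mono subset_union_right))
    obtain ⟨x, hx1, hx2⟩ := arch_meet hy hyd.le hm hS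
      (union_subset (union_subset hk.1 (singleton_subset_iff.2 (hO h1)))
        fun x hx => hO (Con.right_mem hx).1) hs (Or.inr ⟨hb, hyd⟩) hT hTL ht hf
    rcases hx1 with (hx1 | rfl) | hx1
    · exact absurd (Or.inl hx1) (hTO hx2).2
    · exact absurd h2 (hTO hx2).2
    · have hx1' : Con (O \ Zb Ω (bl z) k) w' x := hx1
      exact ⟨x, hx2, hx1'.symm.trans h4⟩

lemma free_grow {z : Site} {y y' m d : ℤ} {ω : Config} (hyy : y ≤ y')
    (hk : ∀ v ∈ clus (Om z y m d) (bl z) ω, v.1 ≠ z.1 + y) (hy : 0 ≤ y) :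
    (Om z y' m d \ Zb (Om z y m d) (bl z) (clus (Om z y m d) (bl z) ω)) ∩ cl ω ⊆
      free (Om z y' m d) (bl z) ω := by
  rintro v ⟨⟨h1, h2⟩, h3⟩
  refine ⟨⟨h1, h3⟩, ?_⟩
  rintro ⟨s, hs, hc⟩
  have hsm := hc.left_mem
  have hsΩ : s ∈ Om z y m d := ⟨hsm.1.1, by have := hs.2; omega, hsm.1.2.2⟩
  have hsk : s ∈ clus (Om z y m d) (bl z) ω := clus_src hsΩ hs hsm.2
  have hvk : v ∉ clus (Om z y m d) (bl z) ω := fun h => h2 (Or.inl h)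
  obtain ⟨w, w', k1, k2, k3, k4⟩ := hc.leave hsk hvk
  obtain ⟨⟨a1, a2⟩, a3⟩ := k4.left_mem
  have hw := (clus_subset k2).1
  by_cases hx : w'.1 ≤ z.1 + y
  · exact a3 (clus_step k2 ⟨a1.1, hx, a1.2.2⟩ a2 k3)
  · have := adj_bound k3
    have := hw.2.1
    exact hk w k2 (by omega)

/-- If the arm event holds, the cluster of the source does not reach the right boundary. -/
lemma armA_clus {z : Site} {y m d : ℤ} {ω : Config} (hy : 0 ≤ y) (hyd : y < d) (hm : m ≤ d)
    (h : ω ∈ ArmA z y m d) : ∀ v ∈ clus (Om z y m d) (bl z) ω, v.1 ≠ z.1 + y := by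
  intro v hv hvy
  obtain ⟨s, hs, h1⟩ := clus_path hv
  obtain ⟨t, f, ht, hf, h2⟩ := h
  rw [free_eq] at h2
  obtain ⟨x, hx1, hx2⟩ := arch_meet_arm (O := clus (Om z y m d) (bl z) ω) hy hyd hm
    (seen_clus _ _ ω) (fun x hx => (clus_subset hx).1) h1 hs hvy h2 (fun x hx => hx.1) ht hf
  exact hx2.right_mem.2 (Or.inl hx2.right_mem.1)

lemma ArmA_grow {z : Site} {y y' m d : ℤ} (hy : 0 ≤ y) (hyy : y ≤ y') (hyd : y < d) (hm : m ≤ d) :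
    ArmA z y m d ⊆ ArmA z y' m d := by
  intro ω h
  have h1 := armA_clus hy hyd hm h
  obtain ⟨t, f, ht, hf, h2⟩ := h
  rw [free_eq] at h2
  exact ⟨t, f, inn_mono hyy le_rfl ht, hf, h2.mono ((inter_subset_inter_left _
    (sdiff_subset_sdiff_left (Om_mono hyy le_rfl le_rfl))).trans (free_grow hyy h1 hy))⟩

/-- Unrevealed sites. -/
def Unr (z : Site) (y m d : ℤ) (k : Set Site) : Set Site := Om z y m d \ Zb (Om z y m d) (bl z) k

/-- Unrevealed sites of the ring between `2 * y` and `4 * y` joined to the right boundary through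
unrevealed sites of that ring. -/
def Reach (z : Site) (y m d : ℤ) (k : Set Site) : Set Site :=
  {v | ∃ b : Site, b.1 = z.1 + y ∧ Con (Om z y (2 * y) (4 * y) \ Zb (Om z y m d) (bl z) k) b v}

/-- Sites adjacent to the reachable region. -/
def NReach (z : Site) (y m d : ℤ) (k : Set Site) : Set Site :=
  {v | ∃ w ∈ Reach z y m d k, Adj v w}

/-- The vertical strip to the right of the boundary. -/
def Strip (z : Site) (y : ℤ) : Set Site := rect (z.1 + y + 1) (z.1 + 2 * y) (z.2 + y + 1) (z.2 + 8 * y)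

section
variable {z : Site} {y m d : ℤ} {k : Set Site} {ω : Config}

lemma reach_subset (hy : 1 ≤ y) (hmy : m ≤ y) (hd : 8 * y ≤ d) :
    Reach z y m d k ⊆ Unr z y m d k := by
  rintro v ⟨b, -, h⟩
  exact ⟨Om_mono le_rfl (by omega) (by omega) h.right_mem.1, h.right_mem.2⟩

lemma reach_ring : Reach z y m d k ⊆ Om z y (2 * y) (4 * y) := by
  rintro v ⟨b, -, h⟩
  exact h.right_mem.1

lemma arm_hits_reach (hy : 1 ≤ y) (hmy : m ≤ y) (hd : 8 * y ≤ d)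
    (hk : Seen (Om z y m d) (bl z) k) {t f : Site} {T : Set Site} (hT : Con T t f)
    (hTO : T ⊆ Unr z y m d k) (ht : t ∈ inn z y m) (hf : f ∈ far z d) :
    ∃ x ∈ T, x ∈ Reach z y m d k := by
  have hHR : HR z (2 * y) y ⊆ Om z y (2 * y) (4 * y) :=
    (HR_subset (by omega) (by omega) (by omega)).trans (Om_mono le_rfl le_rfl (by omega))
  obtain ⟨a, b, ha, hb, h⟩ := HR_link (z := z) (r := 2 * y) (X := y) (by omega) (by omega) (by omega)
  obtain ⟨x, hx, hxb⟩ := arch_meet_arm (by omega) (by omega) (by omega) hk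
    (hHR.trans (Om_mono le_rfl (by omega) (by omega))) h ha hb.1 hT hTO ht hf
  exact ⟨x, hx, b, hb.1, hxb.symm.mono (sdiff_subset_sdiff_left hHR)⟩

/-- The two pieces of an arm before and after the reachable region. -/
lemma arm_pieces (hy : 1 ≤ y) (hmy : m ≤ y) (hd : 8 * y ≤ d)
    (hk : Seen (Om z y m d) (bl z) k) (h : Link (Unr z y m d k ∩ cl ω) (inn z y m) (far z d)) :
    Link ((Unr z y m d k \ Reach z y m d k) ∩ cl ω) (inn z y m) (NReach z y m d k) ∧
    Link ((Unr z y m d k \ Reach z y m d k) ∩ cl ω) (NReach z y m d k) (far z d) := by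
  obtain ⟨t, f, ht, hf, h⟩ := h
  obtain ⟨x, hx1, hx2⟩ := arm_hits_reach hy hmy hd hk h.comp
    (fun x hx => (Con.right_mem hx).1) ht hf
  have hx1' : Con (Unr z y m d k ∩ cl ω) t x := hx1
  have e : (Unr z y m d k ∩ cl ω) \ Reach z y m d k = (Unr z y m d k \ Reach z y m d k) ∩ cl ω := by
    ext v; simp only [mem_inter_iff, Set.mem_sdiff]; tauto
  constructor
  · have htn : t ∉ Reach z y m d k := fun htr => by
      have := (reach_ring htr).2.2.1
      have := inn_nm ht
      omega
    obtain ⟨w', w, h1, h2, h3, h4⟩ := hx1'.enter htn hx2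
    rw [e] at h1
    exact ⟨t, w', ht, ⟨w, h4, h2⟩, h1⟩
  · have hfn : f ∉ Reach z y m d k := fun hfr => by
      have := (reach_ring hfr).2.2.2
      have : d ≤ nm z f := hf
      omega
    obtain ⟨w, w', h1, h2, h3, h4⟩ := (hx1'.symm.trans h).leave hx2 hfn
    rw [e] at h4
    exact ⟨w', f, ⟨w, h2, adj_symm h3⟩, hf, h4⟩

/-- A reachable site is joined to the right boundary of the larger region. -/
lemma reach_ray (hy : 1 ≤ y) {w : Site} (hw : w ∈ Reach z y m d k) :
    ∃ h, z.2 + 2 * y < h ∧ h ≤ z.2 + 4 * y ∧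
      Con (Reach z y m d k ∪ {v | v.2 = h ∧ z.1 + y < v.1 ∧ v.1 ≤ z.1 + 2 * y}) w (z.1 + 2 * y, h) := by
  obtain ⟨b, hb, h⟩ := hw
  have hbR : b ∈ Reach z y m d k := ⟨b, hb, Con.refl h.left_mem⟩
  have hbr := reach_ring hbR
  simp only [mem_Om, nm] at hbr
  refine ⟨b.2, by omega, by omega, ?_⟩
  have h1 : Con (Reach z y m d k) b w := h.comp.mono fun x hx => ⟨b, hb, hx⟩
  refine (h1.symm.mono subset_union_left).trans ?_
  have := con_horiz (A := Reach z y m d k ∪ {v | v.2 = b.2 ∧ z.1 + y < v.1 ∧ v.1 ≤ z.1 + 2 * y})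
    (y := b.2) (x := b.1) (x' := z.1 + 2 * y) (by omega) fun t ht1 ht2 => by
      by_cases htb : t = b.1
      · left
        rw [htb]; exact hbR
      · exact Or.inr ⟨rfl, by simp only; omega, ht2⟩
  exact this

/-- The final part of an arc, outside the revealed region, together with the access to it. -/
lemma arc_tail {r : ℤ} (hy : 1 ≤ y) (hmr : m ≤ r) (hyr : y ≤ r) (hd : 2 * r ≤ d)
    (hk : Seen (Om z y m d) (bl z) k)
    (h : Link (HR z r (2 * y) ∩ (Zb (Om z y m d) (bl z) k ∪ cl ω)) (bl z) (HE z r (2 * y))) :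
    ∃ s w w' e, s ∈ bl z ∧ w ∈ Zb (Om z y m d) (bl z) k ∧ Con (k ∪ {w}) s w ∧ Adj w w' ∧
      Con ((HR z r (2 * y) \ Zb (Om z y m d) (bl z) k) ∩ cl ω) w' e ∧ e ∈ HE z r (2 * y) := by
  obtain ⟨a, e, ha, he, h⟩ := h
  have haΩ : a ∈ Om z y m d := by
    have := h.left_mem.1
    have h2 := ha.2
    rw [mem_HR] at this
    rw [mem_Om]; simp only [nm]
    omega
  have heZ : e ∉ Zb (Om z y m d) (bl z) k := fun hZ => by
    have := (Zb_subset hk.1 hZ).2.1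
    have := he.1
    omega
  obtain ⟨w, w', h1, h2, h3, h4⟩ := h.leave (Zb_src haΩ ha) heZ
  obtain ⟨s, hs, h5⟩ := hk.2 w h2
  refine ⟨s, w, w', e, hs, h2, h5, h3, h4.mono ?_, he⟩
  rintro x ⟨⟨hx1, hx2⟩, hx3⟩
  exact ⟨⟨hx1, hx3⟩, hx2.resolve_left hx3⟩

/-- The final part of an arc meets a vertical crossing of the strip. -/
lemma tail_strip {r : ℤ} (hy : 1 ≤ y) (hyr : y ≤ r) (hr : r ≤ 4 * y) {V F : Set Site}
    {p q w' e : Site}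
    (hV : Con V p q) (hVS : V ⊆ Strip z y) (hp : p.2 ≤ z.2 + y + 1) (hq : z.2 + 8 * y ≤ q.2)
    (hF : Con F w' e) (hFS : F ⊆ HR z r (2 * y)) (hw : w'.1 ≤ z.1 + y + 1)
    (he : e ∈ HE z r (2 * y)) : (F ∩ V).Nonempty := by
  have he1 := he.1
  obtain ⟨a, ha, h1⟩ := hF.symm.hit (fun x => -x.1) (fun a b hab => by
    have := adj_bound hab; omega) (c := -(z.1 + y + 1)) (by omega) (by omega)
  obtain ⟨x, hx1, hx2⟩ := crossings_meet (x0 := z.1 + y + 1) (x1 := z.1 + 2 * y) (y0 := z.2 + r + 1)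
    (y1 := z.2 + 2 * r) h1.symm hV (fun v hv => by
      have k1 := hFS hv.1
      have k2 := hv.2
      rw [mem_HR] at k1
      simp only [Set.mem_ofPred_eq] at k2
      omega) (fun v hv => ⟨(hVS hv).1, (hVS hv).2.1⟩) (by omega) (by omega)
      (by omega) (by omega)
  exact ⟨x, hx1.1, hx2⟩

lemma inner_meets (hy : 1 ≤ y) (hm : 0 ≤ m) (hmy : m ≤ y) (hd : 8 * y ≤ d)
    (hk : Seen (Om z y m d) (bl z) k) {s w w' e u w1 : Site} {F I : Set Site}
    (hs : s ∈ bl z) (hwZ : w ∈ Zb (Om z y m d) (bl z) k) (hsw : Con (k ∪ {w}) s w)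
    (hww : Adj w w') (hF : Con F w' e) (hFS : F ⊆ HR z y (2 * y)) (he : e ∈ HE z y (2 * y))
    (hI : Con I u w1) (hIU : I ⊆ Unr z y m d k) (hu : u ∈ inn z y m)
    (hw1 : w1 ∈ NReach z y m d k) : (F ∩ I).Nonempty := by
  obtain ⟨w2, hw2, hw12⟩ := hw1
  obtain ⟨h, hh1, hh2, hray⟩ := reach_ray hy hw2
  obtain ⟨v0, hv0, hv0u⟩ := hu
  set Ray : Set Site := {v | v.2 = h ∧ z.1 + y < v.1 ∧ v.1 ≤ z.1 + 2 * y} with hRay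
  have hS : Con (k ∪ {w} ∪ F) s e := (hsw.mono subset_union_left).trans
    ((Con.single (Or.inl (Or.inr rfl)) (Or.inr hF.left_mem) hww).trans (hF.mono subset_union_right))
  have hT : Con (Lam z y m ∪ (I ∪ (Reach z y m d k ∪ Ray))) z (z.1 + 2 * y, h) :=
    ((Lam_con (by omega) hv0).mono subset_union_left).trans
      ((Con.single (Or.inl hv0) (Or.inr (Or.inl hI.left_mem)) hv0u).trans
      ((hI.mono (fun x hx => Or.inr (Or.inl hx))).trans
      ((Con.single (Or.inr (Or.inl hI.right_mem)) (Or.inr (Or.inr hray.left_mem)) hw12).trans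
        (hray.mono fun x hx => Or.inr (Or.inr hx)))))
  have hZΩ : ∀ v ∈ k ∪ {w}, v ∈ Zb (Om z y m d) (bl z) k := by
    rintro v (hv | rfl)
    · exact Or.inl hv
    · exact hwZ
  have hSb : ∀ v ∈ k ∪ {w} ∪ F, v ∈ Om z (2 * y) m d := by
    rintro v (hv | hv)
    · exact Om_mono (by omega) le_rfl le_rfl (Zb_subset hk.1 (hZΩ v hv))
    · exact Om_mono le_rfl (by omega) (by omega)
        (HR_subset (by omega) (by omega) (by omega) (hFS hv))
  have hRb : ∀ v ∈ Reach z y m d k ∪ Ray, v ∈ Om z (2 * y) (2 * y) (4 * y) ∧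
      v ∉ Zb (Om z y m d) (bl z) k := by
    rintro v (hv | hv)
    · exact ⟨Om_mono (by omega) le_rfl le_rfl (reach_ring hv), (reach_subset hy hmy hd hv).2⟩
    · simp only [hRay, Set.mem_ofPred_eq] at hv
      refine ⟨?_, fun hZ => ?_⟩
      · rw [mem_Om]; simp only [nm]; omega
      · have := (Zb_subset hk.1 hZ).2.1
        omega
  obtain ⟨x, hx1, hx2⟩ := cross4 (x0 := z.1 - d) (x1 := z.1 + 2 * y) (y0 := z.2) (y1 := z.2 + d) hS hT
    (fun v hv => by
      have := hSb v hv
      simp only [mem_Om, nm] at this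
      exact ⟨by omega, by omega, by omega, by omega⟩)
    (by
      rintro v (hv | hv | hv)
      · simp only [mem_Lam, nm] at hv
        exact ⟨by omega, by omega, by omega, by omega⟩
      · have := (hIU hv).1
        simp only [mem_Om, nm] at this
        exact ⟨by omega, by omega, by omega, by omega⟩
      · have := (hRb v hv).1
        simp only [mem_Om, nm] at this
        exact ⟨by omega, by omega, by omega, by omega⟩)
    hs.1 (Or.inl rfl) (Or.inr he.1) (by have h1 := hs.1; have h2 := hs.2; omega)
    (by have h1 := he.1; have h2 := he.2; omega)
    (Or.inr (Or.inr ⟨Or.inr rfl, by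
      have h1 := he.1
      have h2 := he.2
      have h3 := hSb e (Or.inr hF.right_mem)
      have h4 := hFS hF.right_mem
      rw [mem_HR] at h4
      simp only
      omega⟩))
  rcases hx2 with hx2 | hx2 | hx2
  · have h1 := (hSb x hx1).2.2.1
    have h2 := hx2.2.2
    omega
  · rcases hx1 with hx1 | hx1
    · exact absurd (hZΩ x hx1) (hIU hx2).2
    · exact ⟨x, hx1, hx2⟩
  · rcases hx1 with hx1 | hx1
    · exact absurd (hZΩ x hx1) (hRb x hx2).2
    · have h1 := (hRb x hx2).1.2.2.1
      have h2 := (HR_subset (by omega) (by omega) (by omega) (hFS hx1)).2.2.2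
      omega

lemma outer_meets (hy : 1 ≤ y) (hmy : m ≤ y) (hd : 8 * y ≤ d)
    (hk : Seen (Om z y m d) (bl z) k) {s w w' e f w1 : Site} {F I : Set Site}
    (hs : s ∈ bl z) (hwZ : w ∈ Zb (Om z y m d) (bl z) k) (hsw : Con (k ∪ {w}) s w)
    (hww : Adj w w') (hF : Con F w' e) (hFS : F ⊆ HR z (4 * y) (2 * y))
    (he : e ∈ HE z (4 * y) (2 * y))
    (hI : Con I w1 f) (hIU : I ⊆ Unr z y m d k) (hf : f ∈ far z d)
    (hw1 : w1 ∈ NReach z y m d k) : (F ∩ I).Nonempty := by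
  obtain ⟨w2, hw2, hw12⟩ := hw1
  obtain ⟨h, hh1, hh2, hray⟩ := reach_ray hy hw2
  set Ray : Set Site := {v | v.2 = h ∧ z.1 + y < v.1 ∧ v.1 ≤ z.1 + 2 * y} with hRay
  have hS : Con (k ∪ {w} ∪ F) s e := (hsw.mono subset_union_left).trans
    ((Con.single (Or.inl (Or.inr rfl)) (Or.inr hF.left_mem) hww).trans (hF.mono subset_union_right))
  have hT : Con (I ∪ (Reach z y m d k ∪ Ray)) (z.1 + 2 * y, h) f :=
    (hray.symm.mono subset_union_right).trans
      ((Con.single (Or.inr hray.left_mem) (Or.inl hI.left_mem) (adj_symm hw12)).trans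
      (hI.mono subset_union_left))
  have hZΩ : ∀ v ∈ k ∪ {w}, v ∈ Zb (Om z y m d) (bl z) k := by
    rintro v (hv | rfl)
    · exact Or.inl hv
    · exact hwZ
  have hSb : ∀ v ∈ k ∪ {w} ∪ F, v ∈ Om z (2 * y) m d := by
    rintro v (hv | hv)
    · exact Om_mono (by omega) le_rfl le_rfl (Zb_subset hk.1 (hZΩ v hv))
    · exact Om_mono le_rfl (by omega) (by omega)
        (HR_subset (by omega) (by omega) (by omega) (hFS hv))
  have hRb : ∀ v ∈ Reach z y m d k ∪ Ray, v ∈ Om z (2 * y) (2 * y) (4 * y) ∧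
      v ∉ Zb (Om z y m d) (bl z) k := by
    rintro v (hv | hv)
    · exact ⟨Om_mono (by omega) le_rfl le_rfl (reach_ring hv), (reach_subset hy hmy hd hv).2⟩
    · simp only [hRay, Set.mem_ofPred_eq] at hv
      refine ⟨?_, fun hZ => ?_⟩
      · rw [mem_Om]; simp only [nm]; omega
      · have := (Zb_subset hk.1 hZ).2.1
        omega
  have hfΩ := (hIU hI.right_mem).1
  have hf' : d ≤ nm z f := hf
  simp only [mem_Om, nm] at hfΩ hf'
  obtain ⟨x, hx1, hx2⟩ := cross4 (x0 := z.1 - d) (x1 := z.1 + 2 * y) (y0 := z.2) (y1 := z.2 + d) hS hT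
    (fun v hv => by
      have := hSb v hv
      simp only [mem_Om, nm] at this
      exact ⟨by omega, by omega, by omega, by omega⟩)
    (by
      rintro v (hv | hv)
      · have := (hIU hv).1
        simp only [mem_Om, nm] at this
        exact ⟨by omega, by omega, by omega, by omega⟩
      · have := (hRb v hv).1
        simp only [mem_Om, nm] at this
        exact ⟨by omega, by omega, by omega, by omega⟩)
    hs.1 (Or.inr rfl) (Or.inr he.1) (by have h1 := hs.1; have h2 := hs.2; simp only; omega)
    (by have h1 := he.1; have h2 := he.2; simp only; omega)
    (by omega)
  rcases hx2 with hx2 | hx2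
  · rcases hx1 with hx1 | hx1
    · exact absurd (hZΩ x hx1) (hIU hx2).2
    · exact ⟨x, hx1, hx2⟩
  · rcases hx1 with hx1 | hx1
    · exact absurd (hZΩ x hx1) (hRb x hx2).2
    · have h1 := (hRb x hx2).1.2.2.2
      have h2 := (HR_subset (by omega) (by omega) (by omega) (hFS hx1)).2.2.1
      omega

end

section
variable {z : Site} {y m d : ℤ} {k : Set Site} {ω : Config}

/-- Events off the reachable region whose joint occurrence creates an arm in the larger region. -/
def Detour (z : Site) (y m d : ℤ) (k : Set Site) : Set Config :=
  ({ω | Link ((Unr z y m d k \ Reach z y m d k) ∩ cl ω) (inn z y m) (NReach z y m d k)} ∩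
    {ω | Link ((Unr z y m d k \ Reach z y m d k) ∩ cl ω) (NReach z y m d k) (far z d)}) ∩
  (({ω | Link (HR z y (2 * y) ∩ (Zb (Om z y m d) (bl z) k ∪ cl ω)) (bl z) (HE z y (2 * y))} ∩
    {ω | Link (HR z (4 * y) (2 * y) ∩ (Zb (Om z y m d) (bl z) k ∪ cl ω)) (bl z)
      (HE z (4 * y) (2 * y))}) ∩
    {ω | Link (Strip z y ∩ cl ω) {v | v.2 ≤ z.2 + y + 1} {v | z.2 + 8 * y ≤ v.2}})

/-- An open barrier inside the reachable region. -/
def Barrier (z : Site) (y m d : ℤ) (k : Set Site) : Set Config :=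
  {ω | Link (HR z (2 * y) y ∩ ((Reach z y m d k)ᶜ ∪ op ω)) (bl z) (HE z (2 * y) y)}

lemma barrier_no_arm (hy : 1 ≤ y) (hmy : m ≤ y) (hd : 8 * y ≤ d)
    (h : ω ∈ Barrier z y m d (clus (Om z y m d) (bl z) ω)) : ω ∉ ArmA z y m d := by
  rintro ⟨t, f, ht, hf, h2⟩
  rw [free_eq] at h2
  obtain ⟨a, b, ha, hb, hab⟩ := h
  have hHR : HR z (2 * y) y ⊆ Om z y (2 * y) (4 * y) :=
    (HR_subset (by omega) (by omega) (by omega)).trans (Om_mono le_rfl le_rfl (by omega))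
  obtain ⟨x, hx1, hx2⟩ := arch_meet_arm (by omega) (by omega) (by omega) (seen_clus _ _ ω)
    (inter_subset_left.trans (hHR.trans (Om_mono le_rfl (by omega) (by omega)))) hab ha hb.1 h2
    (fun x hx => hx.1) ht hf
  have hxR : x ∈ Reach z y m d (clus (Om z y m d) (bl z) ω) :=
    ⟨b, hb.1, hx2.symm.mono fun v hv => ⟨hHR hv.1.1, hv.2⟩⟩
  have h3 : ω x = true := hx2.left_mem.1.2.resolve_left fun h => h hxR
  have h4 : ω x = false := hx1.2
  rw [h3] at h4
  exact absurd h4 (by simp)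

lemma detour_arm (hy : 1 ≤ y) (hm : 0 ≤ m) (hmy : m ≤ y) (hd : 8 * y ≤ d)
    (hk : ∀ v ∈ clus (Om z y m d) (bl z) ω, v.1 ≠ z.1 + y)
    (h : ω ∈ Detour z y m d (clus (Om z y m d) (bl z) ω)) : ω ∈ ArmA z (2 * y) m d := by
  obtain ⟨⟨⟨u, w1, hu, hw1, hI⟩, ⟨w3, f, hw3, hf, hO⟩⟩, ⟨harc1, harc3⟩, ⟨p, q, hp, hq, hV⟩⟩ := h
  set K := clus (Om z y m d) (bl z) ω with hK
  have hseen := seen_clus (Om z y m d) (bl z) ω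
  rw [← hK] at hseen
  have hZΩ := Zb_subset (src := bl z) hseen.1
  obtain ⟨s, w, w', e, hs, hwZ, hsw, hww, hF, he⟩ := arc_tail hy hmy le_rfl (by omega) hseen harc1
  obtain ⟨s3, v, v', e3, hs3, hvZ, hsv, hvv, hF3, he3⟩ :=
    arc_tail hy (by omega) (by omega) (by omega) hseen harc3
  have hF1s : ∀ x ∈ {x | Con ((HR z y (2 * y) \ Zb (Om z y m d) (bl z) K) ∩ cl ω) w' x},
      x ∈ HR z y (2 * y) := fun x hx => (Con.right_mem hx).1.1
  have hF3s : ∀ x ∈ {x | Con ((HR z (4 * y) (2 * y) \ Zb (Om z y m d) (bl z) K) ∩ cl ω) v' x},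
      x ∈ HR z (4 * y) (2 * y) := fun x hx => (Con.right_mem hx).1.1
  have hw'1 : w'.1 ≤ z.1 + y + 1 := by
    have h1 := (hZΩ hwZ).2.1
    have := adj_bound hww
    omega
  have hv'1 : v'.1 ≤ z.1 + y + 1 := by
    have h1 := (hZΩ hvZ).2.1
    have := adj_bound hvv
    omega
  obtain ⟨a, ha1, ha2⟩ := inner_meets hy hm hmy hd hseen hs hwZ hsw hww hF.comp hF1s he
    hI.comp (fun x hx => (Con.right_mem hx).1.1) hu hw1
  obtain ⟨b, hb1, hb2⟩ := outer_meets hy hmy hd hseen hs3 hvZ hsv hvv hF3.comp hF3s he3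
    hO.comp (fun x hx => (Con.right_mem hx).1.1) hf hw3
  obtain ⟨a', ha'1, ha'2⟩ := tail_strip hy le_rfl (by omega) hV.comp
    (fun x hx => (Con.right_mem hx).1) hp hq hF.comp hF1s hw'1 he
  obtain ⟨b', hb'1, hb'2⟩ := tail_strip hy (by omega) le_rfl hV.comp
    (fun x hx => (Con.right_mem hx).1) hp hq hF3.comp hF3s hv'1 he3
  simp only [Set.mem_ofPred_eq] at ha1 ha2 hb1 hb2 ha'1 ha'2 hb'1 hb'2
  set M : Set Site := (Om z (2 * y) m d \ Zb (Om z y m d) (bl z) K) ∩ cl ω with hM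
  have mI : (Unr z y m d K \ Reach z y m d K) ∩ cl ω ⊆ M := fun x hx =>
    ⟨⟨Om_mono (by omega) le_rfl le_rfl hx.1.1.1, hx.1.1.2⟩, hx.2⟩
  have mF1 : (HR z y (2 * y) \ Zb (Om z y m d) (bl z) K) ∩ cl ω ⊆ M := fun x hx =>
    ⟨⟨Om_mono le_rfl (by omega) (by omega)
      (HR_subset (by omega) (by omega) (by omega) hx.1.1), hx.1.2⟩, hx.2⟩
  have mF3 : (HR z (4 * y) (2 * y) \ Zb (Om z y m d) (bl z) K) ∩ cl ω ⊆ M := fun x hx =>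
    ⟨⟨Om_mono le_rfl (by omega) (by omega)
      (HR_subset (by omega) (by omega) (by omega) hx.1.1), hx.1.2⟩, hx.2⟩
  have mV : Strip z y ∩ cl ω ⊆ M := fun x hx => by
    obtain ⟨h1, h2, h3, h4⟩ := hx.1
    refine ⟨⟨?_, fun hZ => ?_⟩, hx.2⟩
    · rw [mem_Om]; simp only [nm]; omega
    · have := (hZΩ hZ).2.1
      omega
  have c1 : Con M u a := ha2.mono mI
  have c2 : Con M a a' := (ha1.symm.trans ha'1).mono mF1
  have c3 : Con M a' b' := (ha'2.symm.trans hb'2).mono mV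
  have c4 : Con M b' b := (hb'1.symm.trans hb1).mono mF3
  have c5 : Con M b f := (hb2.symm.trans hO).mono mI
  exact ⟨u, f, inn_mono (by omega) le_rfl hu, hf,
    ((((c1.trans c2).trans c3).trans c4).trans c5).mono (free_grow (by omega) hk (by omega))⟩

lemma Pr_detour {c : ℝ} (hc0 : 0 < c) (hc : ∀ (z : Site) (r X : ℤ), 1 ≤ r → 0 ≤ X → X ≤ 2 * r →
    c ≤ Pr {ω | Link (HR z r X ∩ cl ω) (bl z) (HE z r X)} ∧
    c ≤ Pr {ω | Link (HR z r X ∩ op ω) (bl z) (HE z r X)}) {c' : ℝ} (hc0' : 0 < c')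
    (hc' : c' ≤ Pr (btCl (z.1 + y + 1) (z.1 + 2 * y) (z.2 + y + 1) (z.2 + 8 * y)))
    (hy : 1 ≤ y) (hm : 0 ≤ m) (hmy : m ≤ y) (hd : 8 * y ≤ d)
    (hk : Seen (Om z y m d) (bl z) k) :
    Dep ((Om z (2 * y) m d \ Zb (Om z y m d) (bl z) k) \ Reach z y m d k) (Detour z y m d k) ∧
    Pr {ω | Link (Unr z y m d k ∩ cl ω) (inn z y m) (far z d)} * (c * c * c') ≤
      Pr (Detour z y m d k) := by
  set S := (Om z (2 * y) m d \ Zb (Om z y m d) (bl z) k) \ Reach z y m d k with hS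
  have hSf : S.Finite := (Om_finite z (2 * y) m d).subset (sdiff_subset.trans sdiff_subset)
  have s1 : Unr z y m d k \ Reach z y m d k ⊆ S :=
    sdiff_subset_sdiff_left (sdiff_subset_sdiff_left (Om_mono (by omega) le_rfl le_rfl))
  have s2 : HR z y (2 * y) \ Zb (Om z y m d) (bl z) k ⊆ S := fun v hv => by
    have h1 := HR_subset (by omega) (by omega) (by omega) hv.1
    refine ⟨⟨Om_mono le_rfl (by omega) (by omega) h1, hv.2⟩, fun hR => ?_⟩
    have h2 := (reach_ring hR).2.2.1
    have h3 := h1.2.2.2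
    omega
  have s3 : HR z (4 * y) (2 * y) \ Zb (Om z y m d) (bl z) k ⊆ S := fun v hv => by
    have h1 := HR_subset (by omega) (by omega) (by omega) hv.1
    refine ⟨⟨Om_mono le_rfl (by omega) (by omega) h1, hv.2⟩, fun hR => ?_⟩
    have h2 := (reach_ring hR).2.2.2
    have h3 := h1.2.2.1
    omega
  have s4 : Strip z y ⊆ S := fun v hv => by
    obtain ⟨h1, h2, h3, h4⟩ := hv
    refine ⟨⟨?_, fun hZ => ?_⟩, fun hR => ?_⟩
    · rw [mem_Om]; simp only [nm]; omega
    · have := (Zb_subset hk.1 hZ).2.1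
      omega
    · have := (reach_ring hR).2.1
      omega
  have dI := (dep_link_cl (Unr z y m d k \ Reach z y m d k) (inn z y m) (NReach z y m d k)).mono s1
  have dO := (dep_link_cl (Unr z y m d k \ Reach z y m d k) (NReach z y m d k) (far z d)).mono s1
  have dF1 := (dep_link_union (HR z y (2 * y)) (Zb (Om z y m d) (bl z) k) (bl z)
    (HE z y (2 * y))).mono s2
  have dF3 := (dep_link_union (HR z (4 * y) (2 * y)) (Zb (Om z y m d) (bl z) k) (bl z)
    (HE z (4 * y) (2 * y))).mono s3
  have dV := (dep_link_cl (Strip z y) {v | v.2 ≤ z.2 + y + 1} {v | z.2 + 8 * y ≤ v.2}).mono s4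
  refine ⟨(dI.inter dO).inter ((dF1.inter dF3).inter dV), ?_⟩
  have iI := (dec_link (Unr z y m d k \ Reach z y m d k) (inn z y m) (NReach z y m d k)).decOn univ
  have iO := (dec_link (Unr z y m d k \ Reach z y m d k) (NReach z y m d k) (far z d)).decOn univ
  have iF1 := (dec_link_union (HR z y (2 * y)) (Zb (Om z y m d) (bl z) k) (bl z)
    (HE z y (2 * y))).decOn univ
  have iF3 := (dec_link_union (HR z (4 * y) (2 * y)) (Zb (Om z y m d) (bl z) k) (bl z)
    (HE z (4 * y) (2 * y))).decOn univ
  have iV := (dec_link (Strip z y) {v | v.2 ≤ z.2 + y + 1} {v | z.2 + 8 * y ≤ v.2}).decOn univ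
  have q1 := harris_dec hSf iF1 iF3 dF1 (by rwa [inter_univ])
  have q2 := harris_dec hSf (iF1.inter iF3) iV (dF1.inter dF3) (by rwa [inter_univ])
  have q3 := harris_dec hSf (iI.inter iO) ((iF1.inter iF3).inter iV) (dI.inter dO)
    (by rw [inter_univ]; exact (dF1.inter dF3).inter dV)
  refine le_trans (mul_le_mul (Pr_mono fun ω hω => arm_pieces hy hmy hd hk hω) ?_ (by positivity)
    (Pr_nonneg _)) q3
  refine le_trans (mul_le_mul (le_trans (mul_le_mul ?_ ?_ hc0.le (Pr_nonneg _)) q1) hc' hc0'.le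
    (Pr_nonneg _)) q2
  · exact (hc z y (2 * y) hy (by omega) le_rfl).1.trans (Pr_mono fun ω hω =>
      Link.of_subset (inter_subset_inter_right _ subset_union_right) hω)
  · exact (hc z (4 * y) (2 * y) (by omega) (by omega) (by omega)).1.trans (Pr_mono fun ω hω =>
      Link.of_subset (inter_subset_inter_right _ subset_union_right) hω)

end

theorem ArmA_double : ∃ c : ℝ, 0 < c ∧ ∀ (z : Site) (y m d : ℤ), 1 ≤ y → 0 ≤ m → m ≤ y → 8 * y ≤ d →
    (1 + c) * Pr (ArmA z y m d) ≤ Pr (ArmA z (2 * y) m d) := by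
  classical
  obtain ⟨c, hc0, -, hc⟩ := half_arcs
  obtain ⟨c', hc0', hr⟩ := rsw 8
  refine ⟨c * c * c' * c, by positivity, fun z y m d hy hm hmy hd => ?_⟩
  have hc' := ((hr (z.1 + y + 1) (z.1 + 2 * y) (z.2 + y + 1) (z.2 + 8 * y) (by omega) (by omega)).2
    (by push_cast; omega)).2
  have hSf : (Om z (2 * y) m d).Finite := Om_finite _ _ _ _
  have hΩS : Om z y m d ⊆ Om z (2 * y) m d := Om_mono (by omega) le_rfl le_rfl
  have hHR : HR z (2 * y) y ⊆ Om z y (2 * y) (4 * y) :=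
    (HR_subset (by omega) (by omega) (by omega)).trans (Om_mono le_rfl le_rfl (by omega))
  have dB : ∀ k, Dep (Reach z y m d k) (Barrier z y m d k) := fun k =>
    (dep_link_union_op _ _ _ _).mono fun v hv => by simpa using hv.2
  let ok : Set Site → Prop := fun k => Seen (Om z y m d) (bl z) k ∧ ∀ v ∈ k, v.1 ≠ z.1 + y
  have key := explore_clus (c := c * c * c' * c) (Ω := Om z y m d) (S := Om z (2 * y) m d)
    (src := bl z) hΩS hSf
    (fun k => {_ω | ok k} ∩ {ω | Link (Unr z y m d k ∩ cl ω) (inn z y m) (far z d)})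
    (fun k => {_ω | ok k} ∩ (if ok k then Detour z y m d k ∩ Barrier z y m d k else ∅))
    (fun k _ => (dep_const _ _).inter ((dep_link_cl _ _ _).mono (sdiff_subset_sdiff_left hΩS)))
    ?_ ?_
  · have h1 : ArmA z y m d = {ω | ω ∈ {_ω : Config | ok (clus (Om z y m d) (bl z) ω)} ∩
        {ω' | Link (Unr z y m d (clus (Om z y m d) (bl z) ω) ∩ cl ω') (inn z y m) (far z d)}} := by
      ext ω
      constructor
      · intro h
        refine ⟨⟨seen_clus _ _ _, armA_clus (by omega) (by omega) (by omega) h⟩, ?_⟩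
        simp only [ArmA, FreeArm, Set.mem_ofPred_eq, free_eq] at h
        exact h
      · rintro ⟨-, h⟩
        simp only [ArmA, FreeArm, Set.mem_ofPred_eq, free_eq]
        exact h
    rw [← h1] at key
    have h2 : {ω | ω ∈ {_ω : Config | ok (clus (Om z y m d) (bl z) ω)} ∩
        (if ok (clus (Om z y m d) (bl z) ω) then Detour z y m d (clus (Om z y m d) (bl z) ω) ∩
          Barrier z y m d (clus (Om z y m d) (bl z) ω) else ∅)} ⊆
        ArmA z (2 * y) m d \ ArmA z y m d := by
      rintro ω ⟨h3, h4⟩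
      have h3' : ok (clus (Om z y m d) (bl z) ω) := h3
      rw [if_pos h3'] at h4
      exact ⟨detour_arm hy hm hmy hd h3'.2 h4.1, barrier_no_arm hy hmy hd h4.2⟩
    have h3 := key.trans (Pr_mono h2)
    have dA : Dep (Om z (2 * y) m d) (ArmA z (2 * y) m d \ ArmA z y m d) :=
      (freeArm_dep _ _ _ _).inter ((freeArm_dep _ _ _ _).mono hΩS).compl
    have h4 := Pr_union_add_inter hSf (A := ArmA z y m d) dA
    rw [inter_sdiff_self, Pr_empty, union_sdiff_self,
      union_eq_self_of_subset_left (ArmA_grow (by omega) (by omega) (by omega) (by omega))] at h4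
    linarith
  · intro k hk
    refine (dep_const _ _).inter ?_
    split_ifs with h
    · refine (((Pr_detour hc0 hc hc0' hc' hy hm hmy hd h.1).1.mono sdiff_subset).inter
        ((dB k).mono ?_))
      exact (reach_subset hy hmy hd).trans (sdiff_subset_sdiff_left hΩS)
    · exact dep_const _ False
  · intro k hk
    by_cases h : ok k
    · obtain ⟨d1, p1⟩ := Pr_detour hc0 hc hc0' hc' hy hm hmy hd h.1
      rw [if_pos h]
      have e1 : ∀ A : Set Config, {_ω : Config | ok k} ∩ A = A := fun A => by
        ext ω; exact ⟨fun hh => hh.2, fun hh => ⟨h, hh⟩⟩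
      rw [e1, e1, Pr_indep (hSf.subset (sdiff_subset.trans sdiff_subset)) disjoint_sdiff_left d1
        (dB k)]
      have p2 : c ≤ Pr (Barrier z y m d k) :=
        (hc z (2 * y) y (by omega) (by omega) (by omega)).2.trans (Pr_mono fun ω hω =>
          Link.of_subset (inter_subset_inter_right _ subset_union_right) hω)
      have := mul_le_mul p1 p2 hc0.le (Pr_nonneg _)
      linarith
    · have e1 : ∀ A : Set Config, {_ω : Config | ok k} ∩ A = ∅ := fun A => by
        ext ω; exact ⟨fun hh => h hh.1, fun hh => hh.elim⟩
      rw [e1, e1, Pr_empty]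
      simp

lemma ArmA_double_iter {c : ℝ} (hc : 0 < c) (h : ∀ (z : Site) (y m d : ℤ), 1 ≤ y → 0 ≤ m → m ≤ y →
    8 * y ≤ d → (1 + c) * Pr (ArmA z y m d) ≤ Pr (ArmA z (2 * y) m d)) (z : Site) {m d : ℤ}
    (hm : 1 ≤ m) (j : ℕ) (hj : m * 2 ^ j * 4 ≤ d) :
    (1 + c) ^ j * Pr (ArmA z m m d) ≤ Pr (ArmA z (m * 2 ^ j) m d) := by
  induction j with
  | zero => simp
  | succ j ih =>
    rw [pow_succ] at hj
    have h2 : (1 : ℤ) ≤ 2 ^ j := one_le_pow₀ (by norm_num)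
    have h3 : m ≤ m * 2 ^ j := by nlinarith
    have h1 := h z (m * 2 ^ j) m d (by omega) (by omega) h3 (by linarith)
    have h4 := mul_le_mul_of_nonneg_left (ih (by nlinarith)) (by positivity : 0 ≤ 1 + c)
    calc (1 + c) ^ (j + 1) * Pr (ArmA z m m d) = (1 + c) * ((1 + c) ^ j * Pr (ArmA z m m d)) := by
          ring
      _ ≤ (1 + c) * Pr (ArmA z (m * 2 ^ j) m d) := h4
      _ ≤ Pr (ArmA z (2 * (m * 2 ^ j)) m d) := h1
      _ = Pr (ArmA z (m * 2 ^ (j + 1)) m d) := by congr 2; ring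

/-- The arm at a corner has an exponent strictly larger than one. -/
theorem ArmA_corner : ∃ α C : ℝ, 0 < α ∧ 0 < C ∧ ∀ (z : Site) (m d : ℤ), 1 ≤ m → m ≤ d →
    Pr (ArmA z 0 m d) ≤ C * ((m : ℝ) / d) ^ (1 + α) := by
  obtain ⟨C, hC, hhalf⟩ := ArmA_half
  obtain ⟨c, hc, hdouble⟩ := ArmA_double
  set α := Real.logb 2 (1 + c) with hα
  have hα0 : 0 < α := Real.logb_pos (by norm_num) (by linarith)
  have h2α : (2 : ℝ) ^ α = 1 + c := Real.rpow_logb (by norm_num) (by norm_num) (by linarith)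
  refine ⟨α, max (4 ^ (1 + α)) (C * (1 + c) ^ 3), hα0, by positivity, fun z m d hm hmd => ?_⟩
  have hm0 : (0 : ℝ) < m := by exact_mod_cast hm
  have hd0 : (0 : ℝ) < d := by exact_mod_cast (by omega : 0 < d)
  have hmd' : (m : ℝ) ≤ d := by exact_mod_cast hmd
  obtain ⟨J, hJ1, hJ2⟩ := exists_nat_pow_near (x := (d : ℝ) / m) (y := 2)
    ((one_le_div hm0).2 hmd') (by norm_num)
  have hx : (m : ℝ) / d = ((d : ℝ) / m)⁻¹ := (inv_div _ _).symm
  have hx0 : 0 < (d : ℝ) / m := by positivity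
  by_cases hJ : J < 2
  · refine (Pr_le_one _).trans ?_
    have h4 : (1 : ℝ) / 4 ≤ (m : ℝ) / d := by
      have : (2 : ℝ) ^ (J + 1) ≤ 4 := by
        have : J + 1 ≤ 2 := by omega
        calc (2 : ℝ) ^ (J + 1) ≤ 2 ^ 2 := pow_le_pow_right₀ (by norm_num) this
          _ = 4 := by norm_num
      rw [hx, one_div]
      exact inv_anti₀ hx0 (by linarith)
    have h5 := Real.rpow_le_rpow (by norm_num) h4 (by positivity : 0 ≤ 1 + α)
    have h6 : (4 : ℝ) ^ (1 + α) * (1 / 4) ^ (1 + α) = 1 := by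
      rw [← Real.mul_rpow (by norm_num) (by norm_num)]; norm_num
    calc (1 : ℝ) = 4 ^ (1 + α) * (1 / 4) ^ (1 + α) := h6.symm
      _ ≤ _ := mul_le_mul (le_max_left _ _) h5 (by positivity) (by positivity)
  · obtain ⟨j, rfl⟩ : ∃ j, J = j + 2 := ⟨J - 2, by omega⟩
    have hj : m * 2 ^ j * 4 ≤ d := by
      rw [le_div_iff₀ hm0, pow_add] at hJ1
      have : ((m * 2 ^ j * 4 : ℤ) : ℝ) ≤ (d : ℤ) := by push_cast; linarith
      exact_mod_cast this
    have h2 : (1 : ℤ) ≤ 2 ^ j := one_le_pow₀ (by norm_num)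
    have h3 : m ≤ m * 2 ^ j := by nlinarith
    have p1 : Pr (ArmA z 0 m d) ≤ Pr (ArmA z m m d) :=
      Pr_mono (ArmA_grow le_rfl (by omega) (by omega) hmd)
    have p2 := ArmA_double_iter hc hdouble z hm j hj
    have p3 : Pr (ArmA z (m * 2 ^ j) m d) ≤ Pr (ArmA z d m d) :=
      Pr_mono (ArmA_grow (by omega) (by omega) (by omega) hmd)
    have p4 := hhalf z m d hm hmd
    have p5 : (1 + c) ^ j * Pr (ArmA z 0 m d) ≤ C * (m / d) :=
      (mul_le_mul_of_nonneg_left p1 (by positivity)).trans (p2.trans (p3.trans p4))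
    have p6 : ((d : ℝ) / m) ^ α ≤ (1 + c) ^ (j + 3) := by
      refine (Real.rpow_le_rpow hx0.le hJ2.le hα0.le).trans (le_of_eq ?_)
      rw [← h2α, ← Real.rpow_natCast, ← Real.rpow_natCast, ← Real.rpow_mul (by norm_num),
        ← Real.rpow_mul (by norm_num), mul_comm]
    have p7 : ((m : ℝ) / d) ^ (1 + α) * ((d : ℝ) / m) ^ α = m / d := by
      rw [Real.rpow_add (by positivity), Real.rpow_one, hx, Real.inv_rpow hx0.le]
      have : ((d : ℝ) / m) ^ α ≠ 0 := by positivity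
      field_simp
    have p8 : (m : ℝ) / d ≤ (m / d) ^ (1 + α) * ((1 + c) ^ 3 * (1 + c) ^ j) := by
      rw [← pow_add, add_comm 3 j]
      calc (m : ℝ) / d = ((m : ℝ) / d) ^ (1 + α) * ((d : ℝ) / m) ^ α := p7.symm
        _ ≤ _ := mul_le_mul_of_nonneg_left p6 (by positivity)
    have p9 : (0 : ℝ) < (1 + c) ^ j := by positivity
    have p10 : Pr (ArmA z 0 m d) ≤ C * (1 + c) ^ 3 * (m / d) ^ (1 + α) := by
      refine le_of_mul_le_mul_left ?_ p9
      calc _ ≤ C * (m / d) := p5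
        _ ≤ C * ((m / d) ^ (1 + α) * ((1 + c) ^ 3 * (1 + c) ^ j)) :=
          mul_le_mul_of_nonneg_left p8 hC.le
        _ = _ := by ring
    exact p10.trans (mul_le_mul_of_nonneg_right (le_max_right _ _) (by positivity))

/-- The horizontal line through `z`. -/
def row (z : Site) : Set Site := {v | v.2 = z.2}

/-- Closed arm in a half annulus not joined to the bottom boundary. -/
def ArmT (z : Site) (m d : ℤ) : Set Config :=
  FreeArm (Om z d m d) (row z) (inn z d m) (far z d)

/-- No closed arc in a half annulus. -/
def NoArc (z : Site) (m d : ℤ) : Set Config := {ω | Link (Om z d m d ∩ cl ω) (bl z) (br z)}ᶜ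

lemma noArc_mono {z : Site} {m m' d d' : ℤ} (hm : m ≤ m') (hd : d' ≤ d) :
    NoArc z m d ⊆ NoArc z m' d' := fun _ h h' =>
  h (h'.of_subset (inter_subset_inter_left _ (Om_mono hd hm hd)))

lemma Pr_noArc_pow {c : ℝ} (hc1 : c ≤ 1) (hc : ∀ (z : Site) (r : ℤ), 1 ≤ r →
    c ≤ Pr {ω | Link (Om z (2 * r) r (2 * r) ∩ cl ω) (bl z) (br z)}) (z : Site) {m : ℤ}
    (hm : 1 ≤ m) (J : ℕ) : Pr (NoArc z m (m * 2 ^ J)) ≤ (1 - c) ^ J := by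
  induction J with
  | zero => simpa using Pr_le_one _
  | succ J ih =>
    have h2 : (1 : ℤ) ≤ 2 ^ J := one_le_pow₀ (by norm_num)
    have h3 : m ≤ m * 2 ^ J := by nlinarith
    have h1 : NoArc z m (m * 2 ^ (J + 1)) ⊆
        NoArc z m (m * 2 ^ J) ∩ NoArc z (m * 2 ^ J) (2 * (m * 2 ^ J)) := fun ω h =>
      ⟨noArc_mono le_rfl (by rw [pow_succ]; linarith) h,
        noArc_mono h3 (by rw [pow_succ]; linarith) h⟩
    have dN : ∀ m d, Dep (Om z d m d) (NoArc z m d) := fun m d => (dep_link_cl _ _ _).compl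
    refine (Pr_mono h1).trans ?_
    rw [Pr_indep (Om_finite _ _ _ _) (disjoint_left.2 fun v hv hv' => ?_) (dN _ _) (dN _ _), pow_succ]
    · refine mul_le_mul ih ?_ (Pr_nonneg _) (pow_nonneg (by linarith) _)
      have := Pr_compl (Om_finite z (2 * (m * 2 ^ J)) (m * 2 ^ J) (2 * (m * 2 ^ J)))
        (dep_link_cl (Om z (2 * (m * 2 ^ J)) (m * 2 ^ J) (2 * (m * 2 ^ J))) (bl z) (br z))
      have := hc z (m * 2 ^ J) (by omega)
      simp only [NoArc]
      linarith
    · have := hv.2.2.2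
      have := hv'.2.2.1
      omega

lemma Pr_noArc : ∃ ε C : ℝ, 0 < ε ∧ 0 < C ∧ ∀ (z : Site) (m d : ℤ), 1 ≤ m → m ≤ d →
    Pr (NoArc z m d) ≤ C * ((m : ℝ) / d) ^ ε := by
  obtain ⟨c₀, hc0, -, hc⟩ := arcs
  set c := min c₀ (1 / 2) with hcdef
  have hcpos : 0 < c := lt_min hc0 (by norm_num)
  have hc1 : c ≤ 1 / 2 := min_le_right _ _
  set ε := -Real.logb 2 (1 - c) with hε
  have hε0 : 0 < ε := by
    have := Real.logb_neg (b := 2) (x := 1 - c) (by norm_num) (by linarith) (by linarith)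
    linarith
  have h2ε : (2 : ℝ) ^ (-ε) = 1 - c := by
    rw [hε, neg_neg]
    exact Real.rpow_logb (by norm_num) (by norm_num) (by linarith)
  refine ⟨ε, 2 ^ ε, hε0, by positivity, fun z m d hm hmd => ?_⟩
  have hm0 : (0 : ℝ) < m := by exact_mod_cast hm
  have hd0 : (0 : ℝ) < d := by exact_mod_cast (by omega : 0 < d)
  have hmd' : (m : ℝ) ≤ d := by exact_mod_cast hmd
  obtain ⟨J, hJ1, hJ2⟩ := exists_nat_pow_near (x := (d : ℝ) / m) (y := 2)
    ((one_le_div hm0).2 hmd') (by norm_num)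
  have hx : (m : ℝ) / d = ((d : ℝ) / m)⁻¹ := (inv_div _ _).symm
  have hx0 : 0 < (d : ℝ) / m := by positivity
  have hj : m * 2 ^ J ≤ d := by
    rw [le_div_iff₀ hm0] at hJ1
    have : ((m * 2 ^ J : ℤ) : ℝ) ≤ (d : ℤ) := by push_cast; linarith
    exact_mod_cast this
  have p1 := (Pr_mono (noArc_mono le_rfl hj)).trans (Pr_noArc_pow (by linarith)
    (fun z r hr => (min_le_left _ _).trans (hc z r hr).1) z hm J)
  refine p1.trans ?_
  have p2 : (1 - c) ^ J = 2 ^ ε * ((2 : ℝ) ^ (J + 1)) ^ (-ε) := by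
    rw [← h2ε, ← Real.rpow_natCast, ← Real.rpow_natCast, ← Real.rpow_mul (by norm_num),
      ← Real.rpow_mul (by norm_num), ← Real.rpow_add (by norm_num)]
    congr 1
    push_cast
    ring
  rw [p2, hx, Real.inv_rpow hx0.le, ← Real.rpow_neg hx0.le]
  exact mul_le_mul_of_nonneg_left (Real.rpow_le_rpow_of_nonpos hx0 hJ2.le (by linarith))
    (by positivity)

section
variable {z : Site} {m d : ℤ} {ω : Config}

lemma armT_split (h : ω ∈ ArmT z m d) :
    Link (free (Om z d m d \ Zb (Om z d m d) (br z) (clus (Om z d m d) (br z) ω)) (bl z) ω)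
      (inn z d m) (far z d) := by
  refine Link.of_subset ?_ h
  intro v hv
  have h1 : v ∈ free (Om z d m d) (br z) ω :=
    free_mono subset_rfl (fun x hx => hx.1) ⟨hv, hv.1.1⟩
  rw [free_eq] at h1
  exact free_mono sdiff_subset (fun x hx => hx.1) ⟨hv, h1.1⟩

lemma armT_noArc (hd : 0 ≤ d) (hm : m ≤ d) (h : ω ∈ ArmT z m d) : ω ∈ NoArc z m d := by
  rintro ⟨s, e, hs, he, h1⟩
  obtain ⟨t, f, ht, hf, h2⟩ := h
  obtain ⟨x, hx1, hx2⟩ := arch_meet hd le_rfl hm h1.comp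
    (fun x hx => (Con.right_mem hx).1) hs (Or.inl he) h2
    (fun x hx => Om_subset_Lam _ _ _ _ hx.1.1) ht hf
  exact hx2.2 ⟨s, hs.1, hx1⟩

lemma arm_off_right {k : Set Site} (hk : Seen (Om z d m d) (br z) k) (hd : 0 ≤ d)
    (hm : m ≤ d)
    (h : Link (free (Om z d m d \ Zb (Om z d m d) (br z) k) (bl z) ω)
      (inn z d m) (far z d)) : ω ∈ ArmA z d m d := by
  obtain ⟨t, f, ht, hf, h⟩ := h
  set Ω := Om z d m d with hΩ
  set Z := Zb Ω (br z) k with hZ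
  set D : Set Site := {x | Con (free (Ω \ Z) (bl z) ω) t x} with hD
  have hDsub : D ⊆ free (Ω \ Z) (bl z) ω := fun x hx => Con.right_mem hx
  have hDΩ : D ⊆ Ω := fun x hx => (hDsub hx).1.1.1
  have hZΩ : Z ⊆ Ω := Zb_subset hk.1
  refine ⟨t, f, ht, hf, h.comp.mono fun x hx => ⟨⟨hDΩ hx, (hDsub hx).1.2⟩, ?_⟩⟩
  rintro ⟨s, hs, hc⟩
  have hsD : s ∉ D := fun hsD => (hDsub hsD).2 (clus_src (hDsub hsD).1.1 hs hc.left_mem.2)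
  obtain ⟨w', w, h1, h2, -, h3⟩ := hc.enter hsD hx
  have key : ∀ v, Con ((Ω ∩ cl ω) \ D) s v → v ∉ Z := by
    intro v hv hvZ
    obtain ⟨e, he, hev⟩ := hk.2 v hvZ
    have hev' : Con (Ω \ D) v e := hev.symm.mono fun y hy => by
      rcases hy with hy | rfl
      · exact ⟨hk.1 hy, fun hyD => (hDsub hyD).1.1.2 (Or.inl hy)⟩
      · exact ⟨hZΩ hvZ, hv.right_mem.2⟩
    have hse : Con (Ω \ D) s e :=
      (hv.mono (sdiff_subset_sdiff_left inter_subset_left)).trans hev'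
    obtain ⟨x, hx1, hx2⟩ := arch_meet hd le_rfl hm hse (fun x hx => hx.1) hs (Or.inl he) h.comp
      (fun x hx => Om_subset_Lam _ _ _ _ (hDΩ hx)) ht hf
    exact hx1.2 hx2
  have h4 : Con ((Ω \ Z) ∩ cl ω) s w' := h1.comp.mono fun y hy =>
    ⟨⟨(Con.right_mem hy).1.1, key y hy⟩, (Con.right_mem hy).1.2⟩
  have h5 := hDsub h3
  exact h5.2 (clus_step ⟨s, hs, h4⟩ h5.1.1 h5.1.2 h2)

end

theorem Pr_armT_weak : ∃ ε C : ℝ, 0 < ε ∧ 0 < C ∧ ∀ (z : Site) (m d : ℤ), 1 ≤ m → m ≤ d →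
    Pr (ArmT z m d) ≤ C * ((m : ℝ) / d) ^ (1 + ε) := by
  obtain ⟨ε, C, hε, hC, hno⟩ := Pr_noArc
  obtain ⟨C', hC', hhalf⟩ := ArmA_half
  refine ⟨ε, C' * C, hε, by positivity, fun z m d hm hmd => ?_⟩
  have hm0 : (0 : ℝ) < m := by exact_mod_cast hm
  have hd0 : (0 : ℝ) < d := by exact_mod_cast (by omega : 0 < d)
  set Ω := Om z d m d with hΩ
  have hΩf : Ω.Finite := Om_finite _ _ _ _
  have hp : 0 < C' * ((m : ℝ) / d) := by positivity
  let ok : Set Site → Prop := fun k =>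
    Seen (Om z d m d) (br z) k ∧ ∀ s ∈ bl z, s ∉ k
  have key := explore_clus (c := (C' * ((m : ℝ) / d))⁻¹) (Ω := Ω) (S := Ω) (src := br z)
    subset_rfl hΩf
    (fun k => {_ω | ok k} ∩ {ω | Link (free (Ω \ Zb Ω (br z) k) (bl z) ω) (inn z d m) (far z d)})
    (fun k => {_ω | ok k}) (fun k _ => (dep_const _ _).inter (freeArm_dep _ _ _ _))
    (fun k _ => dep_const _ _) ?_
  · have h1 : ArmT z m d ⊆ {ω | ω ∈ {_ω : Config | ok (clus Ω (br z) ω)} ∩ {ω' | Link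
        (free (Ω \ Zb Ω (br z) (clus Ω (br z) ω)) (bl z) ω') (inn z d m) (far z d)}} := by
      intro ω h
      refine ⟨⟨seen_clus _ _ _, fun s hs hk => ?_⟩, armT_split h⟩
      obtain ⟨e, he, hc⟩ := hk
      exact armT_noArc (by omega) hmd h ⟨s, e, hs, he, hc.symm⟩
    have h2 : {ω | ω ∈ {_ω : Config | ok (clus Ω (br z) ω)}} ⊆ NoArc z m d := by
      rintro ω h ⟨s, e, hs, he, hc⟩
      exact h.2 s hs ⟨e, he, hc.symm⟩
    have h3 := ((mul_le_mul_of_nonneg_left (Pr_mono h1) (by positivity)).trans key).trans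
      ((Pr_mono h2).trans (hno z m d hm hmd))
    rw [inv_mul_le_iff₀ hp] at h3
    refine h3.trans (le_of_eq ?_)
    rw [Real.rpow_add (by positivity), Real.rpow_one]
    ring
  · intro k hk
    by_cases h : ok k
    · have e1 : {_ω : Config | ok k} = univ := by
        ext ω; exact ⟨fun _ => trivial, fun _ => h⟩
      rw [e1, univ_inter, Pr_univ, inv_mul_le_iff₀ hp, mul_one]
      have e2 : {ω | Link (free (Ω \ Zb Ω (br z) k) (bl z) ω) (inn z d m) (far z d)} ⊆ ArmA z d m d := by
        exact fun ω hω => arm_off_right h.1 (by omega) hmd hω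
      exact (Pr_mono e2).trans (hhalf z m d hm hmd)
    · have e1 : ∀ A : Set Config, {_ω : Config | ok k} ∩ A = ∅ := fun A => by
        ext ω; exact ⟨fun hh => h hh.1, fun hh => hh.elim⟩
      rw [e1, Pr_empty, mul_zero]
      exact Pr_nonneg _

/-- Closed arm in a half annulus not joined to the bottom boundary inside the half box. -/
def ArmS (z : Site) (m d : ℤ) : Set Config :=
  {ω | Link (Om z d (2 * m) d ∩ free (Lam z d d) (row z) ω) (inn z d (2 * m)) (far z d)}

/-- Closed arm in a half annulus not joined to the bottom boundary inside a larger half annulus. -/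
def ArmR (z : Site) (m d : ℤ) : Set Config :=
  {ω | Link (Om z d (2 * m) d ∩ free (Om z d m d) (row z) ω) (inn z d (2 * m)) (far z d)}

section
variable {z : Site} {m d : ℤ} {ω : Config}

lemma armT_subset_armR (hm : 1 ≤ m) (hd : 2 * m < d) : ArmT z m d ⊆ ArmR z m d := by
  rintro ω ⟨t, f, ht, hf, h⟩
  exact (arm_restrict h (fun x hx => hx.1.1) ht hf (by omega) le_rfl hd).of_subset
    fun x hx => ⟨hx.2, hx.1⟩

lemma armR_incOn : IncOn (Om z (2 * m) m (2 * m)) (ArmR z m d) := by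
  intro ω ω' h1 h2 h
  have hcl : cl ω' ⊆ cl ω := fun v hv => by
    by_contra hc
    have hv' : ω' v = false := hv
    have hc' : ω v = true := by simpa [mem_cl] using hc
    by_cases hX : v ∈ Om z (2 * m) m (2 * m)
    · rw [h1 v hX hc'] at hv'; exact absurd hv' (by simp)
    · rw [← h2 v hX, hc'] at hv'; exact absurd hv' (by simp)
  refine Link.of_subset ?_ h
  rintro v ⟨hv1, ⟨⟨hv2, hv3⟩, hv4⟩⟩
  refine ⟨hv1, ⟨hv2, ?_⟩, fun ⟨s, hs, hc⟩ => hv4 ⟨s, hs, hc.mono (inter_subset_inter_right _ hcl)⟩⟩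
  have hX : v ∉ Om z (2 * m) m (2 * m) := fun hX => by
    have := hX.2.2.2
    have := hv1.2.2.1
    omega
  rw [mem_cl, ← h2 v hX]
  exact hv3

lemma armR_armS (hm : 1 ≤ m) (hd : 2 * m ≤ d) (h : ω ∈ ArmR z m d)
    (ha : Link (Om z (2 * m) m (2 * m) ∩ op ω) (bl z) (br z)) : ω ∈ ArmS z m d := by
  refine Link.of_subset ?_ h
  rintro v ⟨hv1, ⟨⟨hv2, hv3⟩, hv4⟩⟩
  refine ⟨hv1, ⟨Om_subset_Lam _ _ _ _ hv1, hv3⟩, ?_⟩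
  rintro ⟨s, hs, hc⟩
  by_cases hlow : ∃ y, Con (Lam z d d ∩ cl ω) s y ∧ nm z y ≤ m
  · obtain ⟨y, hy, hym⟩ := hlow
    have hv5 := hv1.2.2.1
    obtain ⟨w, hw, h1⟩ := (hy.symm.trans hc).hit (nm z) (fun a b hab => (nm_step _ hab).1)
      (c := 2 * m) (by omega) (by omega)
    refine crossHA_no_arc hm ⟨y, w, hym, hw.ge, h1.mono ?_⟩ ha
    rintro x ⟨⟨⟨hx1, -, -⟩, hx2⟩, hx3⟩
    have hx3' : nm z x ≤ 2 * m := hx3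
    refine ⟨⟨hx1, ?_, hx3⟩, hx2⟩
    simp only [nm] at hx3'
    omega
  · push Not at hlow
    refine hv4 ⟨s, hs, hc.comp.mono fun x hx => ?_⟩
    have hx1 := (Con.right_mem hx).1
    exact ⟨⟨hx1.1, hx1.2.1, hlow x hx, hx1.2.2⟩, (Con.right_mem hx).2⟩

end

lemma armS_dep (z : Site) (m d : ℤ) : Dep (Lam z d d) (ArmS z m d) := fun ω ω' h => by
  simp only [ArmS, free, Set.mem_ofPred_eq, clus_congr h, inter_cl_congr h]

lemma armR_dep {z : Site} {m d : ℤ} : Dep (Om z d m d) (ArmR z m d) := fun ω ω' h => by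
  simp only [ArmR, free, Set.mem_ofPred_eq, clus_congr h, inter_cl_congr h]

/-- Passing from a half annulus to a half box costs a constant factor. -/
lemma Pr_armT_le_armS : ∃ c : ℝ, 0 < c ∧ ∀ (z : Site) (m d : ℤ), 1 ≤ m → 2 * m < d →
    c * Pr (ArmT z m d) ≤ Pr (ArmS z m d) := by
  obtain ⟨c, hc0, -, hc⟩ := arcs
  refine ⟨c, hc0, fun z m d hm hd => ?_⟩
  set B := {ω | Link (Om z (2 * m) m (2 * m) ∩ op ω) (bl z) (br z)} with hB
  have hsub : Om z (2 * m) m (2 * m) ⊆ Om z d m d := Om_mono (by omega) le_rfl (by omega)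
  have h1 := harris (Om_finite z d m d) (armR_incOn (z := z) (m := m) (d := d))
    (B := B) ((inc_link _ _ _).incOn _) armR_dep
    ((dep_link_op _ _ _).mono fun v hv => ⟨hsub hv, hv⟩)
  have h2 : ArmR z m d ∩ B ⊆ ArmS z m d := fun ω hω => armR_armS hm hd.le hω.1 hω.2
  calc c * Pr (ArmT z m d) ≤ Pr B * Pr (ArmR z m d) :=
        mul_le_mul (hc z m hm).2 (Pr_mono (armT_subset_armR hm hd)) (Pr_nonneg _) (Pr_nonneg _)
    _ ≤ Pr (ArmS z m d) := by rw [mul_comm]; exact h1.trans (Pr_mono h2)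

lemma inn_cut {z : Site} {y y' m : ℤ} (h : m ≤ y') : inn z y m ⊆ inn z y' m := by
  rintro v ⟨w, ⟨h1, h2, h3⟩, hw⟩
  refine ⟨w, ⟨h1, ?_, h3⟩, hw⟩
  simp only [nm] at h3
  omega

lemma Om_cut {z : Site} {y y' m d : ℤ} (h : d ≤ y') : Om z y m d ⊆ Om z y' m d := by
  rintro v ⟨h1, h2, h3, h4⟩
  refine ⟨h1, ?_, h3, h4⟩
  simp only [nm] at h4
  omega

lemma armT_mono {z : Site} {m m' d d' : ℤ} (hm : m ≤ m') (hd : d' ≤ d) (hmd : m' < d') :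
    ArmT z m d ⊆ ArmT z m' d' := by
  rintro ω ⟨t, f, ht, hf, h⟩
  obtain ⟨t', f', ht', hf', h'⟩ := arm_restrict h (fun x hx => hx.1.1) ht hf hm hd hmd
  refine ⟨t', f', inn_cut hmd.le ht', hf', h'.mono ?_⟩
  exact fun x hx => free_mono (Om_mono hd hm hd) subset_rfl ⟨hx.1, Om_cut le_rfl hx.2⟩

lemma armS_subset_armT {z : Site} {m d : ℤ} : ArmS z m d ⊆ ArmT z (2 * m) d := by
  rintro ω ⟨t, f, ht, hf, h⟩
  exact ⟨t, f, ht, hf, h.mono fun x hx => free_mono (Om_subset_Lam _ _ _ _) subset_rfl ⟨hx.2, hx.1⟩⟩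

lemma armS_mono {z : Site} {m d d' : ℤ} (hd : d' ≤ d) (hm : 2 * m < d') :
    ArmS z m d ⊆ ArmS z m d' := by
  rintro ω ⟨t, f, ht, hf, h⟩
  obtain ⟨t', f', ht', hf', h'⟩ := arm_restrict h (fun x hx => hx.1) ht hf le_rfl hd hm
  refine ⟨t', f', inn_cut hm.le ht', hf', h'.mono ?_⟩
  rintro x ⟨⟨hx1, hx2⟩, hx3⟩
  have hx4 : x ∈ Om z d' (2 * m) d' := Om_cut le_rfl hx3
  exact ⟨hx4, free_mono (Lam_mono hd hd) subset_rfl ⟨hx2, Om_subset_Lam _ _ _ _ hx4⟩⟩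

lemma row_trl (w z : Site) : trl w ⁻¹' row (trl w z) = row z := by
  ext v; simp only [mem_preimage, row, trl_apply, Set.mem_ofPred_eq]; omega

lemma mem_armS_trl (w z : Site) (m d : ℤ) (ω : Config) :
    (fun v => ω (trl w v)) ∈ ArmS z m d ↔ ω ∈ ArmS (trl w z) m d := by
  have h := free_preimage_trl w (Lam (trl w z) d d) (row (trl w z)) ω
  rw [Lam_trl, row_trl] at h
  simp only [ArmS, Set.mem_ofPred_eq, h]
  rw [← Om_trl w, ← inn_trl w, ← far_trl w, ← preimage_inter, link_preimage_trl]

lemma Pr_armT_trl (z z' : Site) (m d : ℤ) : Pr (ArmT z m d) = Pr (ArmT z' m d) := by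
  obtain ⟨w, rfl⟩ : ∃ w, trl w z = z' := ⟨_, trl_sub z z'⟩
  have := Pr_freeArm_trl w (Om (trl w z) d m d) (row (trl w z)) (inn (trl w z) d m) (far (trl w z) d)
  rw [Om_trl, row_trl, inn_trl, far_trl] at this
  exact this

/-- Some base point of a horizontal segment has an arm. -/
def RowArm (z : Site) (m d : ℤ) (N : ℕ) : Set Config :=
  {ω | ∃ i < N, ω ∈ ArmS (z.1 + m * i, z.2) m d}

lemma Pr_rowArm_trl (z z' : Site) (m d : ℤ) (N : ℕ) :
    Pr (RowArm z m d N) = Pr (RowArm z' m d N) := by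
  obtain ⟨w, rfl⟩ : ∃ w, trl w z = z' := ⟨_, trl_sub z z'⟩
  rw [← Pr_reindex (trl w) (RowArm z m d N)]
  congr 1
  ext ω
  simp only [RowArm, mem_preimage, Set.mem_ofPred_eq]
  refine exists_congr fun i => and_congr_right fun _ => ?_
  refine (mem_armS_trl w _ m d ω).trans ?_
  rw [show trl w (z.1 + m * i, z.2) = ((trl w z).1 + m * i, (trl w z).2) by
    simp only [trl_apply, Prod.mk.injEq, and_true]; ring]

lemma rowArm_dep (z : Site) (m d : ℤ) (N : ℕ) :
    Dep (⋃ i ∈ Finset.range N, Lam (z.1 + m * i, z.2) d d) (RowArm z m d N) := by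
  refine dep_of_imp ?_
  rintro ω ω' h ⟨i, hi, hω⟩
  refine ⟨i, hi, ?_⟩
  have h1 : Dep (⋃ i ∈ Finset.range N, Lam (z.1 + m * i, z.2) d d)
      (ArmS (z.1 + m * i, z.2) m d) := (armS_dep _ m d).mono
    (subset_biUnion_of_mem (u := fun i : ℕ => Lam (z.1 + m * i, z.2) d d)
      (Finset.mem_coe.2 (Finset.mem_range.2 hi)))
  exact (h1 ω ω' h).1 hω

lemma rowArm_disjOcc {m r : ℤ} {N : ℕ} (hm : 1 ≤ m) (hN : 4 * (m * N) ≤ r) {ω : Config}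
    {G : Finset ℕ} (hG : G ⊆ Finset.range N)
    (h : ∀ k ∈ G, ω ∈ RowArm (0, 4 * m * k) m (3 * r) N) :
    ω ∈ DisjOcc (CrossHA (0, 0) r) G.card := by
  classical
  choose! i hi h using h
  set Z : ℕ → Site := fun k => (m * (i k : ℤ), 4 * (m * (k : ℤ))) with hZ
  have hZb : ∀ k ∈ G, 0 ≤ (Z k).1 ∧ (Z k).1 + 4 * m ≤ r ∧ 0 ≤ (Z k).2 ∧ (Z k).2 + 4 * m ≤ r := by
    intro k hk
    have h1 : (k : ℤ) + 1 ≤ N := by exact_mod_cast Finset.mem_range.1 (hG hk)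
    have h2 : (i k : ℤ) + 1 ≤ N := by exact_mod_cast hi k hk
    have h3 : m * (k : ℤ) + m ≤ m * N := by nlinarith
    have h4 : m * (i k : ℤ) + m ≤ m * N := by nlinarith
    have h5 : 0 ≤ m * (k : ℤ) := by positivity
    have h6 : 0 ≤ m * (i k : ℤ) := by positivity
    simp only [hZ]
    omega
  have h' : ∀ k ∈ G, Link (Om (Z k) (3 * r) (2 * m) (3 * r) ∩
      free (Lam (Z k) (3 * r) (3 * r)) (row (Z k)) ω) (inn (Z k) (3 * r) (2 * m)) (far (Z k) (3 * r)) := by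
    intro k hk
    have := h k hk
    rw [show ((((0 : ℤ), 4 * m * (k : ℤ)) : Site).1 + m * (i k : ℤ),
      (((0 : ℤ), 4 * m * (k : ℤ)) : Site).2) = Z k by
        simp only [hZ, zero_add, Prod.mk.injEq, true_and]; ring] at this
    exact this
  choose! t f ht hf h' using h'
  set P : ℕ → Set Site := fun k =>
    (Lam (0, 0) (2 * r) (2 * r) ∩ cl ω) ∩ free (Lam (Z k) (3 * r) (3 * r)) (row (Z k)) ω with hP
  have htn : ∀ k ∈ G, nm (0, 0) (t k) ≤ r ∧ (t k).2 < (Z k).2 + 4 * m := by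
    intro k hk
    have h1 := inn_nm (ht k hk)
    obtain ⟨h2, h3, h4, h5⟩ := hZb k hk
    simp only [nm] at h1 ⊢
    generalize Z k = w at *
    omega
  have hlink : ∀ k ∈ G, ∃ w, 2 * r ≤ nm (0, 0) w ∧ Con (P k) (t k) w := by
    intro k hk
    have h1 : 3 * r ≤ nm (Z k) (f k) := hf k hk
    obtain ⟨h2, h3, h4, h5⟩ := hZb k hk
    obtain ⟨w, hw, h6⟩ := (h' k hk).hit (nm (0, 0)) (fun a b hab => (nm_step _ hab).1) (c := 2 * r)
      (by have := (htn k hk).1; omega) (by simp only [nm] at h1 ⊢; omega)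
    refine ⟨w, hw.ge, h6.mono ?_⟩
    rintro x ⟨⟨hx1, hx2⟩, hx3⟩
    refine ⟨⟨⟨?_, ?_, hx3⟩, hx2.1.2⟩, hx2⟩
    · have := hx1.1
      simp only; omega
    · simp only [nm, Set.mem_ofPred_eq] at hx3
      simp only; omega
  refine exists_disjOcc (fun k => {x | Con (P k) (t k) x})
    (fun k _ v hv => (Con.right_mem hv).1.2) ?_ ?_
  · have key : ∀ k ∈ G, ∀ l ∈ G, k < l → Disjoint {x | Con (P k) (t k) x} {x | Con (P l) (t l) x} := by
      intro k hk l hl hkl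
      rw [Set.disjoint_left]
      intro x hx1 hx2
      have hxl := (Con.right_mem hx2).2
      have hkl' : (Z k).2 + 4 * m ≤ (Z l).2 := by
        have : (k : ℤ) + 1 ≤ l := by exact_mod_cast hkl
        simp only [hZ]; nlinarith
      have hxl2 : (Z l).2 ≤ x.2 := hxl.1.1.1
      have htk := (htn k hk).2
      obtain ⟨w, hw, h1⟩ := (Con.symm hx1).hit (fun v => -v.2)
        (fun a b hab => by have := adj_bound hab; omega) (c := -(Z l).2) (by omega) (by omega)
      refine hxl.2 ⟨w, by simp only [row, Set.mem_ofPred_eq]; omega, h1.symm.mono ?_⟩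
      rintro v ⟨⟨⟨hv1, hv2⟩, -⟩, hv3⟩
      obtain ⟨h2, h3, h4, h5⟩ := hZb l hl
      have hv4 := hv1.2.2
      simp only [nm, Set.mem_ofPred_eq] at hv3 hv4
      refine ⟨⟨by omega, by omega, ?_⟩, hv2⟩
      simp only [nm]
      omega
    intro k hk l hl hkl
    rcases lt_or_gt_of_ne hkl with h | h
    · exact key k hk l hl h
    · exact (key l hl k hk h).symm
  · intro k hk ω' hω'
    obtain ⟨w, hw, hc⟩ := hlink k hk
    exact link_of_closed ⟨_, _, (htn k hk).1, hw, hc.comp⟩ (fun x hx => (Con.right_mem hx).1.1) hω'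

/-- The probability that some base point of a segment has an arm. -/
theorem Pr_rowArm : ∃ C : ℝ, 0 < C ∧ ∀ (z : Site) (m d : ℤ) (N : ℕ), 1 ≤ m → 1 ≤ N →
    12 * (m * N) ≤ d → N * Pr (RowArm z m d N) ≤ C := by
  obtain ⟨c, hc0, hc1, hc⟩ := arcs
  have hop := fun z r hr => (hc z r hr).2
  refine ⟨(1 - c) / (1 - (1 - c)) + 1, ?_, fun z m d N hm hN1 hN => ?_⟩
  · have : 0 ≤ (1 - c) / (1 - (1 - c)) := div_nonneg (by linarith) (by linarith)
    linarith
  set r := 4 * (m * (N : ℤ)) with hr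
  have hmN : 1 ≤ m * (N : ℤ) := by
    have : (1 : ℤ) ≤ N := by exact_mod_cast hN1
    nlinarith
  have h1 : RowArm z m d N ⊆ RowArm z m (3 * r) N := by
    rintro ω ⟨i, hi, h⟩
    have : m * 1 ≤ m * (N : ℤ) := mul_le_mul_of_nonneg_left (by exact_mod_cast hN1) (by omega)
    exact ⟨i, hi, armS_mono (by omega) (by omega) h⟩
  have h2 : ∑ k ∈ Finset.range N, Pr (RowArm (0, 4 * m * k) m (3 * r) N) ≤ (1 - c) / (1 - (1 - c)) := by
    refine sum_Pr_le_of_tail (Finset.range N) (S := ⋃ k ∈ Finset.range N, ⋃ i ∈ Finset.range N,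
      Lam ((((0 : ℤ), 4 * m * (k : ℤ)) : Site).1 + m * i, (((0 : ℤ), 4 * m * (k : ℤ)) : Site).2) (3 * r) (3 * r))
        ?_ (fun k => RowArm (0, 4 * m * k) m (3 * r) N) ?_ (by linarith) (by linarith) ?_
    · exact Set.Finite.biUnion (Finset.finite_toSet _) fun k _ =>
        Set.Finite.biUnion (Finset.finite_toSet _) fun i _ => Lam_finite _ _ _
    · intro k hk
      exact (rowArm_dep _ _ _ _).mono (subset_biUnion_of_mem (u := fun k : ℕ =>
        ⋃ i ∈ Finset.range N, Lam ((((0 : ℤ), 4 * m * (k : ℤ)) : Site).1 + m * i,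
          (((0 : ℤ), 4 * m * (k : ℤ)) : Site).2) (3 * r) (3 * r)) (Finset.mem_coe.2 hk))
    · intro k
      refine le_trans (Pr_mono ?_) ((Pr_disjOcc_le (S := Lam (0, 0) (2 * r) (2 * r)) (Lam_finite _ _ _)
        (dec_link _ _ _) (dep_link_cl _ _ _) k).trans
        (pow_le_pow_left₀ (Pr_nonneg _) (Pr_crossHA_le hop (0, 0) (r := r) (by omega)) k))
      rintro ω ⟨G, hG, rfl, h⟩
      exact rowArm_disjOcc hm le_rfl hG h
  have h3 : ∑ k ∈ Finset.range N, Pr (RowArm (0, 4 * m * k) m (3 * r) N) =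
      N * Pr (RowArm z m (3 * r) N) := by
    have : ∀ k ∈ Finset.range N, Pr (RowArm (0, 4 * m * (k : ℤ)) m (3 * r) N) =
        Pr (RowArm z m (3 * r) N) := fun k _ => Pr_rowArm_trl _ _ _ _ _
    rw [Finset.sum_congr rfl this, Finset.sum_const, Finset.card_range, nsmul_eq_mul]
  have h4 := mul_le_mul_of_nonneg_left (Pr_mono h1) (Nat.cast_nonneg (α := ℝ) N)
  linarith

/-- Expected number of events in a family, in terms of the probability of their union and of the
pairs of events at distance at least `R`. -/
lemma sum_Pr_le_union_add_pairs {S : Set Site} (hS : S.Finite) (A : ℕ → Set Config) (N R : ℕ)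
    (hR : 1 ≤ R) (hA : ∀ i < N, Dep S (A i)) :
    ∑ i ∈ Finset.range N, Pr (A i) ≤ R * Pr {ω | ∃ i < N, ω ∈ A i} +
      ∑ i ∈ Finset.range N, Pr (A i ∩ {ω | ∃ i', i' + R ≤ i ∧ ω ∈ A i'}) := by
  classical
  set Q : ℕ → Set Config := fun i => {ω | ∃ i', i' + R ≤ i ∧ ω ∈ A i'} with hQ
  have dQ : ∀ i < N, Dep S (Q i) := fun i hi => dep_of_imp fun ω ω' h ⟨i', h1, h2⟩ =>
    ⟨i', h1, ((hA i' (by omega)) ω ω' h).1 h2⟩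
  have h1 : ∀ i ∈ Finset.range N, Pr (A i) ≤ Pr (A i ∩ (Q i)ᶜ) + Pr (A i ∩ Q i) := fun i _ =>
    (Pr_mono fun ω hω => by
      by_cases h : ω ∈ Q i
      · exact Or.inr ⟨hω, h⟩
      · exact Or.inl ⟨hω, h⟩).trans (Pr_union_le _ _)
  refine (Finset.sum_le_sum h1).trans ?_
  rw [Finset.sum_add_distrib]
  refine add_le_add ?_ le_rfl
  have h2 : ∑ i ∈ Finset.range N, Pr (A i ∩ (Q i)ᶜ) =
      ∑ ρ ∈ Finset.range R, ∑ i ∈ Finset.range N with i % R = ρ, Pr (A i ∩ (Q i)ᶜ) :=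
    (Finset.sum_fiberwise_of_maps_to (fun i _ => Finset.mem_range.2 (Nat.mod_lt i hR)) _).symm
  rw [h2]
  have h3 : ∀ ρ ∈ Finset.range R, ∑ i ∈ Finset.range N with i % R = ρ, Pr (A i ∩ (Q i)ᶜ) ≤
      Pr {ω | ∃ i < N, ω ∈ A i} := by
    intro ρ _
    have h4 : Pr (⋃ i ∈ (Finset.range N).filter (fun i => i % R = ρ), A i ∩ (Q i)ᶜ) =
        ∑ i ∈ Finset.range N with i % R = ρ, Pr (A i ∩ (Q i)ᶜ) := by
      refine measureReal_biUnion_finset ?_ fun i hi => ?_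
      · have key : ∀ i i', i % R = ρ → i' % R = ρ → i < i' →
            Disjoint (A i ∩ (Q i)ᶜ) (A i' ∩ (Q i')ᶜ) := by
          intro i i' hi hi' hlt
          rw [Set.disjoint_left]
          rintro ω ⟨h5, -⟩ ⟨-, h6⟩
          refine h6 ⟨i, ?_, h5⟩
          have h7 : R ∣ i' - i := (Nat.modEq_iff_dvd' hlt.le).1 (hi.trans hi'.symm)
          have := Nat.le_of_dvd (by omega) h7
          omega
        intro i hi i' hi' hne
        rw [Finset.mem_coe, Finset.mem_filter] at hi hi'
        rcases lt_or_gt_of_ne hne with h | h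
        · exact key i i' hi.2 hi'.2 h
        · exact (key i' i hi'.2 hi.2 h).symm
      · have hi' := Finset.mem_range.1 (Finset.mem_filter.1 hi).1
        exact ((hA i hi').inter (dQ i hi').compl).measurableSet hS
    rw [← h4]
    refine Pr_mono fun ω hω => ?_
    simp only [mem_iUnion] at hω
    obtain ⟨i, hi, h5⟩ := hω
    exact ⟨i, Finset.mem_range.1 (Finset.mem_filter.1 hi).1, h5.1⟩
  refine (Finset.sum_le_sum h3).trans ?_
  rw [Finset.sum_const, Finset.card_range, nsmul_eq_mul]

lemma Pr_far_left {C : ℝ} (hC : ∀ (z : Site) (m d : ℤ) (N : ℕ), 1 ≤ m → 1 ≤ N →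
    12 * (m * N) ≤ d → N * Pr (RowArm z m d N) ≤ C) {m : ℤ} {K : ℕ} (i : ℕ) (hm : 1 ≤ m)
    (hK : 1 ≤ K) : K * Pr {ω | ∃ i' : ℕ, i' + 64 * K ≤ i ∧ i < i' + 128 * K ∧
      ω ∈ ArmS (m * (i' : ℤ), 0) m (16 * (m * K))} ≤ 65 * C := by
  have h1 : {ω | ∃ i' : ℕ, i' + 64 * K ≤ i ∧ i < i' + 128 * K ∧
      ω ∈ ArmS (m * (i' : ℤ), 0) m (16 * (m * K))} ⊆
      ⋃ b ∈ Finset.range 65, RowArm (m * ((i : ℤ) - 128 * K + b * K), 0) m (16 * (m * K)) K := by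
    rintro ω ⟨i', h1, h2, h3⟩
    have h4 := Nat.div_add_mod (i' + 128 * K - i) K
    have h5 := Nat.mod_lt (i' + 128 * K - i) hK
    set b := (i' + 128 * K - i) / K
    set s := (i' + 128 * K - i) % K
    have h6 : b < 65 := by
      by_contra hb
      have : K * 65 ≤ K * b := Nat.mul_le_mul_left _ (by omega)
      omega
    simp only [mem_iUnion]
    refine ⟨b, Finset.mem_range.2 h6, s, h5, ?_⟩
    have h7 : ((i : ℤ) - 128 * K + b * K) + s = i' := by
      have : (K : ℤ) * b + s = i' + 128 * K - i := by
        have h8 : K * b + s + i = i' + 128 * K := by omega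
        have h9 : (K : ℤ) * b + s + i = i' + 128 * K := by exact_mod_cast h8
        linarith
      linarith
    simp only [← mul_add, h7]
    exact h3
  have h2 := (Pr_mono h1).trans (Pr_biUnion_le _ _)
  have h3 : ∀ b ∈ Finset.range 65, (K : ℝ) *
      Pr (RowArm (m * ((i : ℤ) - 128 * K + b * K), 0) m (16 * (m * K)) K) ≤ C := fun b _ =>
    hC _ _ _ _ hm hK (by have : (0 : ℤ) ≤ m * K := by positivity
                         omega)
  have h4 := Finset.sum_le_sum h3
  rw [← Finset.mul_sum, Finset.sum_const, Finset.card_range, nsmul_eq_mul] at h4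
  exact (mul_le_mul_of_nonneg_left h2 (Nat.cast_nonneg K)).trans (by exact_mod_cast h4)

lemma Pr_pair : ∃ ε C : ℝ, 0 < ε ∧ 0 < C ∧ ∀ (m d : ℤ) (K i : ℕ), 1 ≤ m → 1 ≤ K →
    256 * (m * K) < d → Pr (ArmS (m * (i : ℤ), 0) m d ∩
      {ω | ∃ i' : ℕ, i' + 64 * K ≤ i ∧ i < i' + 128 * K ∧ ω ∈ ArmS (m * (i' : ℤ), 0) m d}) ≤
      C * (1 / (K : ℝ)) ^ (2 + ε) * Pr (ArmT (0, 0) (256 * (m * K)) d) := by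
  obtain ⟨ε, C₁, hε, hC₁, hweak⟩ := Pr_armT_weak
  obtain ⟨C₂, hC₂, hrow⟩ := Pr_rowArm
  refine ⟨ε, C₁ * (65 * C₂), hε, by positivity, fun m d K i hm hK hd => ?_⟩
  have hmK : m ≤ m * K := by
    have : (1 : ℤ) ≤ K := by exact_mod_cast hK
    nlinarith
  set q := m * (K : ℤ) with hq
  set x : Site := (m * (i : ℤ), 0) with hx
  set F : Set Config := {ω | ∃ i' : ℕ, i' + 64 * K ≤ i ∧ i < i' + 128 * K ∧
      ω ∈ ArmS (m * (i' : ℤ), 0) m (16 * q)} with hF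
  have hsub : ArmS x m d ∩ {ω | ∃ i' : ℕ, i' + 64 * K ≤ i ∧ i < i' + 128 * K ∧
      ω ∈ ArmS (m * (i' : ℤ), 0) m d} ⊆ ArmT x (2 * m) (16 * q) ∩ (ArmT x (256 * q) d ∩ F) := by
    rintro ω ⟨h1, i', h2, h3, h4⟩
    have h5 := armS_subset_armT h1
    exact ⟨armT_mono le_rfl (by omega) (by omega) h5, armT_mono (by omega) le_rfl hd h5,
      i', h2, h3, armS_mono (by omega) (by omega) h4⟩
  have dF : Dep {v | v.1 < x.1 - 32 * q ∧ nm x v ≤ 200 * q} F := by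
    refine dep_of_imp ?_
    rintro ω ω' h ⟨i', h2, h3, h4⟩
    refine ⟨i', h2, h3, ?_⟩
    refine ((armS_dep _ m (16 * q)) ω ω' fun v hv => h v ?_).1 h4
    have e1 : m * (i' : ℤ) + 64 * q ≤ m * i := by
      have : ((i' : ℤ) + 64 * K) ≤ i := by exact_mod_cast h2
      have := mul_le_mul_of_nonneg_left this (by omega : 0 ≤ m)
      linarith
    have e2 : m * (i : ℤ) ≤ m * i' + 128 * q := by
      have : (i : ℤ) ≤ (i' : ℤ) + 128 * K := by exact_mod_cast h3.le
      have := mul_le_mul_of_nonneg_left this (by omega : 0 ≤ m)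
      linarith
    obtain ⟨v1, v2, v3⟩ := hv
    simp only [nm] at v1 v2 v3
    simp only [Set.mem_ofPred_eq, nm, hx]
    generalize m * (i : ℤ) = a at *
    generalize m * (i' : ℤ) = b at *
    omega
  have d1 : Dep (Om x (16 * q) (2 * m) (16 * q)) (ArmT x (2 * m) (16 * q)) := freeArm_dep _ _ _ _
  have d3 : Dep (Om x d (256 * q) d) (ArmT x (256 * q) d) := freeArm_dep _ _ _ _
  refine (Pr_mono hsub).trans ?_
  rw [Pr_indep (Om_finite _ _ _ _) ?_ d1 ((d3.mono subset_union_left).inter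
    (dF.mono subset_union_right)), Pr_indep (Om_finite _ _ _ _) ?_ d3 dF]
  · have p1 := hweak x (2 * m) (16 * q) (by omega) (by omega)
    have p2 : K * Pr F ≤ 65 * C₂ := Pr_far_left hrow i hm hK
    have hK0 : (0 : ℝ) < K := by exact_mod_cast hK
    have hm0 : (0 : ℝ) < m := by exact_mod_cast hm
    have p3 : Pr F ≤ 65 * C₂ * (1 / K) := by
      rw [mul_one_div, le_div_iff₀ hK0]; linarith
    have p4 : (((2 * m : ℤ) : ℝ) / ((16 * q : ℤ) : ℝ)) ≤ 1 / K := by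
      rw [hq]; push_cast
      rw [div_le_div_iff₀ (by positivity) hK0]
      nlinarith [mul_pos hm0 hK0]
    have p5 : Pr (ArmT x (2 * m) (16 * q)) ≤ C₁ * (1 / (K : ℝ)) ^ (1 + ε) := by
      refine p1.trans (mul_le_mul_of_nonneg_left (Real.rpow_le_rpow ?_ p4 (by linarith)) hC₁.le)
      rw [hq]; push_cast; positivity
    rw [Pr_armT_trl (0, 0) x]
    have e1 : (1 / (K : ℝ)) ^ (2 + ε) = (1 / (K : ℝ)) ^ (1 + ε) * (1 / K) := by
      rw [show 2 + ε = (1 + ε) + 1 by ring, Real.rpow_add (by positivity), Real.rpow_one]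
    calc _ ≤ (C₁ * (1 / (K : ℝ)) ^ (1 + ε)) * (Pr (ArmT x (256 * q) d) * (65 * C₂ * (1 / K))) :=
          mul_le_mul p5 (mul_le_mul_of_nonneg_left p3 (Pr_nonneg _))
            (mul_nonneg (Pr_nonneg _) (Pr_nonneg _)) (by positivity)
      _ = _ := by rw [e1]; ring
  · rw [Set.disjoint_left]
    rintro v ⟨-, -, v3, -⟩ ⟨-, v4⟩
    omega
  · rw [Set.disjoint_left]
    rintro v ⟨v1, v2, v3, v4⟩ hv
    rcases hv with hv | hv
    · have := hv.2.2.1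
      omega
    · have h1 := hv.1
      simp only [nm] at v4
      omega

lemma far_pairs_subset (A : ℕ → Set Config) {N i l₀ : ℕ} (hi : i < N) :
    A i ∩ {ω | ∃ i', i' + 64 * 2 ^ l₀ ≤ i ∧ ω ∈ A i'} ⊆ ⋃ l ∈ Finset.Ico l₀ N,
      A i ∩ {ω | ∃ i', i' + 64 * 2 ^ l ≤ i ∧ i < i' + 128 * 2 ^ l ∧ ω ∈ A i'} := by
  rintro ω ⟨h1, i', h2, h3⟩
  have hp := Nat.one_le_two_pow (n := l₀)
  have h4 : 2 ^ l₀ ≤ (i - i') / 64 := by omega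
  have h5 : (i - i') / 64 ≠ 0 := by omega
  have h6 := Nat.pow_log_le_self 2 h5
  have h7 := Nat.lt_pow_succ_log_self (b := 2) (by norm_num) ((i - i') / 64)
  have h8 : l₀ ≤ Nat.log 2 ((i - i') / 64) := Nat.le_log_of_pow_le (by norm_num) h4
  rw [pow_succ] at h7
  have h9 := Nat.lt_two_pow_self (n := Nat.log 2 ((i - i') / 64))
  simp only [mem_iUnion]
  exact ⟨_, Finset.mem_Ico.2 ⟨h8, by omega⟩, h1, i', by omega, by omega, h3⟩

lemma sum_Ico_geom_le {q : ℝ} (h0 : 0 ≤ q) (h1 : q < 1) (a b : ℕ) :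
    ∑ l ∈ Finset.Ico a b, q ^ l ≤ q ^ a / (1 - q) := by
  rcases le_total a b with h | h
  · rw [geom_sum_Ico h1.ne h, ← neg_div_neg_eq, neg_sub, neg_sub]
    exact div_le_div_of_nonneg_right (by linarith [pow_nonneg h0 b]) (by linarith)
  · rw [Finset.Ico_eq_empty_of_le h, Finset.sum_empty]
    exact div_nonneg (pow_nonneg h0 a) (by linarith)

/-- The half-plane three-arm bound. -/
theorem Pr_armT : ∃ C : ℝ, 0 < C ∧ ∀ (z : Site) (m d : ℤ), 1 ≤ m → m ≤ d →
    Pr (ArmT z m d) ≤ C * ((m : ℝ) / d) ^ 2 := by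
  obtain ⟨ε, Cp, hε, hCp, hpair⟩ := Pr_pair
  obtain ⟨c, hc, hS⟩ := Pr_armT_le_armS
  obtain ⟨C₃, hC₃, hrow⟩ := Pr_rowArm
  set q : ℝ := (1 / 2 : ℝ) ^ ε with hq
  have hq0 : 0 < q := by positivity
  have hq1 : q < 1 := Real.rpow_lt_one (by norm_num) (by norm_num) hε
  obtain ⟨l₀, hl₀⟩ := exists_pow_lt_of_lt_one
    (show 0 < c * (1 - q) / (2 * (65536 * Cp)) by
      have : 0 < 1 - q := by linarith
      positivity) hq1
  set R : ℕ := 64 * 2 ^ l₀ with hR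
  have hR1 : 1 ≤ R := by have := Nat.one_le_two_pow (n := l₀); omega
  set M : ℝ := 576 + 1152 * R * C₃ / c with hM
  have hM0 : 576 ≤ M := by
    have : 0 ≤ 1152 * R * C₃ / c := by positivity
    linarith
  refine ⟨M, by linarith, fun z m d hm hmd => ?_⟩
  rw [Pr_armT_trl z (0, 0)]
  clear z
  obtain ⟨s, hs⟩ : ∃ s : ℕ, d - m ≤ s := ⟨(d - m).toNat, by omega⟩
  induction s using Nat.strong_induction_on generalizing m with
  | _ s ih =>
  have hm0 : (0 : ℝ) < m := by exact_mod_cast hm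
  have hd0 : (0 : ℝ) < d := by exact_mod_cast (show 0 < d by omega)
  rcases lt_or_ge d (24 * m) with hsmall | hbig
  · have h1 : (1 : ℝ) / 24 ≤ m / d := by
      rw [div_le_div_iff₀ (by norm_num) hd0]
      have : (d : ℝ) < 24 * m := by exact_mod_cast hsmall
      linarith
    have h2 : (1 : ℝ) ≤ 576 * (m / d) ^ 2 := by nlinarith
    have h3 := mul_le_mul_of_nonneg_right hM0 (sq_nonneg ((m : ℝ) / d))
    linarith [Pr_le_one (ArmT (0, 0) m d)]
  obtain ⟨N, hN⟩ : ∃ N : ℕ, (N : ℤ) = d / (12 * m) :=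
    ⟨(d / (12 * m)).toNat, Int.toNat_of_nonneg (Int.ediv_nonneg (by omega) (by omega))⟩
  have hNd : 12 * (m * N) ≤ d := by
    have := Int.mul_ediv_self_le (x := d) (k := 12 * m) (by omega)
    rw [← hN] at this; linarith
  have hNd2 : d < 12 * (m * N) + 12 * m := by
    have := Int.lt_mul_ediv_self_add (x := d) (k := 12 * m) (by omega)
    rw [← hN] at this; linarith
  have hN1 : 1 ≤ N := by
    have : (1 : ℤ) ≤ N := by
      rw [hN]; exact Int.le_ediv_of_mul_le (by omega) (by omega)
    exact_mod_cast this
  have hN0 : (0 : ℝ) < N := by exact_mod_cast hN1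
  set x : ℝ := (m / d : ℝ) with hx
  have hx0 : 0 < x := by positivity
  have hNx : 1 ≤ 24 * (N * x) := by
    have h1 : (d : ℝ) < 12 * (m * N) + 12 * m := by exact_mod_cast hNd2
    have h2 : (1 : ℝ) ≤ N := by exact_mod_cast hN1
    have h3 : (d : ℝ) ≤ 24 * (m * N) := by nlinarith
    rw [hx, ← mul_div_assoc, ← mul_div_assoc, le_div_iff₀ hd0]
    linarith
  set A : ℕ → Set Config := fun i => ArmS (m * (i : ℤ), 0) m d with hA
  have dA : ∀ i < N, Dep (⋃ i ∈ Finset.range N, Lam (m * (i : ℤ), 0) d d) (A i) := fun i hi =>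
    (armS_dep _ _ _).mono (subset_biUnion_of_mem (u := fun i : ℕ => Lam (m * (i : ℤ), 0) d d)
      (Finset.mem_coe.2 (Finset.mem_range.2 hi)))
  have hfin : (⋃ i ∈ Finset.range N, Lam (m * (i : ℤ), 0) d d).Finite :=
    (Finset.finite_toSet _).biUnion fun i _ => Lam_finite _ _ _
  have main := sum_Pr_le_union_add_pairs hfin A N R hR1 dA
  have lower : N * (c * Pr (ArmT (0, 0) m d)) ≤ ∑ i ∈ Finset.range N, Pr (A i) := by
    have h1 : ∀ i ∈ Finset.range N, c * Pr (ArmT (0, 0) m d) ≤ Pr (A i) := fun i _ => by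
      rw [Pr_armT_trl (0, 0) (m * (i : ℤ), 0)]
      exact hS _ m d hm (by omega)
    have h2 := Finset.sum_le_sum h1
    rwa [Finset.sum_const, Finset.card_range, nsmul_eq_mul] at h2
  have union : N * Pr {ω | ∃ i < N, ω ∈ A i} ≤ C₃ := by
    have h1 := hrow (0, 0) m d N hm hN1 hNd
    simp only [RowArm, zero_add] at h1
    exact h1
  have pair : ∀ i < N, ∀ l, Pr (A i ∩ {ω | ∃ i', i' + 64 * 2 ^ l ≤ i ∧ i < i' + 128 * 2 ^ l ∧
      ω ∈ A i'}) ≤ 65536 * Cp * M * x ^ 2 * q ^ l := by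
    intro i hi l
    have hp : 1 ≤ 2 ^ l := Nat.one_le_two_pow
    rcases lt_or_ge (256 * (m * ((2 ^ l : ℕ) : ℤ))) d with hl | hl
    · have h1 := hpair m d (2 ^ l) i hm hp hl
      have hmm : m < 256 * (m * ((2 ^ l : ℕ) : ℤ)) := by
        have : (1 : ℤ) ≤ ((2 ^ l : ℕ) : ℤ) := by exact_mod_cast hp
        nlinarith
      have h2 := ih (s - 1) (by omega) (256 * (m * ((2 ^ l : ℕ) : ℤ))) (by omega) hl.le (by omega)
      refine h1.trans ((mul_le_mul_of_nonneg_left h2 (by positivity)).trans_eq ?_)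
      have hK : (0 : ℝ) < 2 ^ l := by positivity
      push_cast
      have e1 : ((1 : ℝ) / 2 ^ l) ^ (2 + ε) = (1 / 2 ^ l) ^ 2 * q ^ l := by
        rw [Real.rpow_add (by positivity), hq, Real.rpow_two, ← Real.rpow_natCast (_ ^ ε),
          ← Real.rpow_mul (by norm_num), mul_comm ε, Real.rpow_mul (by norm_num),
          Real.rpow_natCast, one_div_pow (2 : ℝ) l]
      rw [e1, hx]
      field_simp
      ring
    · have h1 : (A i ∩ {ω | ∃ i', i' + 64 * 2 ^ l ≤ i ∧ i < i' + 128 * 2 ^ l ∧ ω ∈ A i'}) = ∅ := by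
        refine eq_empty_of_forall_notMem ?_
        rintro ω ⟨-, i', h2, -⟩
        have h3 : m * (12 * N) ≤ m * (256 * ((2 ^ l : ℕ) : ℤ)) := by linarith
        have h4 := le_of_mul_le_mul_left h3 (by omega)
        have h5 : 12 * N ≤ 256 * 2 ^ l := by exact_mod_cast h4
        omega
      rw [h1, Pr_empty]
      have : 0 < M := by linarith
      positivity
  have pairs : ∑ i ∈ Finset.range N, Pr (A i ∩ {ω | ∃ i', i' + R ≤ i ∧ ω ∈ A i'}) ≤
      N * (c / 2 * M * x ^ 2) := by
    have h1 : ∀ i ∈ Finset.range N, Pr (A i ∩ {ω | ∃ i', i' + R ≤ i ∧ ω ∈ A i'}) ≤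
        c / 2 * M * x ^ 2 := fun i hi => by
      have hi' := Finset.mem_range.1 hi
      refine (Pr_mono (far_pairs_subset A (l₀ := l₀) hi')).trans ((Pr_biUnion_le _ _).trans ?_)
      refine (Finset.sum_le_sum fun l _ => pair i hi' l).trans ?_
      rw [← Finset.mul_sum]
      have h2 := sum_Ico_geom_le hq0.le hq1 l₀ N
      have h3 : q ^ l₀ / (1 - q) ≤ c / (2 * (65536 * Cp)) := by
        rw [div_le_iff₀ (by linarith)]
        refine hl₀.le.trans_eq (by ring)
      have hM0' : 0 < M := by linarith
      refine (mul_le_mul_of_nonneg_left (h2.trans h3) (by positivity)).trans_eq ?_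
      field_simp
    have h2 := Finset.sum_le_sum h1
    rwa [Finset.sum_const, Finset.card_range, nsmul_eq_mul] at h2
  have fin1 : N * (c * Pr (ArmT (0, 0) m d)) ≤ N * (R * (C₃ / N ^ 2) + c / 2 * M * x ^ 2) := by
    have h1 : Pr {ω | ∃ i < N, ω ∈ A i} ≤ C₃ / N := by
      rw [le_div_iff₀ hN0]; linarith
    have h2 : (N : ℝ) * (C₃ / N ^ 2) = C₃ / N := by field_simp
    have h3 := mul_le_mul_of_nonneg_left h1 (Nat.cast_nonneg (α := ℝ) R)
    rw [← h2] at h3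
    linarith
  have fin2 := le_of_mul_le_mul_left fin1 hN0
  have fin3 : C₃ / N ^ 2 ≤ 576 * C₃ * x ^ 2 := by
    rw [div_le_iff₀ (by positivity)]
    have h1 : 1 ≤ (24 * (N * x)) ^ 2 := one_le_pow₀ hNx
    nlinarith
  have fin4 := mul_le_mul_of_nonneg_left fin3 (Nat.cast_nonneg (α := ℝ) R)
  have fin5 : c * M = 576 * c + 1152 * R * C₃ := by
    rw [hM]; field_simp
  have fin6 : c * Pr (ArmT (0, 0) m d) ≤ c * (M * x ^ 2) := by
    have h1 : 0 ≤ c * x ^ 2 := by positivity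
    have h2 : c * (M * x ^ 2) = (c * M) * x ^ 2 := by ring
    have h3 : c / 2 * M * x ^ 2 = (c * M) * x ^ 2 / 2 := by ring
    rw [h3] at fin2
    rw [h2]
    rw [fin5] at *
    nlinarith
  exact le_of_mul_le_mul_left fin6 hc

lemma con_of_list {A : Set Site} : ∀ {q : List Site} {a b : Site}, q.IsChain Adj →
    (∀ v ∈ q, v ∈ A) → q.head? = some a → q.getLast? = some b → Con A a b
  | [], _, _, _, _, h, _ => by simp at h
  | [x], a, b, _, hA, h, h' => by
    simp only [List.head?_cons, Option.some.injEq, List.getLast?_singleton] at h h'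
    subst h; subst h'
    exact Con.refl (hA _ (by simp))
  | x :: y :: l, a, b, hc, hA, h, h' => by
    simp only [List.head?_cons, Option.some.injEq] at h
    subst h
    rw [List.isChain_cons_cons] at hc
    rw [List.getLast?_cons_cons] at h'
    have ih := con_of_list (a := y) hc.2 (fun v hv => hA v (List.mem_cons_of_mem _ hv)) rfl h'
    exact (Con.single (hA _ (by simp)) ih.left_mem hc.1).trans ih

lemma con_of_pathIn {S : Set Site} {ω : Config} {q : List Site} {X Y : Set Site}
    {A : Set Site} (hq : PathIn S q) (hA : ∀ v ∈ q, v ∈ A) (hX : FirstIn X q) (hY : LastIn Y q) :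
    ∃ a ∈ X, ∃ b ∈ Y, Con A a b := by
  obtain ⟨a, ha, h1⟩ := hX
  obtain ⟨b, hb, h2⟩ := hY
  exact ⟨a, ha, b, hb, con_of_list hq.1.2.2 hA h1 h2⟩

/-- A pivotal site has a neighbour joined to the top by closed sites not joined to the bottom. -/
lemma pivotal_free {n : ℤ} {ω : Config} {v : Site} (h : Pivotal n ω v) :
    ∃ w t, Adj v w ∧ t.2 = n ∧
      Con (free (rect (-n) n (-n) n) (row (n, -n)) ω) w t := by
  obtain ⟨⟨p, ⟨hp, hop, hl, hr⟩, -⟩, q, -, hq, hcl, hv, ht, -⟩ := h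
  obtain ⟨a, ha, b, hb, hab⟩ := con_of_pathIn (ω := ω) (A := rect (-n) n (-n) n ∩ op ω) hp
    (fun v hv => ⟨hp.2 v hv, hop v hv⟩) hl hr
  obtain ⟨w, hw, t, ht, hwt⟩ := con_of_pathIn (ω := ω) (A := rect (-n) n (-n) n ∩ cl ω) hq
    (fun v hv => ⟨hq.2 v hv, hcl v hv⟩) hv ht
  refine ⟨w, t, hw, ht.2, free_con ⟨hwt.left_mem, ?_⟩ hwt⟩
  rintro ⟨s, hs, hsw⟩
  obtain ⟨x, hx1, hx2⟩ := crossings_meet (x0 := -n) (x1 := n) (y0 := -n) (y1 := n) hab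
    (hsw.trans hwt) (fun v hv => hv.1.2.2) (fun v hv => ⟨hv.1.1, hv.1.2.1⟩) ha.2.le hb.2.ge
    (le_of_eq hs) ht.2.ge
  rw [cl_eq_compl] at hx2
  exact hx2.2 hx1.2

lemma link_Om {P : Set Site} {z u t : Site} {y m d : ℤ} (h : Con P u t) (hu : nm z u ≤ m)
    (ht : d ≤ nm z t) (hmd : m < d) (hP : ∀ v ∈ P, nm z v ≤ d → z.2 ≤ v.2 ∧ v.1 ≤ z.1 + y) :
    Link (P ∩ Om z y m d) (inn z y m) (far z d) := by
  obtain ⟨b, hb, h1⟩ := h.hit (nm z) (fun _ _ h => (nm_step z h).1) (hu.trans hmd.le) ht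
  obtain ⟨a, a', h2, h3, h4, h5⟩ := h1.leave (H := {x | nm z x ≤ m}) hu
    (by simp only [Set.mem_ofPred_eq]; omega)
  have h6 := hP a h2.1 h2.2
  refine ⟨a', b, ⟨a, ⟨h6.1, h6.2, h3⟩, h4⟩, hb.ge, h5.mono ?_⟩
  rintro x ⟨⟨hx1, hx2⟩, hx3⟩
  have h7 := hP x hx1 hx2
  exact ⟨hx1, h7.1, h7.2, by simpa using hx3, hx2⟩

lemma freeArm_of_con {n : ℤ} {ω : Config} {z w t : Site} {y m d : ℤ} {src : Set Site}
    (h : Con (free (rect (-n) n (-n) n) (row (n, -n)) ω) w t) (ht : t.2 = n) (hz : z.2 = -n)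
    (hd : d ≤ n) (hl : -n ≤ z.1 - d) (hr : z.1 + min y d ≤ n) (hy : y = d ∨ z.1 + y = n)
    (hsrc : src ⊆ row z) (hw : nm z w ≤ m) (hmd : m < d) :
    ω ∈ FreeArm (Om z y m d) src (inn z y m) (far z d) := by
  have hn : 0 ≤ n := by
    obtain ⟨h1, h2, -⟩ := h.left_mem.1.1
    omega
  have h1 := link_Om (y := y) (z := z) (m := m) (d := d) h hw (by simp only [nm]; omega) hmd ?_
  · refine Link.of_subset ?_ h1
    rintro x ⟨hx1, hx2⟩
    refine free_mono ?_ ?_ ⟨hx1, hx2⟩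
    · rintro v ⟨v1, v2, v3, v4⟩
      simp only [nm] at v4
      exact ⟨by omega, by omega, by omega, by omega⟩
    · intro v hv
      exact (hsrc hv).trans hz
  · rintro v hv v4
    obtain ⟨v1, v2, v3, -⟩ := hv.1.1
    simp only [nm] at v4
    exact ⟨by omega, by omega⟩

lemma bl_subset_row (z : Site) : bl z ⊆ row z := fun _ h => h.1

/-- The probability of the four arms produced by two pivotal sites near the bottom side. -/
lemma Pr_two_pivotals : ∃ α C : ℝ, 0 < α ∧ 0 < C ∧ ∀ n m d₁ d₂ x₁ x₂ : ℤ, 1 ≤ m → m ≤ d₂ →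
    32 * d₂ ≤ d₁ → d₁ ≤ n → n - d₁ < x₁ → 2 * x₁ ≤ 2 * n - d₁ → x₂ ≤ n →
    (16 * m < d₂ → 2 * x₂ ≤ 2 * n - d₂) → n - d₂ < x₂ - m + 1 →  n - d₁ < x₁ - m + 1 →
    Pr {ω | (∃ v, Pivotal n ω v ∧ x₁ - m < v.1 ∧ v.1 ≤ x₁ ∧ -n ≤ v.2 ∧ v.2 ≤ -n + m) ∧
      ∃ v, Pivotal n ω v ∧ x₂ - m < v.1 ∧ v.1 ≤ x₂ ∧ -n ≤ v.2 ∧ v.2 ≤ -n + m} ≤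
      C * ((m / d₁ : ℝ) ^ 2 * (m / d₂ : ℝ) ^ 2 * (d₂ / d₁ : ℝ) ^ (1 + α) *
        (d₁ / n : ℝ) ^ (1 + α)) := by
  obtain ⟨α, Ca, hα, hCa, harmA⟩ := ArmA_corner
  obtain ⟨Ct, hCt, harmT⟩ := Pr_armT
  set CT := max 1 Ct with hCT
  set CA := max 1 Ca with hCA
  have hCT1 : 1 ≤ CT := le_max_left _ _
  have hCA1 : 1 ≤ CA := le_max_left _ _
  refine ⟨α, (CT * 1024) * (CT * 1024) * (CA * 32 ^ (1 + α)) * (CA * 2 ^ (1 + α)), hα,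
    by positivity, ?_⟩
  intro n m d₁ d₂ x₁ x₂ hm hmd hdd hdn hx1 hx1' hx2' hx2'' hx2 hx1b
  have hm0 : (0 : ℝ) < m := by exact_mod_cast hm
  have h2m : (m : ℝ) ≤ d₂ := by exact_mod_cast hmd
  have h21 : (32 * d₂ : ℝ) ≤ d₁ := by exact_mod_cast hdd
  have h1n : (d₁ : ℝ) ≤ n := by exact_mod_cast hdn
  set T : ℤ → ℤ → Set Config := fun x d => {ω | 2 * m < d / 8 → ω ∈ ArmT (x, -n) (2 * m) (d / 8)}
    with hT
  set A₁ : Set Config := {ω | 2 * d₂ < d₁ / 8 → ω ∈ ArmA (n, -n) 0 (2 * d₂) (d₁ / 8)} with hA₁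
  set A₀ : Set Config := {ω | 2 * d₁ < n → ω ∈ ArmA (n, -n) 0 (2 * d₁) n} with hA₀
  have hsub : {ω | (∃ v, Pivotal n ω v ∧ x₁ - m < v.1 ∧ v.1 ≤ x₁ ∧ -n ≤ v.2 ∧ v.2 ≤ -n + m) ∧
      ∃ v, Pivotal n ω v ∧ x₂ - m < v.1 ∧ v.1 ≤ x₂ ∧ -n ≤ v.2 ∧ v.2 ≤ -n + m} ⊆
      T x₁ d₁ ∩ (T x₂ d₂ ∩ (A₁ ∩ A₀)) := by
    rintro ω ⟨⟨v, hv, v1, v2, v3, v4⟩, u, hu, u1, u2, u3, u4⟩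
    obtain ⟨w, t, hvw, ht, h⟩ := pivotal_free hv
    obtain ⟨w', t', huw, ht', h'⟩ := pivotal_free hu
    have b1 := adj_bound hvw
    have b2 := adj_bound huw
    have b3 := h.left_mem.1.1
    have b4 := h'.left_mem.1.1
    obtain ⟨c1, c2, c3, c4⟩ := b3
    obtain ⟨e1, e2, e3, e4⟩ := b4
    refine ⟨fun hd => ?_, fun hd => ?_, fun hd => ?_, fun hd => ?_⟩
    · exact freeArm_of_con h ht rfl (by omega) (by simp only; omega) (by simp only; omega)
        (Or.inl rfl) Subset.rfl (by simp only [nm]; omega) hd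
    · exact freeArm_of_con h' ht' rfl (by omega) (by simp only; omega) (by simp only; omega)
        (Or.inl rfl) Subset.rfl (by simp only [nm]; omega) hd
    · exact freeArm_of_con h' ht' rfl (by omega) (by simp only; omega) (by simp only; omega)
        (Or.inr (by simp)) (bl_subset_row _) (by simp only [nm]; omega) hd
    · exact freeArm_of_con h ht rfl (by omega) (by simp only; omega) (by simp only; omega)
        (Or.inr (by simp)) (bl_subset_row _) (by simp only [nm]; omega) hd
  set D : ℤ → ℤ → Set Site := fun x d => {v | 2 * m < d / 8 ∧ v ∈ Om (x, -n) (d / 8) (2 * m) (d / 8)}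
  have fin : ∀ x d, (D x d).Finite := fun x d => (Om_finite _ _ _ _).subset fun v hv => hv.2
  have dT : ∀ x d, Dep (D x d) (T x d) := fun x d => dep_of_imp fun ω ω' h h' hd =>
    ((freeArm_dep _ _ _ _) ω ω' fun v hv => h v ⟨hd, hv⟩).1 (h' hd)
  have dA₁ : Dep (Om (n, -n) 0 (2 * d₂) (d₁ / 8)) A₁ := dep_of_imp fun ω ω' h h' hd =>
    ((freeArm_dep _ _ _ _) ω ω' h).1 (h' hd)
  have dA₀ : Dep (Om (n, -n) 0 (2 * d₁) n) A₀ := dep_of_imp fun ω ω' h h' hd =>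
    ((freeArm_dep _ _ _ _) ω ω' h).1 (h' hd)
  have pT : ∀ x d : ℤ, m ≤ d → Pr (T x d) ≤ CT * 1024 * (m / d : ℝ) ^ 2 := by
    intro x d hd
    have hd0 : (0 : ℝ) < d := by exact_mod_cast (by omega : 0 < d)
    rcases lt_or_ge (2 * m) (d / 8) with h | h
    · have h1 : T x d ⊆ ArmT (x, -n) (2 * m) (d / 8) := fun ω hω => hω h
      have h2 := (Pr_mono h1).trans (harmT _ _ _ (by omega) h.le)
      have h3 : (((2 * m : ℤ) : ℝ) / ((d / 8 : ℤ) : ℝ)) ≤ 32 * (m / d) := by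
        have h4 : (d : ℝ) ≤ 16 * ((d / 8 : ℤ) : ℝ) := by
          exact_mod_cast (by omega : d ≤ 16 * (d / 8))
        rw [← mul_div_assoc, div_le_div_iff₀ (by linarith) hd0]
        push_cast
        nlinarith
      have h0 : 0 ≤ (((2 * m : ℤ) : ℝ) / ((d / 8 : ℤ) : ℝ)) :=
        div_nonneg (by exact_mod_cast (by omega)) (by exact_mod_cast (by omega))
      have h4 := pow_le_pow_left₀ h0 h3 2
      calc _ ≤ _ := h2
        _ ≤ CT * (32 * (m / d)) ^ 2 := mul_le_mul (le_max_right _ _) h4 (sq_nonneg _) (by linarith)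
        _ = _ := by ring
    · have h1 : (1 : ℝ) ≤ 32 * (m / d) := by
        rw [← mul_div_assoc, le_div_iff₀ hd0]
        exact_mod_cast (by omega : 1 * d ≤ 32 * m)
      have h2 : 1 ≤ 1024 * (m / d : ℝ) ^ 2 := by nlinarith
      have h3 := mul_le_mul hCT1 h2 zero_le_one (by linarith)
      linarith [Pr_le_one (T x d)]
  have pA : ∀ a d : ℤ, 1 ≤ a → 1 ≤ d → ∀ b : ℝ, (a / d : ℝ) ≤ b → Pr {ω | a < d →
      ω ∈ ArmA (n, -n) 0 a d} ≤ CA * b ^ (1 + α) := by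
    intro a d ha hd b hb
    have hd0 : (0 : ℝ) < d := by exact_mod_cast hd
    have ha0 : (0 : ℝ) < a := by exact_mod_cast ha
    have h0 : (0 : ℝ) ≤ a / d := by positivity
    rcases lt_or_ge a d with h | h
    · have h1 : {ω | a < d → ω ∈ ArmA (n, -n) 0 a d} ⊆ ArmA (n, -n) 0 a d := fun ω hω => hω h
      refine (Pr_mono h1).trans ((harmA _ _ _ ha h.le).trans ?_)
      exact mul_le_mul (le_max_right _ _) (Real.rpow_le_rpow h0 hb (by linarith))
        (Real.rpow_nonneg h0 _) (by linarith)
    · have h1 : (1 : ℝ) ≤ a / d := by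
        rw [le_div_iff₀ hd0, one_mul]; exact_mod_cast h
      have h2 := Real.one_le_rpow (h1.trans hb) (show 0 ≤ 1 + α by linarith)
      have h3 := mul_le_mul hCA1 h2 zero_le_one (by linarith)
      linarith [Pr_le_one {ω | a < d → ω ∈ ArmA (n, -n) 0 a d}]
  have pA₁ : Pr A₁ ≤ CA * 32 ^ (1 + α) * (d₂ / d₁ : ℝ) ^ (1 + α) := by
    rw [mul_assoc, ← Real.mul_rpow (by norm_num) (div_nonneg (by linarith) (by linarith))]
    refine pA _ _ (by omega) (by omega) _ ?_
    have h4 : (d₁ : ℝ) ≤ 16 * ((d₁ / 8 : ℤ) : ℝ) := by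
      exact_mod_cast (by omega : d₁ ≤ 16 * (d₁ / 8))
    rw [← mul_div_assoc, div_le_div_iff₀ (by linarith) (by linarith)]
    push_cast
    nlinarith
  have pA₀ : Pr A₀ ≤ CA * 2 ^ (1 + α) * (d₁ / n : ℝ) ^ (1 + α) := by
    rw [mul_assoc, ← Real.mul_rpow (by norm_num) (div_nonneg (by linarith) (by linarith))]
    refine pA _ _ (by omega) (by omega) _ ?_
    push_cast
    rw [mul_div_assoc]
  refine (Pr_mono hsub).trans ?_
  rw [Pr_indep (fin _ _) ?_ (dT x₁ d₁) (((dT x₂ d₂).mono subset_union_left).inter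
      ((((dA₁.mono subset_union_left).inter (dA₀.mono subset_union_right))).mono
        subset_union_right)),
    Pr_indep (fin _ _) ?_ (dT x₂ d₂)
      ((dA₁.mono subset_union_left).inter (dA₀.mono subset_union_right)),
    Pr_indep (Om_finite _ _ _ _) ?_ dA₁ dA₀]
  · have i1 := pT x₁ d₁ (by omega)
    have i2 := pT x₂ d₂ hmd
    have hh : ∀ {a b : ℝ} {k : ℝ}, 0 ≤ a → 0 ≤ b → 0 ≤ (a / b) ^ k := fun ha hb =>
      Real.rpow_nonneg (div_nonneg ha hb) _
    calc _ ≤ (CT * 1024 * (m / d₁ : ℝ) ^ 2) * ((CT * 1024 * (m / d₂ : ℝ) ^ 2) *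
          ((CA * 32 ^ (1 + α) * (d₂ / d₁ : ℝ) ^ (1 + α)) *
            (CA * 2 ^ (1 + α) * (d₁ / n : ℝ) ^ (1 + α)))) := by
          have q0 : 0 ≤ CA * 32 ^ (1 + α) * (d₂ / d₁ : ℝ) ^ (1 + α) := (Pr_nonneg _).trans pA₁
          have q1 := mul_le_mul pA₁ pA₀ (Pr_nonneg _) q0
          have q2 : 0 ≤ CT * 1024 * (m / d₂ : ℝ) ^ 2 := by positivity
          have q3 := mul_le_mul i2 q1 (mul_nonneg (Pr_nonneg _) (Pr_nonneg _)) q2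
          exact mul_le_mul i1 q3 (mul_nonneg (Pr_nonneg _) (mul_nonneg (Pr_nonneg _)
            (Pr_nonneg _))) (by positivity)
      _ = _ := by ring
  · rw [Set.disjoint_left]
    rintro v ⟨-, -, v3, v4⟩ ⟨-, -, v5, v6⟩
    omega
  · rw [Set.disjoint_left]
    rintro v ⟨hd, v1, v2, v3, v4⟩ (hv | hv)
    all_goals
      obtain ⟨w1, w2, w3, w4⟩ := hv
      simp only [nm] at v3 v4 w3 w4
      omega
  · rw [Set.disjoint_left]
    rintro v ⟨hd, v1, v2, v3, v4⟩ (⟨hd', hv⟩ | hv | hv)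
    all_goals
      obtain ⟨w1, w2, w3, w4⟩ := hv
      simp only [nm] at v3 v4 w3 w4
      omega

lemma Iset_bounds {j₀ i₀ j k : ℕ} (hi : i₀ ≤ j₀) (hj : j ≤ i₀)
    (h : Set.Ioc (-((2 ^ j₀ : ℕ) : ℤ) + ((k : ℤ) - 1) * ((2 ^ (j₀ - i₀) : ℕ) : ℤ))
      (-((2 ^ j₀ : ℕ) : ℤ) + (k : ℤ) * ((2 ^ (j₀ - i₀) : ℕ) : ℤ)) ⊆ Iset j₀ i₀ j) :
    (2 : ℤ) ^ j₀ - 2 ^ (j₀ - j) < -2 ^ j₀ + k * 2 ^ (j₀ - i₀) - 2 ^ (j₀ - i₀) + 1 ∧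
    -2 ^ j₀ + (k : ℤ) * 2 ^ (j₀ - i₀) ≤ 2 ^ j₀ ∧
    (j ≠ i₀ → 2 * (-2 ^ j₀ + (k : ℤ) * 2 ^ (j₀ - i₀)) ≤ 2 * 2 ^ j₀ - 2 ^ (j₀ - j)) := by
  push_cast at h
  have hm : (1 : ℤ) ≤ 2 ^ (j₀ - i₀) := one_le_pow₀ (by norm_num)
  rw [sub_mul, one_mul] at h
  have h1 := h (a := -2 ^ j₀ + (k : ℤ) * 2 ^ (j₀ - i₀)) ⟨by linarith, le_rfl⟩
  have h2 := h (a := -2 ^ j₀ + (k : ℤ) * 2 ^ (j₀ - i₀) - 2 ^ (j₀ - i₀) + 1)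
    ⟨by linarith, by linarith⟩
  unfold Iset at h1 h2
  split_ifs at h1 h2 with hc
  · subst hc
    exact ⟨h2.1, h1.2, fun h => absurd rfl h⟩
  · have e : (2 : ℤ) ^ (j₀ - j) = 2 * 2 ^ (j₀ - j - 1) := by
      rw [← pow_succ', show j₀ - j - 1 + 1 = j₀ - j by omega]
    have hp : (0 : ℤ) < 2 ^ (j₀ - j - 1) := by positivity
    exact ⟨h2.1, by linarith [h1.2], fun _ => by linarith [h1.2]⟩

lemma rpow_exponent {α : ℝ} {j₀ i₀ j₁ j₂ : ℕ} (hi : i₀ ≤ j₀) (h1 : j₁ ≤ j₀) (h2 : j₂ ≤ j₀) :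
    ((2 ^ (j₀ - i₀) : ℝ) / 2 ^ (j₀ - j₁)) ^ 2 * ((2 ^ (j₀ - i₀) : ℝ) / 2 ^ (j₀ - j₂)) ^ 2 *
      ((2 ^ (j₀ - j₂) : ℝ) / 2 ^ (j₀ - j₁)) ^ (1 + α) * ((2 ^ (j₀ - j₁) : ℝ) / 2 ^ j₀) ^ (1 + α) =
    ((2 ^ (j₀ - i₀) : ℝ) / 2 ^ j₀) ^ 4 * (2 : ℝ) ^ (2 * (j₁ : ℝ) + (1 - α) * (j₂ : ℝ)) := by
  have p2 : (0 : ℝ) < 2 := by norm_num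
  rw [mul_assoc, ← Real.mul_rpow (by positivity) (by positivity),
    div_mul_div_cancel₀ (by positivity)]
  have e : ∀ j : ℕ, j ≤ j₀ → (2 ^ (j₀ - j) : ℝ) = 2 ^ ((j₀ : ℝ) - j) := fun j hj => by
    rw [← Nat.cast_sub hj, Real.rpow_natCast]
  have e0 : (2 ^ j₀ : ℝ) = 2 ^ (j₀ : ℝ) := (Real.rpow_natCast _ _).symm
  rw [e _ hi, e _ h1, e _ h2, e0]
  simp only [← Real.rpow_sub p2, ← Real.rpow_natCast, ← Real.rpow_mul p2.le, ← Real.rpow_add p2]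
  congr 1
  push_cast
  ring

end TriPerc

open TriPerc

/-- Second-moment estimate, case (ii) `j₂ - j₁ ≥ 5`:
`P(Q_n ∩ H_{k₁} ≠ ∅, Q_n ∩ H_{k₂} ≠ ∅) ≤ C·(m/n)⁴·2^{2j₁+(1-α)j₂}`. -/
theorem statement11 :
    ∃ α : ℝ, 0 < α ∧ ∃ C : ℝ≥0∞, C < ⊤ ∧
      ∀ μ : Measure Config, IsBernoulliHalf μ →
        ∀ j₀ i₀ : ℕ, i₀ ≤ j₀ →
          ∀ n m : ℕ, n = 2 ^ j₀ → m = 2 ^ (j₀ - i₀) →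
            ∀ k₁ k₂ j₁ j₂ : ℕ,
              1 ≤ k₁ → k₁ < k₂ → k₂ ≤ 2 ^ (i₀ + 1) →
              j₁ + 5 ≤ j₂ → j₂ ≤ i₀ →
              Set.Ioc (-(n : ℤ) + ((k₁ : ℤ) - 1) * (m : ℤ))
                  (-(n : ℤ) + (k₁ : ℤ) * (m : ℤ)) ⊆ Iset j₀ i₀ j₁ →
              Set.Ioc (-(n : ℤ) + ((k₂ : ℤ) - 1) * (m : ℤ))
                  (-(n : ℤ) + (k₂ : ℤ) * (m : ℤ)) ⊆ Iset j₀ i₀ j₂ →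
              μ {ω | (Qset (n : ℤ) ω ∩ Hblock (n : ℤ) (m : ℤ) k₁).Nonempty ∧
                  (Qset (n : ℤ) ω ∩ Hblock (n : ℤ) (m : ℤ) k₂).Nonempty} ≤
                C * ((m : ℝ≥0∞) / (n : ℝ≥0∞)) ^ 4 *
                  (2 : ℝ≥0∞) ^ (2 * (j₁ : ℝ) + (1 - α) * (j₂ : ℝ)) := by
  obtain ⟨α, C, hα, hC, main⟩ := Pr_two_pivotals
  refine ⟨α, hα, ENNReal.ofReal C, ENNReal.ofReal_lt_top, ?_⟩
  intro μ hμ j₀ i₀ hi n m hn hm k₁ k₂ j₁ j₂ hk₁ hk hk₂ hj hj₂ hI₁ hI₂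
  subst hn hm
  obtain ⟨a1, a2, a3⟩ := Iset_bounds hi (by omega) hI₁
  obtain ⟨b1, b2, b3⟩ := Iset_bounds hi hj₂ hI₂
  have a3' := a3 (by omega)
  have hm1 : (1 : ℤ) ≤ 2 ^ (j₀ - i₀) := one_le_pow₀ (by norm_num)
  have hmd : (2 : ℤ) ^ (j₀ - i₀) ≤ 2 ^ (j₀ - j₂) := pow_le_pow_right₀ (by norm_num) (by omega)
  have hdd : 32 * (2 : ℤ) ^ (j₀ - j₂) ≤ 2 ^ (j₀ - j₁) := by
    have : (2 : ℤ) ^ (5 + (j₀ - j₂)) ≤ 2 ^ (j₀ - j₁) := pow_le_pow_right₀ (by norm_num) (by omega)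
    rw [pow_add] at this
    linarith
  have hdn : (2 : ℤ) ^ (j₀ - j₁) ≤ 2 ^ j₀ := pow_le_pow_right₀ (by norm_num) (by omega)
  have key := main (2 ^ j₀) (2 ^ (j₀ - i₀)) (2 ^ (j₀ - j₁)) (2 ^ (j₀ - j₂))
    (-2 ^ j₀ + k₁ * 2 ^ (j₀ - i₀)) (-2 ^ j₀ + k₂ * 2 ^ (j₀ - i₀)) hm1 hmd hdd hdn (by linarith)
    a3' b2 (fun h => b3 fun e => by rw [e] at h; omega) (by linarith) (by linarith)
  push_cast at key
  rw [rpow_exponent hi (by omega) (by omega)] at key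
  rw [eq_mu0 hμ]
  have key' := (ofReal_measureReal (μ := mu0)).symm.trans_le (ENNReal.ofReal_le_ofReal key)
  refine (measure_mono ?_).trans (key'.trans_eq ?_)
  · intro ω hω
    push_cast at hω
    obtain ⟨⟨v, hv, v1, v2, v3, v4⟩, u, hu, u1, u2, u3, u4⟩ := hω
    exact ⟨⟨v, hv, by linarith, v2, v3, v4⟩, u, hu, by linarith, u2, u3, u4⟩
  · rw [ENNReal.ofReal_mul hC.le, ENNReal.ofReal_mul (by positivity), ENNReal.ofReal_pow
      (by positivity), ENNReal.ofReal_div_of_pos (by positivity), ← mul_assoc,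
      ← ENNReal.ofReal_rpow_of_pos (by norm_num)]
    simp [ENNReal.ofReal_pow]
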